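/- arXiv:1512.06001 — 3 statements merged into one kernel-verified Lean document; each statement's English description precedes it below -/
import Mathlib

section
/- Let R be any ring, let Ch(R) be the category of chain complexes of left R-modules, let dwℐ be the class of complexes all of whose components are injective R-modules, and let 𝒲_co = ^⊥(dwℐ) = {W : Ext¹(W, I) = 0 for all I ∈ dwℐ} (the coacyclic complexes). Then: (1) (𝒲_co, dwℐ) is a complete hereditary cotorsion pair in Ch(R); (2) 𝒲_co is a thick class; (3) 𝒲_co ∩ dwℐ is exactly the class of injective objects of Ch(R), i.e., the split exact complexes with injective components; (4) every contractible complex lies in 𝒲_co, and every complex in 𝒲_co is exact. -/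
open CategoryTheory Limits ZeroObject

namespace AbModel

variable {A : Type*} [Category A] [Abelian A]

/-- `0 → X₁ → X₂ → X₃ → 0` given by `f, g` is a short exact sequence. -/
def IsSES {X₁ X₂ X₃ : A} (f : X₁ ⟶ X₂) (g : X₂ ⟶ X₃) : Prop :=
  ∃ w : f ≫ g = 0, (ShortComplex.mk f g w).ShortExact

/-- There exists a short exact sequence `0 → X₁ → X₂ → X₃ → 0`. -/
def SES (X₁ X₂ X₃ : A) : Prop :=
  ∃ (f : X₁ ⟶ X₂) (g : X₂ ⟶ X₃), IsSES f g

/-- `Ext¹(X, Y) = 0`, expressed as: every short exact sequence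
`0 → Y → Z → X → 0` splits. -/
def Ext1IsZero (X Y : A) : Prop :=
  ∀ ⦃Z : A⦄ (f : Y ⟶ Z) (g : Z ⟶ X) (w : f ≫ g = 0),
    (ShortComplex.mk f g w).ShortExact → Nonempty (ShortComplex.mk f g w).Splitting

/-- The right `Ext¹`-orthogonal class of a class of objects. -/
def rightPerp (S : Set A) : Set A := {Y | ∀ X ∈ S, Ext1IsZero X Y}

/-- The left `Ext¹`-orthogonal class of a class of objects. -/
def leftPerp (S : Set A) : Set A := {X | ∀ Y ∈ S, Ext1IsZero X Y}

/-- `(X, Y)` is a cotorsion pair. -/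
def IsCotorsionPair (X Y : Set A) : Prop :=
  X = leftPerp Y ∧ Y = rightPerp X

/-- Completeness of a pair of classes: every object has the two approximation
short exact sequences. -/
def IsCompletePair (X Y : Set A) : Prop :=
  (∀ M : A, ∃ Q W : A, Q ∈ X ∧ W ∈ Y ∧ SES W Q M) ∧
  (∀ M : A, ∃ Q W : A, Q ∈ X ∧ W ∈ Y ∧ SES M W Q)

/-- `(X, Y)` is a complete cotorsion pair. -/
def IsCompleteCotorsionPair (X Y : Set A) : Prop :=
  IsCotorsionPair X Y ∧ IsCompletePair X Y

/-- The hereditary condition on a pair of classes: the left class is closed under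
kernels of epimorphisms between its objects, and the right class is closed under
cokernels of monomorphisms between its objects. -/
def IsHereditaryPair (X Y : Set A) : Prop :=
  (∀ ⦃K B B' : A⦄, B ∈ X → B' ∈ X → SES K B B' → K ∈ X) ∧
  (∀ ⦃B B' Q : A⦄, B ∈ Y → B' ∈ Y → SES B B' Q → Q ∈ Y)

/-- A thick class: closed under direct summands (retracts) and satisfying
two-out-of-three for short exact sequences. -/
def IsThick (W : Set A) : Prop :=
  (∀ ⦃X Y : A⦄, Y ∈ W → (∃ (i : X ⟶ Y) (r : Y ⟶ X), i ≫ r = 𝟙 X) → X ∈ W) ∧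
  (∀ ⦃X Y Z : A⦄, SES X Y Z →
    (X ∈ W → Y ∈ W → Z ∈ W) ∧ (X ∈ W → Z ∈ W → Y ∈ W) ∧ (Y ∈ W → Z ∈ W → X ∈ W))

/-- A Hovey triple `(Q, W, R)`: `W` is thick and `(Q, W ∩ R)`, `(Q ∩ W, R)` are
complete cotorsion pairs. -/
def IsHoveyTriple (Q W R : Set A) : Prop :=
  IsThick W ∧ IsCompleteCotorsionPair Q (W ∩ R) ∧ IsCompleteCotorsionPair (Q ∩ W) R

/-- A hereditary Hovey triple. -/
def IsHereditaryHoveyTriple (Q W R : Set A) : Prop :=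
  IsHoveyTriple Q W R ∧ IsHereditaryPair Q (W ∩ R) ∧ IsHereditaryPair (Q ∩ W) R

end AbModel

open AbModel

section Ext1

variable {A : Type*} [Category A] [Abelian A]

lemma ext1IsZero_iff_exists_section {X Y : A} :
    Ext1IsZero X Y ↔ ∀ ⦃Z : A⦄ (f : Y ⟶ Z) (g : Z ⟶ X), IsSES f g → ∃ s, s ≫ g = 𝟙 X := by
  constructor
  · rintro h Z f g ⟨w, hS⟩
    obtain ⟨σ⟩ := h f g w hS
    exact ⟨σ.s, σ.s_g⟩
  · intro h Z f g w hS
    obtain ⟨s, hs⟩ := h f g ⟨w, hS⟩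
    exact ⟨.ofExactOfSection _ hS.exact s hs hS.mono_f⟩

lemma ext1IsZero_iff_exists_retraction {X Y : A} :
    Ext1IsZero X Y ↔ ∀ ⦃Z : A⦄ (f : Y ⟶ Z) (g : Z ⟶ X), IsSES f g → ∃ r, f ≫ r = 𝟙 Y := by
  constructor
  · rintro h Z f g ⟨w, hS⟩
    obtain ⟨σ⟩ := h f g w hS
    exact ⟨σ.r, σ.f_r⟩
  · intro h Z f g w hS
    obtain ⟨r, hr⟩ := h f g ⟨w, hS⟩
    exact ⟨.ofExactOfRetraction _ hS.exact r hr hS.epi_g⟩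

/-- Morphisms from `X` lift along an epimorphism whose kernel is `Ext¹`-orthogonal to `X`. -/
lemma exists_lift_of_ext1IsZero {X Y P Z : A} (h : Ext1IsZero X Y) {f : Y ⟶ P} {g : P ⟶ Z}
    (hfg : IsSES f g) (u : X ⟶ Z) : ∃ v : X ⟶ P, v ≫ g = u := by
  obtain ⟨w, hS⟩ := hfg
  have : Epi g := hS.epi_g
  have : Mono f := hS.mono_f
  let k : Y ⟶ pullback g u := pullback.lift f 0 (by simp [w])
  have hk : k ≫ pullback.snd g u = 0 := pullback.lift_snd _ _ _
  have : Mono k := mono_of_mono_fac (pullback.lift_fst f 0 (by simp [w]) : k ≫ _ = f)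
  have hSES : (ShortComplex.mk k (pullback.snd g u) hk).ShortExact :=
    { exact := ShortComplex.exact_of_f_is_kernel _ <|
        KernelFork.IsLimit.ofι' k hk fun {B} b hb ↦
          ⟨hS.exact.lift (b ≫ pullback.fst g u)
            (by simp [pullback.condition, reassoc_of% hb]), by
            apply pullback.hom_ext
            · rw [Category.assoc, pullback.lift_fst]
              exact hS.exact.lift_f _ _
            · rw [Category.assoc, hk, comp_zero, hb]⟩ }
  obtain ⟨s, hs⟩ := ext1IsZero_iff_exists_section.1 h k (pullback.snd g u) ⟨hk, hSES⟩
  exact ⟨s ≫ pullback.fst g u, by rw [Category.assoc, pullback.condition, reassoc_of% hs]⟩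

/-- Morphisms to `Y` extend along a monomorphism whose cokernel is `Ext¹`-orthogonal to `Y`. -/
lemma exists_extension_of_ext1IsZero {X Y P Z : A} (h : Ext1IsZero X Y) {f : Z ⟶ P} {g : P ⟶ X}
    (hfg : IsSES f g) (u : Z ⟶ Y) : ∃ v : P ⟶ Y, f ≫ v = u := by
  obtain ⟨w, hS⟩ := hfg
  have : Epi g := hS.epi_g
  have : Mono f := hS.mono_f
  let k : pushout f u ⟶ X := pushout.desc g 0 (by simp [w])
  have hk : pushout.inr f u ≫ k = 0 := pushout.inr_desc _ _ _
  have : Epi k := epi_of_epi_fac (pushout.inl_desc g 0 (by simp [w]) : _ ≫ k = g)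
  have hSES : (ShortComplex.mk (pushout.inr f u) k hk).ShortExact :=
    { exact := ShortComplex.exact_of_g_is_cokernel _ <|
        CokernelCofork.IsColimit.ofπ' k hk fun {B} b hb ↦
          ⟨hS.exact.desc (pushout.inl f u ≫ b)
            (by simp [pushout.condition_assoc, hb]), by
            apply pushout.hom_ext
            · rw [pushout.inl_desc_assoc]
              exact hS.exact.g_desc _ _
            · rw [reassoc_of% hk, zero_comp, hb]⟩ }
  obtain ⟨r, hr⟩ := ext1IsZero_iff_exists_retraction.1 h (pushout.inr f u) k ⟨hk, hSES⟩
  exact ⟨pushout.inl f u ≫ r, by rw [pushout.condition_assoc, hr, Category.comp_id]⟩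

lemma IsSES.of_mono {X Y : A} (f : X ⟶ Y) [Mono f] : IsSES f (cokernel.π f) :=
  ⟨cokernel.condition f, { exact := ShortComplex.exact_cokernel f }⟩

lemma IsSES.of_epi {X Y : A} (f : X ⟶ Y) [Epi f] : IsSES (kernel.ι f) f :=
  ⟨kernel.condition f, { exact := ShortComplex.exact_kernel f }⟩

lemma subset_rightPerp_leftPerp (S : Set A) : S ⊆ rightPerp (leftPerp S) :=
  fun Y hY _ hX ↦ hX Y hY

lemma mem_leftPerp_of_retract {S : Set A} {X Y : A} (hY : Y ∈ leftPerp S) (i : X ⟶ Y) (r : Y ⟶ X)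
    (hir : i ≫ r = 𝟙 X) : X ∈ leftPerp S := by
  intro I hI
  rw [ext1IsZero_iff_exists_section]
  intro Z f g hfg
  obtain ⟨s, hs⟩ := exists_lift_of_ext1IsZero (hY I hI) hfg r
  exact ⟨i ≫ s, by rw [Category.assoc, hs, hir]⟩

lemma ext1IsZero_of_forall_exists_lift {X I E J : A} [Injective E] {j : I ⟶ E} {q : E ⟶ J}
    (hjq : IsSES j q) (h : ∀ b : X ⟶ J, ∃ c : X ⟶ E, c ≫ q = b) : Ext1IsZero X I := by
  rw [ext1IsZero_iff_exists_retraction]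
  rintro T f g ⟨w, hT⟩
  obtain ⟨w', hS⟩ := hjq
  have : Mono f := hT.mono_f
  have : Mono j := hS.mono_f
  have : Epi g := hT.epi_g
  let a : T ⟶ E := Injective.factorThru j f
  have ha : f ≫ a = j := Injective.comp_factorThru _ _
  have haq : f ≫ a ≫ q = 0 := by rw [reassoc_of% ha, w']
  obtain ⟨c, hc⟩ := h (hT.exact.desc (a ≫ q) haq)
  have hb : g ≫ hT.exact.desc (a ≫ q) haq = a ≫ q := hT.exact.g_desc _ _
  have hl : (a - g ≫ c) ≫ q = 0 := by simp [hc, hb]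
  have hr : hS.exact.lift (a - g ≫ c) hl ≫ j = a - g ≫ c := hS.exact.lift_f _ _
  refine ⟨hS.exact.lift (a - g ≫ c) hl, ?_⟩
  rw [← cancel_mono j, Category.assoc, hr]
  simp [ha, reassoc_of% w]

/-- If every object of `S` is the first term of a short exact sequence with injective middle term
and last term in `S`, and the last term of one with injective middle term and first term in `S`,
then the left orthogonal of `S` is thick. -/
lemma isThick_leftPerp {S : Set A}
    (hS : ∀ I ∈ S, ∃ E J : A, Injective E ∧ J ∈ S ∧ SES I E J)
    (hS' : ∀ I ∈ S, ∃ J E : A, Injective E ∧ J ∈ S ∧ SES J E I) :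
    IsThick (leftPerp S) := by
  refine ⟨fun X Y hY ⟨i, r, hir⟩ ↦ mem_leftPerp_of_retract hY i r hir,
    fun X Y Z ⟨i, p, hip⟩ ↦ ⟨fun hX hY I hI ↦ ?_, fun hX hZ I hI ↦ ?_, fun hY hZ I hI ↦ ?_⟩⟩
  · rw [ext1IsZero_iff_exists_section]
    rintro T f g ⟨w, hT⟩
    obtain ⟨J, E, hE, hJ, j, q, hjq⟩ := hS' I hI
    obtain ⟨w', hS₀⟩ := hip
    have : Mono i := hS₀.mono_f
    have : Mono f := hT.mono_f
    have : Epi p := hS₀.epi_g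
    obtain ⟨s, hs⟩ := exists_lift_of_ext1IsZero (hY I hI) ⟨w, hT⟩ p
    let t : X ⟶ I := hT.exact.lift (i ≫ s) (by simp [hs, w'])
    have ht : t ≫ f = i ≫ s := hT.exact.lift_f _ _
    obtain ⟨t', ht'⟩ := exists_lift_of_ext1IsZero (hX J hJ) hjq t
    let e : Y ⟶ I := Injective.factorThru t' i ≫ q
    have he : i ≫ e = t := by simp [e, ht']
    refine ⟨hS₀.exact.desc (s - e ≫ f) (by simp [reassoc_of% he, ht]), ?_⟩
    rw [← cancel_epi p]
    have := hS₀.exact.g_desc (s - e ≫ f) (by simp [reassoc_of% he, ht])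
    dsimp at this
    rw [reassoc_of% this]
    simp [hs, w]
  · obtain ⟨E, J, hE, hJ, j, q, hjq⟩ := hS I hI
    obtain ⟨w, hS₀⟩ := hip
    have : Mono i := hS₀.mono_f
    have : Epi p := hS₀.epi_g
    refine ext1IsZero_of_forall_exists_lift hjq fun b ↦ ?_
    obtain ⟨c, hc⟩ := exists_lift_of_ext1IsZero (hX I hI) hjq (i ≫ b)
    let c' : Y ⟶ E := Injective.factorThru c i
    have hc' : i ≫ c' = c := Injective.comp_factorThru _ _
    have he : i ≫ (b - c' ≫ q) = 0 := by simp [reassoc_of% hc', hc]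
    obtain ⟨e, he'⟩ := exists_lift_of_ext1IsZero (hZ I hI) hjq (hS₀.exact.desc (b - c' ≫ q) he)
    have : p ≫ hS₀.exact.desc (b - c' ≫ q) he = b - c' ≫ q := hS₀.exact.g_desc _ _
    exact ⟨c' + p ≫ e, by simp [he', this]⟩
  · obtain ⟨E, J, hE, hJ, j, q, hjq⟩ := hS I hI
    refine ext1IsZero_of_forall_exists_lift hjq fun b ↦ ?_
    obtain ⟨b', hb'⟩ := exists_extension_of_ext1IsZero (hZ J hJ) hip b
    obtain ⟨c, hc⟩ := exists_lift_of_ext1IsZero (hY I hI) hjq b'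
    exact ⟨i ≫ c, by rw [Category.assoc, hc, hb']⟩

end Ext1

section Contractible

variable {C : Type*} [Category C] [Abelian C]

/-- The chain complexes all of whose components are injective. -/
abbrev degreewiseInjective (C : Type*) [Category C] [Abelian C] : Set (ChainComplex C ℤ) :=
  {I | ∀ n, Injective (I.X n)}

lemma Homotopy.eq_nullHomotopicMap {X Y : ChainComplex C ℤ} {f : X ⟶ Y} (h : Homotopy f 0) :
    f = Homotopy.nullHomotopicMap h.hom := by
  ext n
  rw [h.comm n, HomologicalComplex.zero_f, add_zero]
  rfl

lemma isSES_f {X Y Z : ChainComplex C ℤ} {f : X ⟶ Y} {g : Y ⟶ Z} (h : IsSES f g) (n : ℤ) :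
    IsSES (f.f n) (g.f n) := by
  obtain ⟨w, hS⟩ := h
  exact ⟨by rw [← HomologicalComplex.comp_f, w, HomologicalComplex.zero_f],
    (HomologicalComplex.shortExact_iff_degreewise_shortExact _).1 hS n⟩

lemma exists_section_of_isSES {A : Type*} [Category A] [Abelian A] {X Y Z : A} [Injective X]
    {f : X ⟶ Y} {g : Y ⟶ Z} (h : IsSES f g) : ∃ s : Z ⟶ Y, s ≫ g = 𝟙 Z := by
  obtain ⟨w, hS⟩ := h
  have : Injective (ShortComplex.mk f g w).X₁ := ‹_›
  exact ⟨hS.splittingOfInjective.s, hS.splittingOfInjective.s_g⟩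

lemma degreewiseInjective_of_isSES {X Y Z : ChainComplex C ℤ} {f : X ⟶ Y} {g : Y ⟶ Z}
    (h : IsSES f g) (hX : X ∈ degreewiseInjective C) (hY : Y ∈ degreewiseInjective C) :
    Z ∈ degreewiseInjective C := by
  intro n
  have := hX n
  have := hY n
  obtain ⟨s, hs⟩ := exists_section_of_isSES (isSES_f h n)
  exact (⟨s, g.f n, hs⟩ : Retract _ (Y.X n)).injective

/-- A contractible complex is left orthogonal to the complexes of injective objects. -/
lemma mem_leftPerp_of_contractible {X : ChainComplex C ℤ} (h : Homotopy (𝟙 X) 0) :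
    X ∈ leftPerp (degreewiseInjective C) := by
  intro I hI
  rw [ext1IsZero_iff_exists_section]
  intro P f g hfg
  have (n : ℤ) : ∃ s, s ≫ g.f n = 𝟙 (X.X n) := by
    have := hI n
    exact exists_section_of_isSES (isSES_f hfg n)
  choose s hs using this
  refine ⟨Homotopy.nullHomotopicMap fun i j ↦ h.hom i j ≫ s j, ?_⟩
  rw [Homotopy.nullHomotopicMap_comp]
  conv_rhs => rw [h.eq_nullHomotopicMap]
  simp [hs]

/-- A contractible complex of injective objects is an injective complex. -/
lemma injective_of_contractible {X : ChainComplex C ℤ} (h : Homotopy (𝟙 X) 0)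
    (hX : X ∈ degreewiseInjective C) : Injective X where
  factors {A B} f i _ := by
    have (j : ℤ) := hX j
    refine ⟨Homotopy.nullHomotopicMap
      fun a b ↦ Injective.factorThru (f.f a ≫ h.hom a b) (i.f a), ?_⟩
    rw [Homotopy.comp_nullHomotopicMap]
    conv_rhs => rw [← Category.comp_id f, h.eq_nullHomotopicMap, Homotopy.comp_nullHomotopicMap]
    simp

/-- An injective complex is contractible. -/
lemma nonempty_homotopy_of_injective (X : ChainComplex C ℤ) [Injective X] :
    Nonempty (Homotopy (𝟙 X) 0) := by
  let i := HomologicalComplex.homotopyCofiber.inr (𝟙 X)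
  have : Mono i := by
    have (n : ℤ) : Mono (i.f n) :=
      mono_of_mono_fac (HomologicalComplex.homotopyCofiber.inrX_sndX (𝟙 X) n)
    exact HomologicalComplex.mono_of_mono_f _ this
  have hi : i ≫ Injective.factorThru (𝟙 X) i = 𝟙 X := Injective.comp_factorThru _ _
  have h := HomologicalComplex.homotopyCofiber.inrCompHomotopy (𝟙 X)
    (fun j ↦ ⟨j + 1, by simp⟩)
  exact ⟨((Homotopy.ofEq (by rw [Category.id_comp]; exact hi.symm)).trans
    (h.compRight (Injective.factorThru (𝟙 X) i))).trans (Homotopy.ofEq zero_comp)⟩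

/-- The direct sum of the disc complexes on the components of `X`, with the components
of `X` being the bottom terms of the discs. -/
noncomputable def discSum (X : ChainComplex C ℤ) : ChainComplex C ℤ where
  X n := X.X (n + 1) ⊞ X.X n
  d i j := if h : j + 1 = i then
      biprod.snd ≫ (X.XIsoOfEq h).inv ≫ biprod.inl
    else 0
  shape i j h := dif_neg h
  d_comp_d' i j k hij hjk := by
    obtain rfl : j + 1 = i := hij
    obtain rfl : k + 1 = j := hjk
    simp

namespace discSum

variable (X : ChainComplex C ℤ) (n : ℤ)

/-- The inclusion of the top term of a disc. -/
noncomputable def inl : X.X (n + 1) ⟶ (discSum X).X n :=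
  (biprod.inl : _ ⟶ X.X (n + 1) ⊞ X.X n)

/-- The inclusion of the bottom term of a disc. -/
noncomputable def inr : X.X n ⟶ (discSum X).X n :=
  (biprod.inr : _ ⟶ X.X (n + 1) ⊞ X.X n)

/-- The projection to the top term of a disc. -/
noncomputable def fst : (discSum X).X n ⟶ X.X (n + 1) :=
  (biprod.fst : X.X (n + 1) ⊞ X.X n ⟶ _)

/-- The projection to the bottom term of a disc. -/
noncomputable def snd : (discSum X).X n ⟶ X.X n :=
  (biprod.snd : X.X (n + 1) ⊞ X.X n ⟶ _)

@[simp]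
lemma inl_fst : inl X n ≫ fst X n = 𝟙 _ := biprod.inl_fst

@[simp]
lemma inl_snd : inl X n ≫ snd X n = 0 := biprod.inl_snd

@[simp]
lemma inr_fst : inr X n ≫ fst X n = 0 := biprod.inr_fst

@[simp]
lemma inr_snd : inr X n ≫ snd X n = 𝟙 _ := biprod.inr_snd

@[simp]
lemma inl_fst_assoc {Y : C} (f : X.X (n + 1) ⟶ Y) : inl X n ≫ fst X n ≫ f = f := by
  rw [← Category.assoc, inl_fst, Category.id_comp]

@[simp]
lemma inl_snd_assoc {Y : C} (f : X.X n ⟶ Y) : inl X n ≫ snd X n ≫ f = 0 := by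
  rw [← Category.assoc, inl_snd, zero_comp]

@[simp]
lemma inr_fst_assoc {Y : C} (f : X.X (n + 1) ⟶ Y) : inr X n ≫ fst X n ≫ f = 0 := by
  rw [← Category.assoc, inr_fst, zero_comp]

@[simp]
lemma inr_snd_assoc {Y : C} (f : X.X n ⟶ Y) : inr X n ≫ snd X n ≫ f = f := by
  rw [← Category.assoc, inr_snd, Category.id_comp]

lemma total : fst X n ≫ inl X n + snd X n ≫ inr X n = 𝟙 _ := biprod.total

lemma d_eq : (discSum X).d (n + 1) n = snd X (n + 1) ≫ inl X n := by
  simp [discSum, snd, inl]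

/-- The canonical projection from `discSum X` to `X`. -/
noncomputable def π : discSum X ⟶ X where
  f n := fst X n ≫ X.d (n + 1) n + snd X n
  comm' i j hij := by
    obtain rfl : j + 1 = i := hij
    simp [d_eq]

@[simp]
lemma inl_π_f : inl X n ≫ (π X).f n = X.d (n + 1) n := by simp [π]

@[simp]
lemma inr_π_f : inr X n ≫ (π X).f n = 𝟙 _ := by simp [π]

instance : Epi (π X) := by
  have (n : ℤ) : Epi ((π X).f n) := epi_of_epi_fac (inr_π_f X n)
  exact HomologicalComplex.epi_of_epi_f _ this

variable {X} in
lemma kernel_π_mem (hX : X ∈ degreewiseInjective C) :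
    kernel (π X) ∈ degreewiseInjective C := by
  intro n
  have := hX (n + 1)
  obtain ⟨w, hS⟩ := isSES_f (IsSES.of_epi (π X)) n
  let σ : (ShortComplex.mk _ _ w).Splitting :=
    .ofExactOfSection _ hS.exact (inr X n) (inr_π_f X n) hS.mono_f
  have hr : inr X n ≫ σ.r = 0 := σ.s_r
  have hι : (kernel.ι (π X)).f n ≫ σ.r = 𝟙 _ := σ.f_r
  have htot : fst X n ≫ inl X n ≫ σ.r = σ.r := by
    have := total X n =≫ σ.r
    rwa [Preadditive.add_comp, Category.assoc, Category.assoc, hr, comp_zero, add_zero,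
      Category.id_comp] at this
  exact Retract.injective (Y := X.X (n + 1))
    { i := (kernel.ι (π X)).f n ≫ fst X n
      r := inl X n ≫ σ.r
      retract := by rw [Category.assoc, htot, hι] }

/-- The disc sum is contractible. -/
noncomputable def homotopy : Homotopy (𝟙 (discSum X)) 0 :=
  (Homotopy.ofEq (by
    ext n
    obtain ⟨m, rfl⟩ : ∃ m, m + 1 = n := ⟨n - 1, by simp⟩
    rw [Homotopy.nullHomotopicMap_f (show (ComplexShape.down ℤ).Rel (m + 1 + 1) (m + 1) from rfl)
      (show (ComplexShape.down ℤ).Rel (m + 1) m from rfl), d_eq, d_eq,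
      dif_pos rfl, dif_pos rfl, HomologicalComplex.id_f, ← total]
    simp [add_comm])).trans
  (Homotopy.nullHomotopy (fun i j ↦ if h : i + 1 = j then
      fst X i ≫ (X.XIsoOfEq h).hom ≫ inr X j else 0) (fun i j hij ↦ dif_neg hij))

end discSum

lemma injective_discSum {X : ChainComplex C ℤ} (hX : X ∈ degreewiseInjective C) :
    Injective (discSum X) :=
  injective_of_contractible (discSum.homotopy X) fun n ↦ by
    have := hX n
    have := hX (n + 1)
    exact inferInstanceAs (Injective (X.X (n + 1) ⊞ X.X n))

/-- A complex of injective objects which is left orthogonal to such complexes is injective. -/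
lemma injective_of_mem_leftPerp {X : ChainComplex C ℤ}
    (hX : X ∈ degreewiseInjective C) (hX' : X ∈ leftPerp (degreewiseInjective C)) :
    Injective X := by
  obtain ⟨s, hs⟩ := ext1IsZero_iff_exists_section.1 (hX' _ (discSum.kernel_π_mem hX)) _ _
    (IsSES.of_epi (discSum.π X))
  have := injective_discSum hX
  exact (⟨s, _, hs⟩ : Retract X (discSum X)).injective

open HomologicalComplex in
/-- A complex which is left orthogonal to the complexes of injective objects is exact. -/
lemma exactAt_of_mem_leftPerp [EnoughInjectives C] {X : ChainComplex C ℤ}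
    (hX : X ∈ leftPerp (degreewiseInjective C)) (n : ℤ) : X.ExactAt n := by
  let J := Injective.under (X.opcycles n)
  let φ : X.X n ⟶ J := X.pOpcycles n ≫ Injective.ι _
  let f : X ⟶ (single C _ n).obj J := mkHomToSingle φ (by intro i _; simp [φ])
  have hJ : (single C (ComplexShape.down ℤ) n).obj J ∈ degreewiseInjective C :=
    fun i ↦ inferInstance
  obtain ⟨g, hg⟩ := exists_lift_of_ext1IsZero (hX _ (discSum.kernel_π_mem hJ))
    (IsSES.of_epi (discSum.π _)) f
  have h : Homotopy f 0 := (Homotopy.ofEq (by simp [hg])).trans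
    (((discSum.homotopy _).compLeft g).compRight (discSum.π _) |>.trans (Homotopy.ofEq (by simp)))
  have hf : X.iCycles n ≫ f.f n = 0 := by
    obtain ⟨m, rfl⟩ : ∃ m, m + 1 = n := ⟨n - 1, by simp⟩
    rw [h.eq_nullHomotopicMap,
      Homotopy.nullHomotopicMap_f (show (ComplexShape.down ℤ).Rel (m + 1 + 1) (m + 1) from rfl)
        (show (ComplexShape.down ℤ).Rel (m + 1) m from rfl)]
    simp
  rw [exactAt_iff, ShortComplex.exact_iff_iCycles_pOpcycles_zero]
  have hf' : X.iCycles n ≫ φ = 0 := by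
    rw [← cancel_mono (singleObjXSelf (ComplexShape.down ℤ) n J).inv]
    simpa [f] using hf
  change X.iCycles n ≫ X.pOpcycles n = 0
  rw [← cancel_mono (Injective.ι (X.opcycles n)), zero_comp, Category.assoc]
  exact hf'

end Contractible

section Discs

open HomologicalComplex

variable {C : Type*} [Category C] [Abelian C]

/-- The complex `X ⟶ X` concentrated in degrees `n` and `n - 1`. -/
noncomputable def disc (n : ℤ) (X : C) : ChainComplex C ℤ :=
  double (𝟙 X) (show (ComplexShape.down ℤ).Rel n (n - 1) by simp)

/-- Morphisms from the disc on `X` identify to morphisms from `X`. -/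
noncomputable def discHomEquiv (n : ℤ) (X : C) (K : ChainComplex C ℤ) :
    (disc n X ⟶ K) ≃ (X ⟶ K.X n) :=
  (evalCompCoyonedaCorepresentableByDoubleId _ (by lia) X).homEquiv

lemma discHomEquiv_comp {n : ℤ} {X : C} {K L : ChainComplex C ℤ} (f : disc n X ⟶ K) (g : K ⟶ L) :
    discHomEquiv n X L (f ≫ g) = discHomEquiv n X K f ≫ g.f n :=
  (evalCompCoyonedaCorepresentableByDoubleId _ (by lia) X).homEquiv_comp _ _

lemma discHomEquiv_symm_comp {n : ℤ} {X : C} {K L : ChainComplex C ℤ} (f : X ⟶ K.X n)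
    (g : K ⟶ L) :
    (discHomEquiv n X K).symm f ≫ g = (discHomEquiv n X L).symm (f ≫ g.f n) := by
  apply (discHomEquiv n X L).injective
  simp [discHomEquiv_comp]

/-- The morphism between discs induced by a morphism. -/
noncomputable def discMap (n : ℤ) {X Y : C} (i : X ⟶ Y) : disc n X ⟶ disc n Y :=
  (discHomEquiv n X _).symm (i ≫ discHomEquiv n Y _ (𝟙 _))

lemma discMap_comp (n : ℤ) {X Y : C} (i : X ⟶ Y) {K : ChainComplex C ℤ} (f : disc n Y ⟶ K) :
    discMap n i ≫ f = (discHomEquiv n X K).symm (i ≫ discHomEquiv n Y K f) := by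
  rw [discMap, discHomEquiv_symm_comp, Category.assoc, ← discHomEquiv_comp, Category.id_comp]

instance (n : ℤ) {X Y : C} (i : X ⟶ Y) [Mono i] : Mono (discMap n i) := by
  let hn : (ComplexShape.down ℤ).Rel n (n - 1) := by simp
  let e (Z : C) : (disc n Z).X n ≅ Z := doubleXIso₀ (𝟙 Z) hn
  have he : (discMap n i).f n = (e X).hom ≫ i ≫ (e Y).inv := by
    have : discHomEquiv n X _ (discMap n i) = i ≫ discHomEquiv n Y _ (𝟙 _) := by simp [discMap]
    change (e X).inv ≫ (discMap n i).f n = i ≫ (e Y).inv ≫ 𝟙 _ at this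
    rw [← cancel_epi (e X).inv, this]
    simp
  have hd (Z : C) : IsIso ((disc n Z).d n (n - 1)) := by
    rw [disc, double_d (𝟙 Z) hn (by lia)]
    infer_instance
  have h₀ : Mono ((discMap n i).f n) := by
    rw [he]
    infer_instance
  have (k : ℤ) : Mono ((discMap n i).f k) := by
    by_cases h : k = n
    · subst h
      exact h₀
    by_cases h' : k = n - 1
    · subst h'
      have hc : (discMap n i).f (n - 1) =
          inv ((disc n X).d n (n - 1)) ≫ (discMap n i).f n ≫ (disc n Y).d n (n - 1) := by
        simp
      rw [hc]
      infer_instance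
    · exact ⟨fun _ _ _ ↦ (isZero_double_X _ _ _ h h').eq_of_tgt _ _⟩
  exact mono_of_mono_f _ this

lemma hasLiftingProperty_discMap_iff (n : ℤ) {A B : C} (i : A ⟶ B) {X Y : ChainComplex C ℤ}
    (p : X ⟶ Y) : HasLiftingProperty (discMap n i) p ↔ HasLiftingProperty i (p.f n) := by
  constructor
  · refine fun h ↦ ⟨fun {f g} sq ↦ ?_⟩
    have sq' : CommSq ((discHomEquiv n A X).symm f) (discMap n i) p
        ((discHomEquiv n B Y).symm g) :=
      ⟨by rw [discMap_comp, discHomEquiv_symm_comp, Equiv.apply_symm_apply, sq.w]⟩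
    refine ⟨⟨{ l := discHomEquiv n B X sq'.lift, fac_left := ?_, fac_right := ?_ }⟩⟩
    · apply (discHomEquiv n A X).symm.injective
      rw [← discMap_comp, sq'.fac_left]
    · rw [← discHomEquiv_comp, sq'.fac_right, Equiv.apply_symm_apply]
  · refine fun h ↦ ⟨fun {f g} sq ↦ ?_⟩
    have sq' : CommSq (discHomEquiv n A X f) i (p.f n) (discHomEquiv n B Y g) :=
      ⟨by rw [← discHomEquiv_comp, sq.w, discMap_comp, Equiv.apply_symm_apply]⟩
    refine ⟨⟨{ l := (discHomEquiv n B X).symm sq'.lift, fac_left := ?_, fac_right := ?_ }⟩⟩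
    · rw [discMap_comp, Equiv.apply_symm_apply, sq'.fac_left, Equiv.symm_apply_apply]
    · rw [discHomEquiv_symm_comp, sq'.fac_right, Equiv.symm_apply_apply]

end Discs

section SmallObject

open MorphismProperty IsGrothendieckAbelian

universe w v u

lemma exists_section_of_rlp_monomorphisms {C : Type*} [Category C] [Abelian C] {X Y : C}
    {p : X ⟶ Y} (hp : (monomorphisms C).rlp p) : ∃ s, s ≫ p = 𝟙 Y := by
  have : HasLiftingProperty (0 : 0 ⟶ Y) p := hp _ (inferInstanceAs (Mono _))
  have sq : CommSq (0 : 0 ⟶ X) (0 : 0 ⟶ Y) p (𝟙 Y) := ⟨by simp⟩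
  exact ⟨sq.lift, sq.fac_right⟩

/-- A small family of monomorphisms in a Grothendieck abelian category permits the small
object argument. -/
lemma hasSmallObjectArgument_ofHoms {C : Type u} [Category.{v} C] [Abelian C]
    [IsGrothendieckAbelian.{w} C] {ι : Type*} [Small.{w} ι] {A B : ι → C} (f : ∀ i, A i ⟶ B i)
    [∀ i, Mono (f i)] : HasSmallObjectArgument.{w} (ofHoms f) := by
  obtain ⟨κ, hκ', hκ⟩ := HasCardinalLT.exists_regular_cardinal_forall.{w}
    (fun i ↦ Subobject (A i))
  have : Fact κ.IsRegular := ⟨hκ'⟩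
  have : Nonempty κ.ord.ToType := by simpa using hκ'.ne_zero
  have := WellFoundedLT.toOrderBot κ.ord.ToType
  have hf : ofHoms f ≤ monomorphisms C := by
    rintro _ _ _ ⟨i⟩
    exact inferInstanceAs (Mono (f i))
  exact ⟨κ, inferInstance, inferInstance,
    { preservesColimit {A B X Y} i hi g hg := by
        let hg' : (monomorphisms C).TransfiniteCompositionOfShape κ.ord.ToType g :=
          { toTransfiniteCompositionOfShape := hg.toTransfiniteCompositionOfShape
            map_mem j hj := by
              have := (hg.attachCells j hj).pushouts_coproducts
              simp only [ofHoms_homFamily] at this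
              refine (?_ : _ ≤ monomorphisms C) _ this
              simpa only [pushouts_le_iff, coproducts_le_iff] using hf }
        have (j j' : κ.ord.ToType) (φ : j ⟶ j') : Mono (hg'.F.map φ) := hg'.mem_map φ
        apply preservesColimit_coyoneda_obj_of_mono (Y := hg'.F) (κ := κ)
        obtain ⟨i⟩ := hi
        exact hκ i }⟩

variable (C : Type u) [Category.{v} C] [Abelian C] [IsGrothendieckAbelian.{w} C]

/-- The morphisms between discs induced by the inclusions of subobjects of the separator. -/
noncomputable def discInclusions : MorphismProperty (ChainComplex C ℤ) :=
  ofHoms fun x : ℤ × Subobject (separator C) ↦ discMap x.1 x.2.arrow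

instance : HasSmallObjectArgument.{w} (discInclusions C) :=
  hasSmallObjectArgument_ofHoms _

lemma discInclusions_le_monomorphisms :
    discInclusions C ≤ monomorphisms (ChainComplex C ℤ) := by
  rintro _ _ _ ⟨i⟩
  exact inferInstanceAs (Mono (discMap _ _))

variable {C}

lemma discInclusions_rlp_iff {X Y : ChainComplex C ℤ} (p : X ⟶ Y) :
    (discInclusions C).rlp p ↔ ∀ n, (monomorphisms C).rlp (p.f n) := by
  simp_rw [← generatingMonomorphisms_rlp (isSeparator_separator C)]
  constructor
  · rintro h n _ _ _ ⟨S⟩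
    rw [← hasLiftingProperty_discMap_iff]
    exact h _ ⟨(n, S)⟩
  · rintro h _ _ _ ⟨n, S⟩
    rw [hasLiftingProperty_discMap_iff]
    exact h n _ ⟨S⟩

lemma discInclusions_rlp_to_zero_iff {X Z : ChainComplex C ℤ} (p : X ⟶ Z) (hZ : IsZero Z) :
    (discInclusions C).rlp p ↔ X ∈ degreewiseInjective C := by
  rw [discInclusions_rlp_iff]
  refine forall_congr' fun n ↦ ?_
  rw [injective_iff_rlp_monomorphisms_zero]
  have hZ' : IsZero (Z.X n) := Functor.map_isZero (HomologicalComplex.eval _ _ n) hZ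
  exact (monomorphisms C).rlp.arrow_mk_iso_iff
    (Arrow.isoMk (Iso.refl _) (hZ'.iso (isZero_zero C)) ((isZero_zero C).eq_of_tgt _ _))

lemma mem_degreewiseInjective_of_injective (X : ChainComplex C ℤ) [hX : Injective X] :
    X ∈ degreewiseInjective C := by
  rw [← discInclusions_rlp_to_zero_iff (0 : X ⟶ 0) (isZero_zero _)]
  exact antitone_rlp (discInclusions_le_monomorphisms C) _
    ((injective_iff_rlp_monomorphisms_zero X).1 hX)

lemma epi_of_discInclusions_rlp {X Y : ChainComplex C ℤ} {p : X ⟶ Y}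
    (hp : (discInclusions C).rlp p) : Epi p := by
  rw [discInclusions_rlp_iff] at hp
  have (n : ℤ) : Epi (p.f n) := by
    obtain ⟨s, hs⟩ := exists_section_of_rlp_monomorphisms (hp n)
    exact epi_of_epi_fac hs
  exact HomologicalComplex.epi_of_epi_f _ this

lemma kernel_mem_of_discInclusions_rlp {X Y : ChainComplex C ℤ} {p : X ⟶ Y}
    (hp : (discInclusions C).rlp p) : kernel p ∈ degreewiseInjective C := by
  rw [← discInclusions_rlp_to_zero_iff (0 : kernel p ⟶ 0) (isZero_zero _)]
  intro A B i hi
  have := hp i hi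
  refine ⟨fun {f g} sq ↦ ?_⟩
  have sq' : CommSq (f ≫ kernel.ι p) i p 0 := ⟨by simp⟩
  exact ⟨⟨{ l := kernel.lift p sq'.lift sq'.fac_right
            fac_left := by simp [← cancel_mono (kernel.ι p)]
            fac_right := (isZero_zero _).eq_of_tgt _ _ }⟩⟩

lemma discInclusions_rlp_of_isSES {X Y Z : ChainComplex C ℤ} {f : X ⟶ Y} {p : Y ⟶ Z}
    (h : IsSES f p) (hX : X ∈ degreewiseInjective C) : (discInclusions C).rlp p := by
  rw [discInclusions_rlp_iff]
  intro n A B i hi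
  have := hX n
  have : Mono i := hi
  obtain ⟨w, hS⟩ := isSES_f h n
  have : Mono (f.f n) := hS.mono_f
  obtain ⟨s, hs⟩ := exists_section_of_isSES (isSES_f h n)
  refine ⟨fun {a b} sq ↦ ?_⟩
  have ha : (a - i ≫ b ≫ s) ≫ p.f n = 0 := by simp [hs, sq.w]
  let c : A ⟶ X.X n := hS.exact.lift (a - i ≫ b ≫ s) ha
  have hc : c ≫ f.f n = a - i ≫ b ≫ s := hS.exact.lift_f _ _
  refine ⟨⟨{ l := b ≫ s + Injective.factorThru c i ≫ f.f n, fac_left := ?_, fac_right := ?_ }⟩⟩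
  · simp [hc]
  · simp [hs, w]

end SmallObject

section Completeness

open MorphismProperty IsGrothendieckAbelian

universe w v u

variable {C : Type u} [Category.{v} C] [Abelian C] [IsGrothendieckAbelian.{w} C]

lemma exists_embedding_degreewiseInjective (M : ChainComplex C ℤ) :
    ∃ Q W : ChainComplex C ℤ, Q ∈ leftPerp (degreewiseInjective C) ∧
      W ∈ degreewiseInjective C ∧ SES M W Q := by
  let F := (functorialFactorizationData (discInclusions C).rlp.llp
    (discInclusions C).rlp).factorizationData (0 : M ⟶ 0)
  have hY : F.Z ∈ degreewiseInjective C :=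
    (discInclusions_rlp_to_zero_iff F.p (isZero_zero _)).1 F.hp
  have : Mono F.i := by
    have := F.hi (0 : Injective.under M ⟶ 0)
      ((discInclusions_rlp_to_zero_iff _ (isZero_zero _)).2
        (mem_degreewiseInjective_of_injective _))
    have sq : CommSq (Injective.ι M) F.i (0 : Injective.under M ⟶ 0) 0 := ⟨by simp⟩
    exact mono_of_mono_fac sq.fac_left
  refine ⟨cokernel F.i, F.Z, fun I hI ↦ ?_, hY, F.i, _, IsSES.of_mono F.i⟩
  rw [ext1IsZero_iff_exists_section]
  intro P f g hfg
  have := F.hi _ (discInclusions_rlp_of_isSES hfg hI)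
  have sq : CommSq 0 F.i g (cokernel.π F.i) := ⟨by simp⟩
  refine ⟨cokernel.desc F.i sq.lift sq.fac_left, ?_⟩
  simp [← cancel_epi (cokernel.π F.i)]

lemma exists_cover_mem_leftPerp (M : ChainComplex C ℤ) :
    ∃ Q W : ChainComplex C ℤ, Q ∈ leftPerp (degreewiseInjective C) ∧
      W ∈ degreewiseInjective C ∧ SES W Q M := by
  let F := (functorialFactorizationData (discInclusions C).rlp.llp
    (discInclusions C).rlp).factorizationData (0 : 0 ⟶ M)
  have : Epi F.p := epi_of_discInclusions_rlp F.hp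
  have hW := kernel_mem_of_discInclusions_rlp F.hp
  refine ⟨F.Z, kernel F.p, fun I hI ↦ ?_, hW, _, F.p, IsSES.of_epi F.p⟩
  rw [ext1IsZero_iff_exists_section]
  intro P f g hfg
  have := F.hi _ (discInclusions_rlp_of_isSES hfg hI)
  have sq : CommSq 0 F.i g (𝟙 F.Z) := ⟨(isZero_zero _).eq_of_src _ _⟩
  exact ⟨sq.lift, sq.fac_right⟩

lemma rightPerp_leftPerp_degreewiseInjective :
    rightPerp (leftPerp (degreewiseInjective C)) = degreewiseInjective C := by
  refine (subset_rightPerp_leftPerp _).antisymm' fun Y hY ↦ ?_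
  obtain ⟨Q, W, hQ, hW, f, g, hfg⟩ := exists_embedding_degreewiseInjective Y
  obtain ⟨r, hr⟩ := ext1IsZero_iff_exists_retraction.1 (hY Q hQ) f g hfg
  intro n
  have := hW n
  exact Retract.injective (Y := W.X n)
    ((⟨f, r, hr⟩ : Retract Y W).map (HomologicalComplex.eval C _ n))

lemma isThick_leftPerp_degreewiseInjective : IsThick (leftPerp (degreewiseInjective C)) := by
  refine isThick_leftPerp (fun I hI ↦ ?_) fun I hI ↦ ?_
  · have h := IsSES.of_mono (Injective.ι I)
    exact ⟨_, _, inferInstance, degreewiseInjective_of_isSES h hI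
      (mem_degreewiseInjective_of_injective _), _, _, h⟩
  · exact ⟨_, _, injective_discSum hI, discSum.kernel_π_mem hI, _, _,
      IsSES.of_epi (discSum.π I)⟩

lemma leftPerp_inter_degreewiseInjective :
    leftPerp (degreewiseInjective C) ∩ degreewiseInjective C =
      {I : ChainComplex C ℤ | Injective I} := by
  refine Set.Subset.antisymm (fun X hX ↦ injective_of_mem_leftPerp hX.2 hX.1)
    fun X (_ : Injective X) ↦ ⟨?_, mem_degreewiseInjective_of_injective X⟩
  obtain ⟨h⟩ := nonempty_homotopy_of_injective X
  exact mem_leftPerp_of_contractible h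

end Completeness

/-- Proposition (the Inj / coderived model structure, Bravo–Gillespie–Hovey, Becker):
for any ring `R`, let `dwI` be the class of chain complexes of injective `R`-modules
and `Wco = ᗮ(dwI)` the class of coacyclic complexes.  Then `(Wco, dwI)` is a complete
hereditary cotorsion pair in `Ch(R)`, `Wco` is thick, `Wco ∩ dwI` is exactly the class
of injective objects of `Ch(R)`, every contractible complex is coacyclic, and every
coacyclic complex is exact. -/
theorem coacyclic_cotorsion_pair (R : Type u) [Ring R] :
    IsCompleteCotorsionPair
      (leftPerp {I : ChainComplex (ModuleCat.{u} R) ℤ | ∀ n, Injective (I.X n)})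
      {I : ChainComplex (ModuleCat.{u} R) ℤ | ∀ n, Injective (I.X n)} ∧
    IsHereditaryPair
      (leftPerp {I : ChainComplex (ModuleCat.{u} R) ℤ | ∀ n, Injective (I.X n)})
      {I : ChainComplex (ModuleCat.{u} R) ℤ | ∀ n, Injective (I.X n)} ∧
    IsThick
      (leftPerp {I : ChainComplex (ModuleCat.{u} R) ℤ | ∀ n, Injective (I.X n)}) ∧
    (leftPerp {I : ChainComplex (ModuleCat.{u} R) ℤ | ∀ n, Injective (I.X n)} ∩
        {I : ChainComplex (ModuleCat.{u} R) ℤ | ∀ n, Injective (I.X n)} =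
      {I : ChainComplex (ModuleCat.{u} R) ℤ | Injective I}) ∧
    (∀ X : ChainComplex (ModuleCat.{u} R) ℤ, Nonempty (Homotopy (𝟙 X) 0) →
      X ∈ leftPerp {I : ChainComplex (ModuleCat.{u} R) ℤ | ∀ n, Injective (I.X n)}) ∧
    (∀ X ∈ leftPerp {I : ChainComplex (ModuleCat.{u} R) ℤ | ∀ n, Injective (I.X n)},
      ∀ n : ℤ, X.ExactAt n) := by
  have hthick := isThick_leftPerp_degreewiseInjective (C := ModuleCat.{u} R)
  refine ⟨⟨⟨rfl, rightPerp_leftPerp_degreewiseInjective.symm⟩,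
      exists_cover_mem_leftPerp, exists_embedding_degreewiseInjective⟩,
    ⟨fun K B B' hB hB' h ↦ (hthick.2 h).2.2 hB hB',
      fun B B' Q hB hB' ⟨_, _, h⟩ ↦ degreewiseInjective_of_isSES h hB hB'⟩,
    hthick, leftPerp_inter_degreewiseInjective,
    fun X ⟨h⟩ ↦ mem_leftPerp_of_contractible h, fun X hX n ↦ exactAt_of_mem_leftPerp hX n⟩
end

section
/- Let R be any ring, let Ch(R) be the category of chain complexes of left R-modules, let dw𝒫 be the class of complexes all of whose components are projective R-modules, and let 𝒲_ctr = (dw𝒫)^⊥ = {W : Ext¹(P, W) = 0 for all P ∈ dw𝒫} (the contraacyclic complexes). Then: (1) (dw𝒫, 𝒲_ctr) is a complete hereditary cotorsion pair in Ch(R); (2) 𝒲_ctr is a thick class; (3) dw𝒫 ∩ 𝒲_ctr is exactly the class of projective objects of Ch(R), i.e., the split exact complexes with projective components. -/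
open CategoryTheory Limits ZeroObject

open AbModel

namespace AbModel

universe v u

section Abelian

variable {A : Type u} [Category.{v} A] [Abelian A]

lemma IsSES.mono {X Y Z : A} {f : X ⟶ Y} {g : Y ⟶ Z} (h : IsSES f g) : Mono f :=
  h.choose_spec.mono_f

lemma IsSES.epi {X Y Z : A} {f : X ⟶ Y} {g : Y ⟶ Z} (h : IsSES f g) : Epi g :=
  h.choose_spec.epi_g

lemma IsSES.zero {X Y Z : A} {f : X ⟶ Y} {g : Y ⟶ Z} (h : IsSES f g) : f ≫ g = 0 :=
  h.choose

lemma IsSES.exists_desc {X Y Z T : A} {f : X ⟶ Y} {g : Y ⟶ Z} (h : IsSES f g)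
    (k : Y ⟶ T) (hk : f ≫ k = 0) : ∃ l : Z ⟶ T, g ≫ l = k :=
  have := h.epi
  ⟨h.choose_spec.exact.desc k hk, h.choose_spec.exact.g_desc k hk⟩

lemma IsSES.exists_lift {X Y Z T : A} {f : X ⟶ Y} {g : Y ⟶ Z} (h : IsSES f g)
    (k : T ⟶ Y) (hk : k ≫ g = 0) : ∃ l : T ⟶ X, l ≫ f = k :=
  have := h.mono
  ⟨h.choose_spec.exact.lift k hk, h.choose_spec.exact.lift_f k hk⟩

/-- A monomorphism with a cokernel gives a short exact sequence. -/
lemma IsSES.of_mono {X Y Z : A} {f : X ⟶ Y} {g : Y ⟶ Z} [Mono f] [Epi g] (w : f ≫ g = 0)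
    (hg : ∀ ⦃T : A⦄ (k : Y ⟶ T), f ≫ k = 0 → ∃ l : Z ⟶ T, g ≫ l = k) : IsSES f g := by
  refine ⟨w, ⟨ShortComplex.exact_of_g_is_cokernel _ ?_⟩⟩
  exact CokernelCofork.IsColimit.ofπ _ _ (fun k hk ↦ (hg k hk).choose)
    (fun k hk ↦ (hg k hk).choose_spec)
    (fun k hk m hm ↦ by rw [← cancel_epi g, hm, (hg k hk).choose_spec])

/-- An epimorphism with a kernel gives a short exact sequence. -/
lemma IsSES.of_epi {X Y Z : A} {f : X ⟶ Y} {g : Y ⟶ Z} [Mono f] [Epi g] (w : f ≫ g = 0)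
    (hf : ∀ ⦃T : A⦄ (k : T ⟶ Y), k ≫ g = 0 → ∃ l : T ⟶ X, l ≫ f = k) : IsSES f g := by
  refine ⟨w, ⟨ShortComplex.exact_of_f_is_kernel _ ?_⟩⟩
  exact KernelFork.IsLimit.ofι _ _ (fun k hk ↦ (hf k hk).choose)
    (fun k hk ↦ (hf k hk).choose_spec)
    (fun k hk m hm ↦ by rw [← cancel_mono f, hm, (hf k hk).choose_spec])

lemma isSES_cokernel {X Y : A} (f : X ⟶ Y) [Mono f] : IsSES f (cokernel.π f) :=
  IsSES.of_mono (cokernel.condition f) fun _ k hk ↦ ⟨cokernel.desc f k hk, by simp⟩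

lemma isSES_kernel {X Y : A} (f : X ⟶ Y) [Epi f] : IsSES (kernel.ι f) f :=
  IsSES.of_epi (kernel.condition f) fun _ k hk ↦ ⟨kernel.lift f k hk, by simp⟩

lemma IsSES.exists_of_isPushout {X Y Z X' Y' : A} {f : X ⟶ Y} {g : Y ⟶ Z} (h : IsSES f g)
    {u : X ⟶ X'} {inl : Y ⟶ Y'} {inr : X' ⟶ Y'} (sq : IsPushout f u inl inr) :
    ∃ g' : Y' ⟶ Z, inl ≫ g' = g ∧ IsSES inr g' := by
  have := h.mono
  have := h.epi
  have hm : Mono inr := (MorphismProperty.monomorphisms A).of_isPushout sq.flip ‹Mono f›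
  let g' : Y' ⟶ Z := sq.desc g 0 (by simp [h.zero])
  have e : inl ≫ g' = g := sq.inl_desc _ _ _
  have e' : inr ≫ g' = 0 := sq.inr_desc _ _ _
  have : Epi g' := by
    have : Epi (inl ≫ g') := by rwa [e]
    exact epi_of_epi inl g'
  refine ⟨g', e, IsSES.of_mono e' fun T k hk ↦ ?_⟩
  obtain ⟨l, hl⟩ := h.exists_desc (inl ≫ k) (by rw [sq.w_assoc, hk, comp_zero])
  refine ⟨l, sq.hom_ext ?_ ?_⟩
  · rw [← Category.assoc, e, hl]
  · rw [← Category.assoc, e', hk, zero_comp]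

lemma IsSES.exists_of_isPullback {X Y Z Y' Z' : A} {f : X ⟶ Y} {g : Y ⟶ Z} (h : IsSES f g)
    {u : Z' ⟶ Z} {fst : Y' ⟶ Y} {snd : Y' ⟶ Z'} (sq : IsPullback fst snd g u) :
    ∃ f' : X ⟶ Y', f' ≫ fst = f ∧ IsSES f' snd := by
  have := h.mono
  have := h.epi
  have hm : Epi snd := (MorphismProperty.epimorphisms A).of_isPullback sq ‹Epi g›
  let f' : X ⟶ Y' := sq.lift f 0 (by simp [h.zero])
  have e : f' ≫ fst = f := sq.lift_fst _ _ _
  have e' : f' ≫ snd = 0 := sq.lift_snd _ _ _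
  have : Mono f' := by
    have : Mono (f' ≫ fst) := by rwa [e]
    exact mono_of_mono f' fst
  refine ⟨f', e, IsSES.of_epi e' fun T k hk ↦ ?_⟩
  obtain ⟨l, hl⟩ := h.exists_lift (k ≫ fst) (by
    rw [Category.assoc, sq.w, ← Category.assoc, hk, zero_comp])
  refine ⟨l, sq.hom_ext ?_ ?_⟩
  · rw [Category.assoc, e, hl]
  · rw [Category.assoc, e', hk, comp_zero]

lemma Ext1IsZero.exists_section {X Y Z : A} (h : Ext1IsZero X Y) {f : Y ⟶ Z} {g : Z ⟶ X}
    (hfg : IsSES f g) : ∃ s : X ⟶ Z, s ≫ g = 𝟙 X := by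
  obtain ⟨w, hw⟩ := hfg
  obtain ⟨σ⟩ := h f g w hw
  exact ⟨σ.s, σ.s_g⟩

lemma Ext1IsZero.exists_retraction {X Y Z : A} (h : Ext1IsZero X Y) {f : Y ⟶ Z} {g : Z ⟶ X}
    (hfg : IsSES f g) : ∃ r : Z ⟶ Y, f ≫ r = 𝟙 Y := by
  obtain ⟨w, hw⟩ := hfg
  obtain ⟨σ⟩ := h f g w hw
  exact ⟨σ.r, σ.f_r⟩

lemma ext1IsZero_of_exists_section {X Y : A}
    (h : ∀ ⦃Z : A⦄ (f : Y ⟶ Z) (g : Z ⟶ X), IsSES f g → ∃ s : X ⟶ Z, s ≫ g = 𝟙 X) :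
    Ext1IsZero X Y := by
  intro Z f g w hS
  obtain ⟨s, hs⟩ := h f g ⟨w, hS⟩
  have := hS.mono_f
  exact ⟨ShortComplex.Splitting.ofExactOfSection _ hS.exact s hs this⟩

lemma ext1IsZero_of_exists_retraction {X Y : A}
    (h : ∀ ⦃Z : A⦄ (f : Y ⟶ Z) (g : Z ⟶ X), IsSES f g → ∃ r : Z ⟶ Y, f ≫ r = 𝟙 Y) :
    Ext1IsZero X Y := by
  intro Z f g w hS
  obtain ⟨s, hs⟩ := h f g ⟨w, hS⟩
  have := hS.epi_g
  exact ⟨ShortComplex.Splitting.ofExactOfRetraction _ hS.exact s hs this⟩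

lemma ext1IsZero_of_projective (X Y : A) [Projective X] : Ext1IsZero X Y :=
  ext1IsZero_of_exists_section fun _ _ g h ↦
    have := h.epi
    ⟨Projective.factorThru (𝟙 X) g, by simp⟩

lemma Ext1IsZero.exists_extension {X Y K D : A} (h : Ext1IsZero X Y) {i : K ⟶ D} {q : D ⟶ X}
    (hiq : IsSES i q) (u : K ⟶ Y) : ∃ v : D ⟶ Y, i ≫ v = u := by
  have sq := IsPushout.of_hasPushout i u
  obtain ⟨g', -, hg'⟩ := hiq.exists_of_isPushout sq
  obtain ⟨r, hr⟩ := h.exists_retraction hg'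
  exact ⟨pushout.inl i u ≫ r, by rw [sq.w_assoc, hr, Category.comp_id]⟩

lemma Ext1IsZero.exists_lift {X Y E Z : A} (h : Ext1IsZero X Y) {j : Y ⟶ E} {p : E ⟶ Z}
    (hjp : IsSES j p) (u : X ⟶ Z) : ∃ v : X ⟶ E, v ≫ p = u := by
  have sq := IsPullback.of_hasPullback p u
  obtain ⟨f', -, hf'⟩ := hjp.exists_of_isPullback sq
  obtain ⟨s, hs⟩ := h.exists_section hf'
  exact ⟨s ≫ pullback.fst p u, by rw [Category.assoc, sq.w, ← Category.assoc, hs, Category.id_comp]⟩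

/-- If `Ext¹(D, Y) = 0` and `0 → K → D → X → 0` is exact, then `Ext¹(X, Y) = 0` as soon as
all morphisms `K ⟶ Y` extend to `D`. -/
lemma ext1IsZero_of_exists_extension {X Y K D : A} (hD : Ext1IsZero D Y) {i : K ⟶ D} {q : D ⟶ X}
    (hiq : IsSES i q) (h : ∀ u : K ⟶ Y, ∃ v : D ⟶ Y, i ≫ v = u) : Ext1IsZero X Y := by
  refine ext1IsZero_of_exists_section fun Z f g hfg ↦ ?_
  have := hiq.epi
  obtain ⟨d, hd⟩ := hD.exists_lift hfg q
  obtain ⟨u, hu⟩ := hfg.exists_lift (i ≫ d) (by rw [Category.assoc, hd, hiq.zero])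
  obtain ⟨v, hv⟩ := h u
  obtain ⟨s, hs⟩ := hiq.exists_desc (d - v ≫ f) (by
    rw [Preadditive.comp_sub, ← hu, ← hv, Category.assoc, sub_self])
  exact ⟨s, by rw [← cancel_epi q, ← Category.assoc, hs, Preadditive.sub_comp, Category.assoc,
    hfg.zero, comp_zero, sub_zero, hd, Category.comp_id]⟩

lemma Ext1IsZero.of_retract_left {X X' Y : A} (h : Ext1IsZero X' Y) (i : X ⟶ X') (r : X' ⟶ X)
    (hir : i ≫ r = 𝟙 X) : Ext1IsZero X Y :=
  ext1IsZero_of_exists_section fun _ _ _ hfg ↦ by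
    obtain ⟨v, hv⟩ := h.exists_lift hfg r
    exact ⟨i ≫ v, by rw [Category.assoc, hv, hir]⟩

lemma Ext1IsZero.of_retract_right {X Y Y' : A} (h : Ext1IsZero X Y') (i : Y ⟶ Y') (r : Y' ⟶ Y)
    (hir : i ≫ r = 𝟙 Y) : Ext1IsZero X Y :=
  ext1IsZero_of_exists_retraction fun _ _ _ hfg ↦ by
    obtain ⟨v, hv⟩ := h.exists_extension hfg i
    exact ⟨v ≫ r, by rw [← Category.assoc, hv, hir]⟩

lemma Ext1IsZero.of_isSES {X Y₁ Y₂ Y₃ : A} (h₁ : Ext1IsZero X Y₁) (h₃ : Ext1IsZero X Y₃)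
    {f : Y₁ ⟶ Y₂} {g : Y₂ ⟶ Y₃} (hfg : IsSES f g) : Ext1IsZero X Y₂ := by
  refine ext1IsZero_of_exists_section fun Z a b hab ↦ ?_
  have sq := IsPushout.of_hasPushout a g
  obtain ⟨b', hb', hs'⟩ := hab.exists_of_isPushout sq
  obtain ⟨s, hs⟩ := h₃.exists_section hs'
  have := hfg.mono
  have := hab.mono
  have : Epi (pushout.inl a g) :=
    (MorphismProperty.epimorphisms A).of_isPushout sq hfg.epi
  have hker : IsSES (f ≫ a) (pushout.inl a g) :=
    IsSES.of_mono (by rw [Category.assoc, sq.w, ← Category.assoc, hfg.zero, zero_comp])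
      fun T k hk ↦ by
        obtain ⟨l, hl⟩ := hfg.exists_desc (a ≫ k) (by rw [← Category.assoc, hk])
        exact ⟨sq.desc k l hl.symm, sq.inl_desc _ _ _⟩
  obtain ⟨v, hv⟩ := h₁.exists_lift hker s
  exact ⟨v, by rw [← hb', ← Category.assoc, hv, hs]⟩

/-- If `p` is an epimorphism and `i` is a monomorphism with projective cokernel, then `i` has the
left lifting property with respect to `p`. -/
lemma IsSES.exists_lift_of_projective {X Y C E B : A} {i : X ⟶ Y} {q : Y ⟶ C} (h : IsSES i q)
    [Projective C] (p : E ⟶ B) [Epi p] (u : X ⟶ E) (v : Y ⟶ B) (w : i ≫ v = u ≫ p) :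
    ∃ l : Y ⟶ E, i ≫ l = u ∧ l ≫ p = v := by
  have := h.epi
  obtain ⟨r, hr⟩ := (ext1IsZero_of_projective C X).exists_retraction h
  obtain ⟨t, ht⟩ := h.exists_desc (v - r ≫ u ≫ p) (by
    rw [Preadditive.comp_sub, ← Category.assoc, hr, Category.id_comp, w, sub_self])
  refine ⟨r ≫ u + q ≫ Projective.factorThru t p, ?_, ?_⟩
  · rw [Preadditive.comp_add, ← Category.assoc, hr, ← Category.assoc, h.zero]
    simp
  · rw [Preadditive.add_comp, Category.assoc, Category.assoc, Projective.factorThru_comp, ht]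
    simp

lemma IsSES.projective_mid {X Y Z : A} {f : X ⟶ Y} {g : Y ⟶ Z} (h : IsSES f g)
    [Projective X] [Projective Z] : Projective Y := by
  obtain ⟨w, hw⟩ := h
  obtain ⟨σ⟩ := ext1IsZero_of_projective Z X f g w hw
  exact Projective.of_iso σ.isoBinaryBiproduct.symm inferInstance

lemma IsSES.projective_left {X Y Z : A} {f : X ⟶ Y} {g : Y ⟶ Z} (h : IsSES f g)
    [Projective Y] [Projective Z] : Projective X := by
  obtain ⟨r, hr⟩ := (ext1IsZero_of_projective Z X).exists_retraction h
  exact (Retract.mk f r hr).projective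

lemma IsSES.projective_right {X Y Z : A} {f : X ⟶ Y} {g : Y ⟶ Z} (h : IsSES f g)
    [Projective Y] {r : Y ⟶ X} (hr : f ≫ r = 𝟙 X) : Projective Z := by
  obtain ⟨w, hw⟩ := h
  have := hw.epi_g
  let σ := ShortComplex.Splitting.ofExactOfRetraction _ hw.exact r hr this
  exact (Retract.mk σ.s g σ.s_g).projective

end Abelian

section Disk

variable {C : Type u} [Category.{v} C] [Abelian C]

lemma IsSES.eval {X Y Z : ChainComplex C ℤ} {f : X ⟶ Y} {g : Y ⟶ Z} (h : IsSES f g) (n : ℤ) :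
    IsSES (f.f n) (g.f n) :=
  ⟨by rw [← HomologicalComplex.comp_f, h.zero, HomologicalComplex.zero_f],
    (HomologicalComplex.shortExact_iff_degreewise_shortExact _).1 h.choose_spec n⟩

lemma IsSES.of_eval {X Y Z : ChainComplex C ℤ} {f : X ⟶ Y} {g : Y ⟶ Z}
    (h : ∀ n, IsSES (f.f n) (g.f n)) : IsSES f g :=
  ⟨by ext n; exact (h n).zero,
    (HomologicalComplex.shortExact_iff_degreewise_shortExact _).2 fun n ↦ (h n).choose_spec⟩

/-- The contractible complex with components `M n ⊞ M (n + 1)` attached to a graded object `M`: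
it is the sum of the disk complexes on the objects `M n`. -/
noncomputable def diskSum (M : ℤ → C) : ChainComplex C ℤ :=
  ChainComplex.of (fun n ↦ M n ⊞ M (n + 1)) (fun _ ↦ biprod.fst ≫ biprod.inr) (by simp)

namespace diskSum

variable (M N : ℤ → C)

/-- The inclusion of the generators. -/
noncomputable def gen (n : ℤ) : M n ⟶ (diskSum M).X n := biprod.inl

/-- The projection to the cogenerators. -/
noncomputable def cogen (n : ℤ) : (diskSum M).X n ⟶ M (n + 1) := biprod.snd

variable {M N}

lemma hom_ext_from {X : ChainComplex C ℤ} {φ ψ : diskSum M ⟶ X}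
    (h : ∀ n, gen M n ≫ φ.f n = gen M n ≫ ψ.f n) : φ = ψ := by
  ext n
  apply biprod.hom_ext'
  · exact h n
  · have e : (biprod.inr : _ ⟶ M n ⊞ M (n + 1)) = gen M (n + 1) ≫ (diskSum M).d (n + 1) n := by
      simp [gen, diskSum]
    have := h (n + 1) =≫ X.d (n + 1) n
    simp only [Category.assoc, HomologicalComplex.Hom.comm] at this
    erw [e, Category.assoc, Category.assoc]
    exact this

lemma hom_ext_to {X : ChainComplex C ℤ} {φ ψ : X ⟶ diskSum M}
    (h : ∀ n, φ.f n ≫ cogen M n = ψ.f n ≫ cogen M n) : φ = ψ := by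
  ext n
  obtain ⟨n, rfl⟩ : ∃ m, m + 1 = n := ⟨n - 1, by simp⟩
  apply biprod.hom_ext
  · have e : (biprod.fst : M (n + 1) ⊞ M (n + 1 + 1) ⟶ _) =
        (diskSum M).d (n + 1) n ≫ cogen M n := by
      simp [cogen, diskSum]
    have (θ : X ⟶ diskSum M) : θ.f (n + 1) ≫ (diskSum M).d (n + 1) n ≫ cogen M n =
        X.d (n + 1) n ≫ θ.f n ≫ cogen M n := by
      rw [HomologicalComplex.Hom.comm_assoc]
    erw [e, this, this, h n]
  · exact h (n + 1)

/-- Morphisms from `diskSum M` are determined by graded morphisms from `M`. -/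
noncomputable def desc {X : ChainComplex C ℤ} (φ : ∀ n, M n ⟶ X.X n) : diskSum M ⟶ X where
  f n := biprod.desc (φ n) (φ (n + 1) ≫ X.d (n + 1) n)
  comm' i j h := by
    obtain rfl : j + 1 = i := h
    simp only [diskSum, ChainComplex.of_d]
    apply biprod.hom_ext' <;> simp

@[simp]
lemma gen_desc {X : ChainComplex C ℤ} (φ : ∀ n, M n ⟶ X.X n) (n : ℤ) :
    gen M n ≫ (desc φ).f n = φ n :=
  biprod.inl_desc _ _

@[simp]
lemma gen_desc_assoc {X : ChainComplex C ℤ} (φ : ∀ n, M n ⟶ X.X n) (n : ℤ) {T : C}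
    (k : X.X n ⟶ T) : gen M n ≫ (desc φ).f n ≫ k = φ n ≫ k := by
  rw [← Category.assoc, gen_desc]

/-- Morphisms to `diskSum M` are determined by graded morphisms to `M`. -/
noncomputable def lift {X : ChainComplex C ℤ} (φ : ∀ n, X.X n ⟶ M (n + 1)) : X ⟶ diskSum M where
  f n := biprod.lift (X.d n (n - 1) ≫ φ (n - 1) ≫ eqToHom (by simp)) (φ n)
  comm' i j h := by
    obtain rfl : j + 1 = i := h
    simp only [diskSum, ChainComplex.of_d]
    apply biprod.hom_ext
    all_goals simp

@[simp]
lemma lift_cogen {X : ChainComplex C ℤ} (φ : ∀ n, X.X n ⟶ M (n + 1)) (n : ℤ) :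
    (lift φ).f n ≫ cogen M n = φ n :=
  biprod.lift_snd _ _

@[simp]
lemma lift_cogen_assoc {X : ChainComplex C ℤ} (φ : ∀ n, X.X n ⟶ M (n + 1)) (n : ℤ) {T : C}
    (k : M (n + 1) ⟶ T) : (lift φ).f n ≫ cogen M n ≫ k = φ n ≫ k := by
  rw [← Category.assoc, lift_cogen]

/-- `diskSum` is functorial with respect to graded morphisms. -/
noncomputable abbrev map (f : ∀ n, M n ⟶ N n) : diskSum M ⟶ diskSum N :=
  lift fun n ↦ cogen M n ≫ f (n + 1)

instance projective_X [∀ n, Projective (M n)] (n : ℤ) : Projective ((diskSum M).X n) :=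
  inferInstanceAs (Projective (M n ⊞ M (n + 1)))

instance projective [∀ n, Projective (M n)] : Projective (diskSum M) where
  factors f e _ := ⟨desc fun n ↦ Projective.factorThru (gen M n ≫ f.f n) (e.f n),
    hom_ext_from fun n ↦ by simp [← Category.assoc]⟩

instance epi_desc {X : ChainComplex C ℤ} (p : ∀ n, M n ⟶ X.X n) [∀ n, Epi (p n)] :
    Epi (desc p) := by
  have (n : ℤ) : Epi ((desc p).f n) := by
    have : Epi (gen M n ≫ (desc p).f n) := by rw [gen_desc]; infer_instance
    exact epi_of_epi (gen M n) _
  exact HomologicalComplex.epi_of_epi_f _ this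

instance mono_lift {X : ChainComplex C ℤ} (p : ∀ n, X.X n ⟶ M (n + 1)) [∀ n, Mono (p n)] :
    Mono (lift p) := by
  have (n : ℤ) : Mono ((lift p).f n) := by
    have : Mono ((lift p).f n ≫ cogen M n) := by rw [lift_cogen]; infer_instance
    exact mono_of_mono _ (cogen M n)
  exact HomologicalComplex.mono_of_mono_f _ this

/-- Lifting property of `diskSum.map f`, tested degreewise. -/
lemma exists_lift_map {f : ∀ n, M n ⟶ N n} [∀ n, Epi (f n)] {X Y Z : ChainComplex C ℤ}
    {i : X ⟶ Y} {q : Y ⟶ Z} (h : IsSES i q) [∀ n, Projective (Z.X n)]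
    (a : X ⟶ diskSum M) (b : Y ⟶ diskSum N) (w : i ≫ b = a ≫ map f) :
    ∃ l : Y ⟶ diskSum M, i ≫ l = a ∧ l ≫ map f = b := by
  have H (n : ℤ) := (h.eval n).exists_lift_of_projective (f (n + 1))
    (a.f n ≫ cogen M n) (b.f n ≫ cogen N n) (by
      have := congr_arg (fun φ ↦ HomologicalComplex.Hom.f φ n ≫ cogen N n) w
      simpa using this)
  choose l hl hl' using H
  exact ⟨lift l, hom_ext_to fun n ↦ by simp [hl], hom_ext_to fun n ↦ by simp [hl']⟩

lemma ext1IsZero {Z : ChainComplex C ℤ} (hZ : ∀ n, Projective (Z.X n)) (M : ℤ → C) :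
    Ext1IsZero Z (diskSum M) := by
  refine ext1IsZero_of_exists_retraction fun Y i q h ↦ ?_
  have H (n : ℤ) := (ext1IsZero_of_projective (Z.X n) (M (n + 1))).exists_extension (h.eval n)
    (cogen M n)
  choose r hr using H
  exact ⟨lift r, hom_ext_to fun n ↦ by simp [hr]⟩

end diskSum

end Disk

section Orthogonal

variable {C : Type u} [Category.{v} C] [Abelian C]

variable (C) in
/-- The complexes with projective components. -/
abbrev dwProj : Set (ChainComplex C ℤ) := {P | ∀ n, Projective (P.X n)}

lemma IsSES.mem_dwProj_left {X Y Z : ChainComplex C ℤ} {f : X ⟶ Y} {g : Y ⟶ Z} (h : IsSES f g)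
    (hY : Y ∈ dwProj C) (hZ : Z ∈ dwProj C) : X ∈ dwProj C := fun n ↦
  have := hY n
  have := hZ n
  (h.eval n).projective_left

lemma IsSES.mem_dwProj_mid {X Y Z : ChainComplex C ℤ} {f : X ⟶ Y} {g : Y ⟶ Z} (h : IsSES f g)
    (hX : X ∈ dwProj C) (hZ : Z ∈ dwProj C) : Y ∈ dwProj C := fun n ↦
  have := hX n
  have := hZ n
  (h.eval n).projective_mid

lemma mem_dwProj_of_retract {X Y : ChainComplex C ℤ} (h : Retract X Y) (hY : Y ∈ dwProj C) :
    X ∈ dwProj C := fun n ↦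
  have : Projective ((HomologicalComplex.eval C _ n).obj Y) := hY n
  (h.map (HomologicalComplex.eval C _ n)).projective

/-- A complex with projective components embeds into a projective complex with cokernel
having projective components. -/
lemma exists_isSES_diskSum_mid {P : ChainComplex C ℤ} (hP : P ∈ dwProj C) :
    ∃ (M : ℤ → C) (Q : ChainComplex C ℤ) (i : P ⟶ diskSum M) (q : diskSum M ⟶ Q),
      IsSES i q ∧ (∀ n, Projective (M n)) ∧ Q ∈ dwProj C := by
  let M (n : ℤ) : C := P.X (n - 1)
  have hM (n : ℤ) : Projective (M n) := hP _
  let p (n : ℤ) : P.X n ⟶ M (n + 1) := eqToHom (by simp [M])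
  have (n : ℤ) : Mono (p n) := inferInstanceAs (Mono (eqToHom _))
  refine ⟨M, _, diskSum.lift p, _, isSES_cokernel _, hM, fun n ↦ ?_⟩
  have hr : (diskSum.lift p).f n ≫ diskSum.cogen M n ≫ inv (p n) = 𝟙 _ := by simp
  exact ((isSES_cokernel (diskSum.lift p)).eval n).projective_right hr

variable [EnoughProjectives C]

lemma exists_epi_diskSum (X : ChainComplex C ℤ) :
    ∃ (F : ℤ → C) (q : diskSum F ⟶ X), Epi q ∧ ∀ n, Projective (F n) :=
  ⟨fun n ↦ Projective.over (X.X n), diskSum.desc fun n ↦ Projective.π (X.X n),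
    inferInstance, inferInstance⟩

lemma mem_rightPerp_dwProj_right {X Y Z : ChainComplex C ℤ} {f : X ⟶ Y} {g : Y ⟶ Z}
    (h : IsSES f g) (hX : X ∈ rightPerp (dwProj C)) (hY : Y ∈ rightPerp (dwProj C)) :
    Z ∈ rightPerp (dwProj C) := by
  intro P hP
  obtain ⟨F, q, _, hF⟩ := exists_epi_diskSum P
  have hK := isSES_kernel q
  refine ext1IsZero_of_exists_extension (ext1IsZero_of_projective _ _) hK fun u ↦ ?_
  obtain ⟨u', rfl⟩ := (hX _ (hK.mem_dwProj_left (fun n ↦ inferInstance) hP)).exists_lift h u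
  obtain ⟨v, rfl⟩ := (hY P hP).exists_extension hK u'
  exact ⟨v ≫ g, by rw [Category.assoc]⟩

lemma mem_rightPerp_dwProj_left {X Y Z : ChainComplex C ℤ} {f : X ⟶ Y} {g : Y ⟶ Z}
    (h : IsSES f g) (hY : Y ∈ rightPerp (dwProj C)) (hZ : Z ∈ rightPerp (dwProj C)) :
    X ∈ rightPerp (dwProj C) := by
  intro P hP
  have := h.mono
  have := h.epi
  obtain ⟨F, q, _, hF⟩ := exists_epi_diskSum P
  have hK := isSES_kernel q
  refine ext1IsZero_of_exists_extension (ext1IsZero_of_projective _ _) hK fun u ↦ ?_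
  obtain ⟨a, ha⟩ := (hY P hP).exists_extension hK (u ≫ f)
  obtain ⟨b, hb⟩ := hK.exists_desc (a ≫ g) (by
    rw [← Category.assoc, ha, Category.assoc, h.zero, comp_zero])
  obtain ⟨M, Q, j, p, hjp, _, hQ⟩ := exists_isSES_diskSum_mid hP
  obtain ⟨c, rfl⟩ := (hZ Q hQ).exists_extension hjp b
  obtain ⟨t, ht⟩ := h.exists_lift (a - q ≫ j ≫ Projective.factorThru c g) (by
    simp [← hb])
  refine ⟨t, ?_⟩
  rw [← cancel_mono f, Category.assoc, ht, Preadditive.comp_sub, ha, reassoc_of% hK.zero]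
  simp

lemma isThick_rightPerp_dwProj : IsThick (rightPerp (dwProj C)) := by
  refine ⟨fun X Y hY ⟨i, r, hir⟩ P hP ↦ (hY P hP).of_retract_right i r hir, ?_⟩
  rintro X Y Z ⟨f, g, h⟩
  exact ⟨mem_rightPerp_dwProj_right h, fun hX hZ P hP ↦ (hX P hP).of_isSES (hZ P hP) h,
    mem_rightPerp_dwProj_left h⟩

lemma isHereditaryPair_dwProj : IsHereditaryPair (dwProj C) (rightPerp (dwProj C)) :=
  ⟨fun _ _ _ hB hB' ⟨_, _, h⟩ ↦ h.mem_dwProj_left hB hB',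
    fun _ _ _ hB hB' ⟨_, _, h⟩ ↦ mem_rightPerp_dwProj_right h hB hB'⟩

lemma dwProj_inter_rightPerp :
    dwProj C ∩ rightPerp (dwProj C) = {P : ChainComplex C ℤ | Projective P} := by
  ext P
  constructor
  · rintro ⟨hP, hP'⟩
    obtain ⟨M, Q, j, p, hjp, _, hQ⟩ := exists_isSES_diskSum_mid hP
    obtain ⟨r, hr⟩ := (hP' Q hQ).exists_retraction hjp
    exact (Retract.mk j r hr).projective
  · intro (hP : Projective P)
    obtain ⟨F, q, _, hF⟩ := exists_epi_diskSum P
    let h : Retract P (diskSum F) := ⟨Projective.factorThru (𝟙 P) q, q, by simp⟩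
    exact ⟨mem_dwProj_of_retract h fun n ↦ inferInstance,
      fun Q hQ ↦ (diskSum.ext1IsZero hQ F).of_retract_right h.i h.r h.retract⟩

/-- If every morphism in `I` is a monomorphism with cokernel in `dwProj C`, then so is every
morphism in `I.rlp.llp`. -/
lemma mono_and_cokernel_mem_dwProj_of_llp_rlp {I : MorphismProperty (ChainComplex C ℤ)}
    (hI : ∀ ⦃X Y : ChainComplex C ℤ⦄ (i : X ⟶ Y), I i →
      ∃ (Z : ChainComplex C ℤ) (q : Y ⟶ Z), IsSES i q ∧ Z ∈ dwProj C)
    {X Y : ChainComplex C ℤ} (i : X ⟶ Y) (hi : I.rlp.llp i) :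
    Mono i ∧ cokernel i ∈ dwProj C := by
  have key {M N : ℤ → C} (f : ∀ n, M n ⟶ N n) [∀ n, Epi (f n)] : I.rlp (diskSum.map f) := by
    intro X' Y' i' hi'
    obtain ⟨Z, q, h, hZ⟩ := hI i' hi'
    refine ⟨fun {a b} sq ↦ ?_⟩
    have : ∀ n, Projective (Z.X n) := hZ
    obtain ⟨l, hl, hl'⟩ := diskSum.exists_lift_map h a b sq.w.symm
    exact ⟨⟨⟨l, hl, hl'⟩⟩⟩
  constructor
  · let M (n : ℤ) : C := X.X (n - 1)
    let p (n : ℤ) : X.X n ⟶ M (n + 1) := eqToHom (by simp [M])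
    have (n : ℤ) : Mono (p n) := inferInstanceAs (Mono (eqToHom _))
    have := hi _ (key (fun n ↦ (0 : M n ⟶ 0)))
    have sq : CommSq (diskSum.lift p) i (diskSum.map (fun n ↦ (0 : M n ⟶ 0))) 0 :=
      ⟨diskSum.hom_ext_to fun n ↦ (isZero_zero C).eq_of_tgt _ _⟩
    have h : Mono (i ≫ sq.lift) := by rw [sq.fac_left]; infer_instance
    exact mono_of_mono i sq.lift
  · intro n
    let Q := cokernel i
    let N (n : ℤ) : C := Q.X (n - 1)
    let p (n : ℤ) : Q.X n ⟶ N (n + 1) := eqToHom (by simp [N])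
    have (n : ℤ) : IsIso (p n) := inferInstanceAs (IsIso (eqToHom _))
    have := hi _ (key (fun n ↦ Projective.π (N n)))
    have sq : CommSq 0 i (diskSum.map (fun n ↦ Projective.π (N n)))
      (cokernel.π i ≫ diskSum.lift p) := ⟨by simp⟩
    let s : Q ⟶ diskSum (fun n ↦ Projective.over (N n)) := cokernel.desc i sq.lift sq.fac_left
    have hs : s ≫ diskSum.map (fun n ↦ Projective.π (N n)) = diskSum.lift p := by
      rw [← cancel_epi (cokernel.π i)]
      simp [s]
    have hn := congr_arg (fun φ ↦ HomologicalComplex.Hom.f φ n ≫ diskSum.cogen N n) hs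
    simp only [HomologicalComplex.comp_f, Category.assoc, diskSum.lift_cogen] at hn
    exact (Retract.mk (s.f n ≫ diskSum.cogen _ n) (Projective.π (N (n + 1)) ≫ inv (p n))
      (by simp [reassoc_of% hn])).projective

end Orthogonal

section SmallObject

open MorphismProperty

variable {C : Type u} [Category.{v} C] [Abelian C] [IsGrothendieckAbelian.{v} C]

/-- In a Grothendieck abelian category, a small set of monomorphisms permits the
small object argument. -/
lemma hasSmallObjectArgument_ofHoms {J : Type v} {X Y : J → C} (i : ∀ j, X j ⟶ Y j)
    [∀ j, Mono (i j)] : HasSmallObjectArgument.{v} (ofHoms i) := by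
  obtain ⟨κ, hκ', hκ⟩ := HasCardinalLT.exists_regular_cardinal_forall.{v} fun j ↦ Subobject (X j)
  have : Fact κ.IsRegular := ⟨hκ'⟩
  have : Nonempty κ.ord.ToType := by simpa using hκ'.ne_zero
  have := WellFoundedLT.toOrderBot κ.ord.ToType
  have hi : ofHoms i ≤ monomorphisms C := by
    rintro _ _ _ ⟨j⟩
    exact monomorphisms.infer_property _
  exact ⟨κ, inferInstance, inferInstance,
    { preservesColimit {A B X' Y'} k hk f hf := by
        let hf' : (monomorphisms C).TransfiniteCompositionOfShape κ.ord.ToType f :=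
          { toTransfiniteCompositionOfShape := hf.toTransfiniteCompositionOfShape
            map_mem j hj := by
              have := (hf.attachCells j hj).pushouts_coproducts
              simp only [ofHoms_homFamily] at this
              refine (?_ : _ ≤ monomorphisms C) _ this
              simpa only [pushouts_le_iff, coproducts_le_iff] using hi }
        have (j j' : κ.ord.ToType) (φ : j ⟶ j') : Mono (hf'.F.map φ) := hf'.mem_map φ
        apply IsGrothendieckAbelian.preservesColimit_coyoneda_obj_of_mono (Y := hf'.F) (κ := κ)
        obtain ⟨j⟩ := hk
        exact hκ j }⟩

/-- Every complex embeds into one that is right orthogonal to a given small family of complexes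
with projective components, the cokernel having projective components. -/
lemma exists_isSES_of_small [EnoughProjectives C] {J : Type v} (S : J → ChainComplex C ℤ)
    (hS : ∀ j, S j ∈ dwProj C) (M : ChainComplex C ℤ) :
    ∃ (W Q : ChainComplex C ℤ) (f : M ⟶ W) (g : W ⟶ Q), IsSES f g ∧ Q ∈ dwProj C ∧
      ∀ j, Ext1IsZero (S j) W := by
  have (j : J) (n : ℤ) : Projective ((S j).X n) := hS j n
  let q (j : J) : diskSum (S j).X ⟶ S j := diskSum.desc fun n ↦ 𝟙 _
  have := hasSmallObjectArgument_ofHoms fun j ↦ kernel.ι (q j)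
  let I := ofHoms fun j ↦ kernel.ι (q j)
  let fac := (functorialFactorizationData I.rlp.llp I.rlp).factorizationData (0 : M ⟶ 0)
  obtain ⟨_, h⟩ := mono_and_cokernel_mem_dwProj_of_llp_rlp (I := I)
    (by rintro _ _ _ ⟨j⟩; exact ⟨_, _, isSES_kernel (q j), hS j⟩) fac.i fac.hi
  refine ⟨fac.Z, _, fac.i, _, isSES_cokernel _, h, fun j ↦ ?_⟩
  refine ext1IsZero_of_exists_extension (ext1IsZero_of_projective _ _) (isSES_kernel (q j))
    fun u ↦ ?_
  have := fac.hp _ ⟨j⟩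
  have sq : CommSq u (kernel.ι (q j)) fac.p 0 := ⟨(isZero_zero _).eq_of_tgt _ _⟩
  exact ⟨sq.lift, sq.fac_left⟩

end SmallObject

section Free

variable {R : Type u} [Ring R]

/-- The Eilenberg swindle: a projective module has a free complement that makes it free. -/
lemma exists_free_prod (P : Type u) [AddCommGroup P] [Module R P] [Module.Projective R P] :
    ∃ (F : Type u) (_ : AddCommGroup F) (_ : Module R F),
      Module.Free R F ∧ Module.Free R (P × F) := by
  obtain ⟨i, hi⟩ := Module.projective_def'.1 ‹Module.Projective R P›
  let L := P →₀ R
  let π : L →ₗ[R] P := Finsupp.linearCombination R id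
  have hπ (x : P) : π (i x) = x := LinearMap.congr_fun hi x
  let τ : L →ₗ[R] L := i ∘ₗ π
  let κ : L →ₗ[R] L := LinearMap.id - τ
  let σ : (ℕ →₀ L) →ₗ[R] (ℕ →₀ L) := Finsupp.lmapDomain L R Nat.succ
  let σ' : (ℕ →₀ L) →ₗ[R] (ℕ →₀ L) := Finsupp.lcomapDomain Nat.succ Nat.succ_injective
  have σ_zero (f : ℕ →₀ L) : σ f 0 = 0 := Finsupp.mapDomain_of_notMem_range _ _ (by simp)
  have σ_succ (f : ℕ →₀ L) (n : ℕ) : σ f (n + 1) = f n :=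
    Finsupp.mapDomain_apply Nat.succ_injective _ _
  have σ'_apply (f : ℕ →₀ L) (n : ℕ) : σ' f n = f (n + 1) := rfl
  let a : P × (ℕ →₀ L) →ₗ[R] (ℕ →₀ L) :=
    (Finsupp.lsingle 0 ∘ₗ i) ∘ₗ LinearMap.fst R _ _ +
      (σ ∘ₗ Finsupp.mapRange.linearMap τ + Finsupp.mapRange.linearMap κ) ∘ₗ LinearMap.snd R _ _
  let b : (ℕ →₀ L) →ₗ[R] P × (ℕ →₀ L) :=
    (π ∘ₗ Finsupp.lapply 0).prod
      (Finsupp.mapRange.linearMap κ + Finsupp.mapRange.linearMap τ ∘ₗ σ')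
  have hab : a ∘ₗ b = LinearMap.id := by
    refine LinearMap.ext fun f ↦ Finsupp.ext fun n ↦ ?_
    cases n <;> simp [a, b, σ_zero, σ_succ, σ'_apply, κ, τ, hπ]
  have hba : b ∘ₗ a = LinearMap.id := by
    refine LinearMap.ext fun f ↦ Prod.ext ?_ (Finsupp.ext fun n ↦ ?_)
    · simp [a, b, σ_zero, κ, τ, hπ]
    · cases n <;> simp [a, b, σ_zero, σ_succ, σ'_apply, κ, τ, hπ]
  exact ⟨ℕ →₀ L, inferInstance, inferInstance, inferInstance,
    Module.Free.of_equiv (LinearEquiv.ofLinearMap b a hba hab)⟩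

/-- A complex with projective components is a retract of a complex with free components. -/
lemma exists_retract_free {P : ChainComplex (ModuleCat.{u} R) ℤ} (hP : P ∈ dwProj _) :
    ∃ P' : ChainComplex (ModuleCat.{u} R) ℤ,
      Nonempty (Retract P P') ∧ ∀ n, Module.Free R (P'.X n) := by
  have (n : ℤ) : Module.Projective R (P.X n) := (IsProjective.iff_projective _).2 (hP n)
  choose F _ _ hF hF' using fun n ↦ exists_free_prod (R := R) (P.X n)
  refine ⟨P ⊞ diskSum fun n ↦ ModuleCat.of R (F n),
    ⟨⟨biprod.inl, biprod.fst, by simp⟩⟩, fun n ↦ ?_⟩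
  let e : (P ⊞ diskSum fun n ↦ ModuleCat.of R (F n)).X n ≅
      ModuleCat.of R (P.X n × (F n × F (n + 1))) :=
    HomologicalComplex.biprodXIso _ _ _ ≪≫
      biprod.mapIso (Iso.refl _) (ModuleCat.biprodIsoProd _ _) ≪≫ ModuleCat.biprodIsoProd _ _
  exact Module.Free.of_equiv ((LinearEquiv.prodAssoc R _ _ _).trans e.symm.toLinearEquiv)

end Free

section Twist

variable {C : Type u} [Category.{v} C] [Abelian C]

/-- If `Ext¹(Q, W) = 0`, then every chain map from `Q` to a shift of `W` is null-homotopic. -/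
lemma Ext1IsZero.exists_homotopy {Q W : ChainComplex C ℤ} (h : Ext1IsZero Q W)
    (e : ∀ n : ℤ, Q.X (n + 1) ⟶ W.X n)
    (he : ∀ n, e (n + 1) ≫ W.d (n + 1) n + Q.d (n + 1 + 1) (n + 1) ≫ e n = 0) :
    ∃ k : ∀ n, Q.X n ⟶ W.X n, ∀ n,
      e n = Q.d (n + 1) n ≫ k n - k (n + 1) ≫ W.d (n + 1) n := by
  let δ (n : ℤ) : W.X (n + 1) ⊞ Q.X (n + 1) ⟶ W.X n ⊞ Q.X n :=
    biprod.desc (W.d (n + 1) n ≫ biprod.inl)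
      (e n ≫ biprod.inl + Q.d (n + 1) n ≫ biprod.inr)
  let Z : ChainComplex C ℤ := ChainComplex.of (fun n ↦ W.X n ⊞ Q.X n) δ (fun n ↦ by
    apply biprod.hom_ext'
    · simp [δ]
    · apply biprod.hom_ext
      · simpa [δ] using he n
      · simp [δ])
  have hZ (n : ℤ) : Z.d (n + 1) n = δ n := by simp [Z]
  let f : W ⟶ Z :=
    { f n := biprod.inl
      comm' i j hij := by
        obtain rfl : j + 1 = i := hij
        erw [hZ]; simp [δ] }
  let g : Z ⟶ Q :=
    { f n := biprod.snd
      comm' i j hij := by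
        obtain rfl : j + 1 = i := hij
        erw [hZ]; apply biprod.hom_ext' <;> simp [δ] }
  have hfg : IsSES f g := IsSES.of_eval fun n ↦
    ⟨biprod.inl_snd, (ShortComplex.Splitting.ofHasBinaryBiproduct _ _).shortExact⟩
  obtain ⟨s, hs⟩ := h.exists_section hfg
  let k (n : ℤ) : Q.X n ⟶ W.X n := s.f n ≫ biprod.fst
  have hk (n : ℤ) : s.f n = k n ≫ biprod.inl + biprod.inr := by
    apply biprod.hom_ext
    · simp [k]
    · have := HomologicalComplex.congr_hom hs n
      simpa [g] using this
  refine ⟨k, fun n ↦ ?_⟩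
  have := s.comm (n + 1) n =≫ biprod.fst
  rw [hZ, hk, hk] at this
  simp only [δ, Preadditive.add_comp, Category.assoc, biprod.inl_desc,
    biprod.inr_desc, biprod.inl_fst, biprod.inr_fst, Category.comp_id, comp_zero,
    add_zero] at this
  rw [← this]
  abel

end Twist

section FiniteDescent

/-- A relation with finitely many successors that lowers a degree by one has finitely many
descendants of each degree. -/
lemma finite_descendants {α : Type*} (deg : α → ℤ) (r : α → α → Prop)
    (hr : ∀ x, {y | r x y}.Finite) (hdeg : ∀ x y, r x y → deg y + 1 = deg x) (x : α) (n : ℤ) :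
    {y | Relation.ReflTransGen r x y ∧ deg y = n}.Finite := by
  let T (k : ℕ) : Set α := Nat.rec {x} (fun _ S ↦ ⋃ y ∈ S, {z | r y z}) k
  have hT (k : ℕ) : (T k).Finite := by
    induction k with
    | zero => exact Set.finite_singleton x
    | succ k ih => exact ih.biUnion fun y _ ↦ hr y
  refine (hT (deg x - n).toNat).subset ?_
  rintro y ⟨hy, rfl⟩
  suffices ∃ k : ℕ, y ∈ T k ∧ deg y + k = deg x by
    obtain ⟨k, hk, h⟩ := this
    obtain rfl : (deg x - deg y).toNat = k := by omega
    exact hk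
  induction hy with
  | refl => exact ⟨0, rfl, by simp⟩
  | @tail y z _ hyz ih =>
    obtain ⟨k, hk, h⟩ := ih
    have := hdeg _ _ hyz
    exact ⟨k + 1, Set.mem_biUnion hk hyz, by push_cast; omega⟩

end FiniteDescent

section Generators

variable (R : Type u) [Ring R]

/-- The data of a complex of finitely generated free modules, given in coordinates. -/
structure FreeComplexData where
  /-- the ranks -/
  rank : ℤ → ℕ
  /-- the differentials -/
  d (n : ℤ) : (Fin (rank (n + 1)) →₀ R) →ₗ[R] (Fin (rank n) →₀ R)
  d_comp_d (n : ℤ) : d n ∘ₗ d (n + 1) = 0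

variable {R}

/-- The complex of finitely generated free modules with the given coordinates. -/
noncomputable abbrev FreeComplexData.complex (j : FreeComplexData R) :
    ChainComplex (ModuleCat.{u} R) ℤ :=
  ChainComplex.of (fun n ↦ ModuleCat.of R (Fin (j.rank n) →₀ R)) (fun n ↦ ModuleCat.ofHom (j.d n))
    (fun n ↦ by rw [← ModuleCat.ofHom_comp, j.d_comp_d]; rfl)

lemma FreeComplexData.complex_mem_dwProj (j : FreeComplexData R) :
    j.complex ∈ dwProj (ModuleCat.{u} R) := fun _ ↦
  ModuleCat.projective_of_free Finsupp.basisSingleOne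

end Generators

section PartialSection

variable {R : Type u} [Ring R] {W Z P : ChainComplex (ModuleCat.{u} R) ℤ}

lemma d_d_apply (P : ChainComplex (ModuleCat.{u} R) ℤ) (i j k : ℤ) (x : P.X i) :
    P.d j k (P.d i j x) = 0 :=
  LinearMap.congr_fun (congr_arg ModuleCat.Hom.hom (P.d_comp_d i j k)) x

lemma comm_apply (f : W ⟶ Z) (i j : ℤ) (x : W.X i) :
    Z.d i j (f.f i x) = f.f j (W.d i j x) :=
  LinearMap.congr_fun (congr_arg ModuleCat.Hom.hom (f.comm i j)) x

/-- A graded section `s` of `Z ⟶ P` commuting with the differentials on a graded submodule `A`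
of `P` may be modified away from `A` so as to commute also on a complement `Q` of `A` in a larger
graded submodule, provided `Q`, with the differential induced modulo `A`, is left orthogonal to
the kernel `W` of `Z ⟶ P`. -/
lemma exists_section_of_ext1IsZero {j : W ⟶ Z} {p : Z ⟶ P} (hjp : IsSES j p)
    (A : ∀ n, Submodule R (P.X n))
    (s : ∀ n, P.X n ⟶ Z.X n) (hps : ∀ n, s n ≫ p.f n = 𝟙 _)
    (hs : ∀ n, ∀ x ∈ A (n + 1), Z.d (n + 1) n (s (n + 1) x) = s n (P.d (n + 1) n x))
    {Q : ChainComplex (ModuleCat.{u} R) ℤ} (hQ : Ext1IsZero Q W)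
    (ι : ∀ n, Q.X n ⟶ P.X n) (π : ∀ n, P.X n ⟶ Q.X n) (hιπ : ∀ n, ι n ≫ π n = 𝟙 _)
    (hπ : ∀ n, ∀ x ∈ A n, π n x = 0)
    (hd : ∀ n x, P.d (n + 1) n (ι (n + 1) x) - ι n (Q.d (n + 1) n x) ∈ A n) :
    ∃ s' : ∀ n, P.X n ⟶ Z.X n, (∀ n, s' n ≫ p.f n = 𝟙 _) ∧ (∀ n, ∀ x ∈ A n, s' n x = s n x) ∧
      ∀ n x, Z.d (n + 1) n (s' (n + 1) (ι (n + 1) x)) = s' n (P.d (n + 1) n (ι (n + 1) x)) := by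
  choose e he using fun n ↦ (hjp.eval n).exists_lift
    (ι (n + 1) ≫ (s (n + 1) ≫ Z.d (n + 1) n - P.d (n + 1) n ≫ s n)) (by
      have := p.comm (n + 1) n
      simp only [Preadditive.comp_sub, Preadditive.sub_comp, Category.assoc, hps, ← this,
        reassoc_of% hps (n + 1), Category.comp_id, sub_self])
  have he' (n : ℤ) (x : Q.X (n + 1)) : j.f n (e n x) =
      Z.d (n + 1) n (s (n + 1) (ι (n + 1) x)) - s n (P.d (n + 1) n (ι (n + 1) x)) :=
    LinearMap.congr_fun (congr_arg ModuleCat.Hom.hom (he n)) x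
  have hιπ' (n : ℤ) (x : Q.X n) : π n (ι n x) = x :=
    LinearMap.congr_fun (congr_arg ModuleCat.Hom.hom (hιπ n)) x
  have hdι (n : ℤ) (x : Q.X (n + 1)) : ∃ a ∈ A n,
      P.d (n + 1) n (ι (n + 1) x) = a + ι n (Q.d (n + 1) n x) :=
    ⟨_, hd n x, by simp⟩
  have hj (n : ℤ) : Function.Injective (j.f n) :=
    (ModuleCat.mono_iff_injective _).1 (hjp.eval n).mono
  obtain ⟨h, hh⟩ := hQ.exists_homotopy e (fun n ↦ by
    ext x
    apply hj n
    obtain ⟨a, ha, hx⟩ := hdι (n + 1) x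
    have h1 : s n (P.d (n + 1) n a) + s n (P.d (n + 1) n (ι (n + 1) (Q.d (n + 1 + 1) (n + 1) x)))
        = 0 := by
      rw [← map_add, ← map_add, ← hx, d_d_apply, map_zero]
    simp only [ModuleCat.hom_add, ModuleCat.hom_comp, LinearMap.add_apply, LinearMap.comp_apply,
      ModuleCat.hom_zero, LinearMap.zero_apply, map_add, map_zero, ← comm_apply, he', hx,
      map_sub, d_d_apply, hs n a ha]
    rw [eq_neg_of_add_eq_zero_left h1]
    abel)
  have hh' (n : ℤ) (x : Q.X (n + 1)) :
      e n x = h n (Q.d (n + 1) n x) - W.d (n + 1) n (h (n + 1) x) :=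
    LinearMap.congr_fun (congr_arg ModuleCat.Hom.hom (hh n)) x
  have hs' (n : ℤ) (x : P.X n) : (s n + π n ≫ h n ≫ j.f n) x = s n x + j.f n (h n (π n x)) := rfl
  refine ⟨fun n ↦ s n + π n ≫ h n ≫ j.f n, fun n ↦ ?_, fun n x hx ↦ ?_, fun n x ↦ ?_⟩
  · simp [hps, (hjp.eval n).zero]
  · rw [hs', hπ n x hx]; simp
  · obtain ⟨a, ha, hx⟩ := hdι n x
    have h1 := he' n x
    rw [hh', map_sub, ← comm_apply] at h1
    simp only [hs', hιπ', map_add]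
    have h2 : π n (P.d (n + 1) n (ι (n + 1) x)) = Q.d (n + 1) n x := by
      rw [hx, map_add, hπ n a ha, hιπ', zero_add]
    rw [sub_eq_sub_iff_add_eq_add] at h1
    rw [h2, ← h1, add_comm]

variable {B : ℤ → Type u} (b : ∀ n, Module.Basis (B n) R (P.X n))

/-- The basis element `y` occurs in the differential of the basis element `x`. -/
def Succ (x y : Σ n, B n) : Prop :=
  y.1 + 1 = x.1 ∧ (b y.1).repr (P.d x.1 y.1 (b x.1 x.2)) y.2 ≠ 0

lemma finite_succ (x : Σ n, B n) : {y | Succ b x y}.Finite := by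
  let m := x.1 - 1
  refine (((b m).repr (P.d x.1 m (b x.1 x.2))).support.finite_toSet.image
    fun y ↦ (⟨m, y⟩ : Σ n, B n)).subset ?_
  rintro ⟨n, y⟩ ⟨h, hz⟩
  obtain rfl : n = m := by dsimp at h; omega
  exact ⟨y, by simpa using hz, rfl⟩

/-- The graded submodule spanned by a set of basis elements. -/
def spanOf (A : Set (Σ n, B n)) (n : ℤ) : Submodule R (P.X n) :=
  Submodule.span R (b n '' {y | ⟨n, y⟩ ∈ A})

variable {b}

lemma basis_mem_spanOf {A : Set (Σ n, B n)} {n : ℤ} {y : B n} (hy : ⟨n, y⟩ ∈ A) :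
    b n y ∈ spanOf b A n :=
  Submodule.subset_span ⟨y, hy, rfl⟩

lemma spanOf_induction {A : Set (Σ n, B n)} {n : ℤ} {M : Type*} [AddCommGroup M] [Module R M]
    {f g : P.X n →ₗ[R] M} (h : ∀ y, ⟨n, y⟩ ∈ A → f (b n y) = g (b n y)) {x : P.X n}
    (hx : x ∈ spanOf b A n) : f x = g x :=
  LinearMap.eqOn_span (by rintro _ ⟨y, hy, rfl⟩; exact h y hy) hx

lemma repr_eq_zero_of_mem_spanOf {A : Set (Σ n, B n)} {n : ℤ} {x : P.X n}
    (hx : x ∈ spanOf b A n) {y : B n} (hy : ⟨n, y⟩ ∉ A) : (b n).repr x y = 0 := by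
  by_contra h
  exact hy ((b n).mem_span_image.1 hx (by simpa using h))

lemma d_mem_spanOf {A : Set (Σ n, B n)} (hA : ∀ x ∈ A, ∀ y, Succ b x y → y ∈ A) {n : ℤ}
    {x : P.X (n + 1)} (hx : x ∈ spanOf b A (n + 1)) : P.d (n + 1) n x ∈ spanOf b A n := by
  refine (Submodule.span_le (p := (spanOf b A n).comap (P.d (n + 1) n).hom)).2 ?_ hx
  rintro _ ⟨y, hy, rfl⟩
  refine (b n).mem_span_image.2 fun z hz ↦ ?_
  exact hA _ hy ⟨n, z⟩ ⟨rfl, by simpa using hz⟩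

variable (b) in
/-- A graded section of `p` commuting with the differentials on the subcomplex spanned by a set
of basis elements. -/
structure PartialSection (p : Z ⟶ P) where
  /-- the basis elements spanning the subcomplex -/
  carrier : Set (Σ n, B n)
  mem_of_succ : ∀ x ∈ carrier, ∀ y, Succ b x y → y ∈ carrier
  /-- the graded section -/
  s (n : ℤ) : P.X n ⟶ Z.X n
  s_comp (n : ℤ) : s n ≫ p.f n = 𝟙 _
  comm (n : ℤ) (y : B (n + 1)) : ⟨n + 1, y⟩ ∈ carrier →
    Z.d (n + 1) n (s (n + 1) (b (n + 1) y)) = s n (P.d (n + 1) n (b (n + 1) y))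

namespace PartialSection

variable {p : Z ⟶ P}

lemma comm_of_mem (a : PartialSection b p) {n : ℤ} {x : P.X (n + 1)}
    (hx : x ∈ spanOf b a.carrier (n + 1)) :
    Z.d (n + 1) n (a.s (n + 1) x) = a.s n (P.d (n + 1) n x) :=
  spanOf_induction (f := (a.s (n + 1) ≫ Z.d (n + 1) n).hom) (g := (P.d (n + 1) n ≫ a.s n).hom)
    (a.comm n) hx

/-- `a'` extends `a`. -/
def Extends (a a' : PartialSection b p) : Prop :=
  a.carrier ⊆ a'.carrier ∧ ∀ n y, ⟨n, y⟩ ∈ a.carrier → a.s n (b n y) = a'.s n (b n y)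

lemma Extends.trans {a a' a'' : PartialSection b p} (h : Extends a a') (h' : Extends a' a'') :
    Extends a a'' :=
  ⟨h.1.trans h'.1, fun n y hy ↦ (h.2 n y hy).trans (h'.2 n y (h.1 hy))⟩

lemma exists_extends_of_isChain {c : Set (PartialSection b p)} (hc : IsChain Extends c)
    (hc' : c.Nonempty) : ∃ a', ∀ a ∈ c, Extends a a' := by
  classical
  obtain ⟨a₀, ha₀⟩ := hc'
  have agree {a a' : PartialSection b p} (ha : a ∈ c) (ha' : a' ∈ c) {n : ℤ} {y : B n}
      (hy : ⟨n, y⟩ ∈ a.carrier) (hy' : ⟨n, y⟩ ∈ a'.carrier) :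
      a.s n (b n y) = a'.s n (b n y) := by
    by_cases h : a = a'
    · rw [h]
    · obtain h | h := hc ha ha' h
      · exact h.2 n y hy
      · exact (h.2 n y hy').symm
  let v (n : ℤ) (y : B n) : Z.X n :=
    if h : ∃ a ∈ c, ⟨n, y⟩ ∈ a.carrier then h.choose.s n (b n y) else a₀.s n (b n y)
  let s (n : ℤ) : P.X n ⟶ Z.X n := ModuleCat.ofHom ((b n).constr ℕ (v n))
  have hv {a : PartialSection b p} (ha : a ∈ c) {n : ℤ} {y : B n} (hy : ⟨n, y⟩ ∈ a.carrier) :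
      a.s n (b n y) = s n (b n y) := by
    have h : ∃ a ∈ c, ⟨n, y⟩ ∈ a.carrier := ⟨a, ha, hy⟩
    change _ = (b n).constr ℕ (v n) (b n y)
    rw [Module.Basis.constr_basis]
    simp only [v, dif_pos h]
    exact agree ha h.choose_spec.1 hy h.choose_spec.2
  have hv' {a : PartialSection b p} (ha : a ∈ c) {n : ℤ} {x : P.X n}
      (hx : x ∈ spanOf b a.carrier n) : a.s n x = s n x :=
    spanOf_induction (f := (a.s n).hom) (g := (s n).hom) (fun y hy ↦ hv ha hy) hx
  refine ⟨{
    carrier := ⋃ a ∈ c, a.carrier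
    mem_of_succ := ?_
    s := s
    s_comp := ?_
    comm := ?_ }, fun a ha ↦ ⟨Set.subset_biUnion_of_mem (u := fun a ↦ a.carrier) ha,
      fun n y hy ↦ hv ha hy⟩⟩
  · intro x hx y hy
    obtain ⟨a, ha, hx⟩ := Set.mem_iUnion₂.1 hx
    exact Set.mem_biUnion ha (a.mem_of_succ x hx y hy)
  · intro n
    have (a : PartialSection b p) (x : P.X n) : p.f n (a.s n x) = x :=
      LinearMap.congr_fun (congr_arg ModuleCat.Hom.hom (a.s_comp n)) x
    refine ModuleCat.hom_ext ((b n).ext fun y ↦ ?_)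
    change p.f n ((b n).constr ℕ (v n) (b n y)) = b n y
    rw [Module.Basis.constr_basis]
    dsimp only [v]
    split_ifs <;> exact this _ _
  · intro n y hy
    obtain ⟨a, ha, hy⟩ := Set.mem_iUnion₂.1 hy
    rw [← hv ha hy, a.comm n y hy,
      hv' ha (d_mem_spanOf a.mem_of_succ (basis_mem_spanOf hy))]

lemma exists_extends_mem {j : W ⟶ Z} (hjp : IsSES j p)
    (hW : ∀ S : FreeComplexData R, Ext1IsZero S.complex W) (a : PartialSection b p)
    (x : Σ n, B n) : ∃ a', Extends a a' ∧ x ∈ a'.carrier := by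
  classical
  let C : Set (Σ n, B n) := {y | Relation.ReflTransGen (Succ b) x y ∧ y ∉ a.carrier}
  have hAC : ∀ y ∈ a.carrier ∪ C, ∀ z, Succ b y z → z ∈ a.carrier ∪ C := by
    intro y hy z hz
    by_cases h : z ∈ a.carrier
    · exact Or.inl h
    · obtain hy | hy := hy
      · exact Or.inl (a.mem_of_succ y hy z hz)
      · exact Or.inr ⟨hy.1.tail hz, h⟩
  have (n : ℤ) : Finite {y : B n // ⟨n, y⟩ ∈ C} := by
    have := (finite_descendants Sigma.fst (Succ b) (finite_succ b) (fun _ _ h ↦ h.1) x n).to_subtype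
    exact Finite.of_injective
      (β := {y : Σ n, B n | Relation.ReflTransGen (Succ b) x y ∧ y.1 = n})
      (fun y ↦ ⟨⟨n, y.1⟩, y.2.1, rfl⟩) (fun y y' h ↦ by
        simpa [Subtype.ext_iff] using h)
  let φ (n : ℤ) : Fin (Nat.card {y : B n // ⟨n, y⟩ ∈ C}) ≃ {y : B n // ⟨n, y⟩ ∈ C} :=
    (Finite.equivFin _).symm
  have hφ (n : ℤ) : Function.Injective fun k ↦ (φ n k).1 :=
    Subtype.val_injective.comp (φ n).injective
  let F (n : ℤ) := Fin (Nat.card {y : B n // ⟨n, y⟩ ∈ C}) →₀ R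
  let ι (n : ℤ) : F n →ₗ[R] P.X n := Finsupp.linearCombination R fun k ↦ b n (φ n k).1
  let π (n : ℤ) : P.X n →ₗ[R] F n :=
    Finsupp.lcomapDomain (fun k ↦ (φ n k).1) (hφ n) ∘ₗ (b n).repr.toLinearMap
  have hι (n : ℤ) (k) : ι n (Finsupp.single k 1) = b n (φ n k).1 :=
    (Finsupp.linearCombination_single R _ _).trans (one_smul _ _)
  have π_apply (n : ℤ) (x : P.X n) (k) : π n x k = (b n).repr x (φ n k).1 := rfl
  have hπι (n : ℤ) : π n ∘ₗ ι n = LinearMap.id := by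
    refine Finsupp.basisSingleOne.ext fun k ↦ Finsupp.ext fun k' ↦ ?_
    simp only [Finsupp.coe_basisSingleOne, LinearMap.comp_apply, hι, π_apply,
      Module.Basis.repr_self, LinearMap.id_apply, Finsupp.single_apply, (hφ n).eq_iff]
  have hπι' (n : ℤ) (v : F n) : π n (ι n v) = v := LinearMap.congr_fun (hπι n) v
  have hπ (n : ℤ) (x : P.X n) (hx : x ∈ spanOf b a.carrier n) : π n x = 0 :=
    Finsupp.ext fun k ↦ repr_eq_zero_of_mem_spanOf hx (φ n k).2.2
  have hCι (n : ℤ) (y : B n) (hy : ⟨n, y⟩ ∈ C) : ∃ v, ι n v = b n y :=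
    ⟨Finsupp.single ((φ n).symm ⟨y, hy⟩) 1, by rw [hι]; simp⟩
  have hιC (n : ℤ) (v : F n) : ι n v ∈ spanOf b (a.carrier ∪ C) n := by
    have : v ∈ (⊤ : Submodule R (F n)) := trivial
    rw [← Finsupp.basisSingleOne.span_eq] at this
    refine (Submodule.span_le (p := (spanOf b (a.carrier ∪ C) n).comap (ι n))).2 ?_ this
    rintro _ ⟨k, rfl⟩
    simpa only [Finsupp.coe_basisSingleOne, SetLike.mem_coe, Submodule.mem_comap, hι] using
      basis_mem_spanOf (Or.inr (φ n k).2)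
  have hιπ (n : ℤ) (x : P.X n) (hx : x ∈ spanOf b (a.carrier ∪ C) n) :
      x - ι n (π n x) ∈ spanOf b a.carrier n := by
    refine (Submodule.span_le
      (p := (spanOf b a.carrier n).comap (LinearMap.id - ι n ∘ₗ π n))).2 ?_ hx
    rintro _ ⟨y, hy | hy, rfl⟩
    · simpa [hπ n _ (basis_mem_spanOf hy)] using basis_mem_spanOf hy
    · obtain ⟨v, hv⟩ := hCι n y hy
      simp [← hv, hπι']
  let δ (n : ℤ) : F (n + 1) →ₗ[R] F n := π n ∘ₗ (P.d (n + 1) n).hom ∘ₗ ι (n + 1)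
  have hδ (n : ℤ) (v : F (n + 1)) : P.d (n + 1) n (ι (n + 1) v) - ι n (δ n v) ∈
      spanOf b a.carrier n :=
    hιπ n _ (d_mem_spanOf hAC (hιC (n + 1) v))
  let S : FreeComplexData R :=
    { rank n := Nat.card {y : B n // ⟨n, y⟩ ∈ C}
      d := δ
      d_comp_d n := LinearMap.ext fun v ↦ by
        have := hπ n _ (d_mem_spanOf a.mem_of_succ (hδ (n + 1) v))
        rw [map_sub, map_sub, d_d_apply, map_zero, zero_sub, neg_eq_zero] at this
        exact this }
  have hS (n : ℤ) (v : F (n + 1)) : S.complex.d (n + 1) n v = δ n v := by simp [S]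
  obtain ⟨s, hps, hsa, hs⟩ := exists_section_of_ext1IsZero hjp (spanOf b a.carrier) a.s a.s_comp
    (fun n x hx ↦ a.comm_of_mem hx) (hW S) (fun n ↦ ModuleCat.ofHom (ι n))
    (fun n ↦ ModuleCat.ofHom (π n)) (fun n ↦ ModuleCat.hom_ext (hπι n)) hπ
    (fun n v ↦ by rw [hS]; exact hδ n v)
  refine ⟨{
    carrier := a.carrier ∪ C
    mem_of_succ := hAC
    s := s
    s_comp := hps
    comm := ?_ }, ⟨Set.subset_union_left, fun n y hy ↦ (hsa n _ (basis_mem_spanOf hy)).symm⟩, ?_⟩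
  · rintro n y (hy | hy)
    · rw [hsa _ _ (basis_mem_spanOf hy), a.comm n y hy,
        hsa n _ (d_mem_spanOf a.mem_of_succ (basis_mem_spanOf hy))]
    · obtain ⟨v, hv⟩ := hCι _ y hy
      rw [← hv]
      exact hs n v
  · by_cases h : x ∈ a.carrier
    · exact Or.inl h
    · exact Or.inr ⟨.refl, h⟩

end PartialSection

lemma ext1IsZero_of_basis (b : ∀ n, Module.Basis (B n) R (P.X n))
    (hW : ∀ S : FreeComplexData R, Ext1IsZero S.complex W) : Ext1IsZero P W := by
  refine ext1IsZero_of_exists_section fun Z j p hjp ↦ ?_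
  have (n : ℤ) : ∃ s : P.X n ⟶ Z.X n, s ≫ p.f n = 𝟙 _ := by
    have : Projective (P.X n) := ModuleCat.projective_of_free (b n)
    exact (ext1IsZero_of_projective _ _).exists_section (hjp.eval n)
  choose s₀ hs₀ using this
  have : Nonempty (PartialSection b p) := ⟨⟨∅, by simp, s₀, hs₀, by simp⟩⟩
  obtain ⟨a, ha⟩ := exists_maximal_of_nonempty_chains_bounded
    (fun c hc hc' ↦ PartialSection.exists_extends_of_isChain (b := b) (p := p) hc hc')
    PartialSection.Extends.trans
  have mem (x : Σ n, B n) : x ∈ a.carrier := by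
    obtain ⟨a', h, hx⟩ := a.exists_extends_mem hjp hW x
    exact (ha a' h).1 hx
  refine ⟨{ f := a.s, comm' := ?_ }, ?_⟩
  · intro i k hik
    obtain rfl : k + 1 = i := hik
    exact ModuleCat.hom_ext ((b (k + 1)).ext fun y ↦ a.comm k y (mem _))
  · ext1 n
    exact a.s_comp n

/-- A complex is contraacyclic if it is right orthogonal to the complexes of finitely generated
free modules. -/
lemma mem_rightPerp_dwProj_of_freeComplexData
    (hW : ∀ S : FreeComplexData R, Ext1IsZero S.complex W) :
    W ∈ rightPerp (dwProj (ModuleCat.{u} R)) := by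
  intro P hP
  obtain ⟨P', ⟨h⟩, _⟩ := exists_retract_free hP
  exact (ext1IsZero_of_basis (fun n ↦ Module.Free.chooseBasis R (P'.X n)) hW).of_retract_left
    h.i h.r h.retract

end PartialSection

section Complete

variable (R : Type u) [Ring R]

lemma isCompletePair_dwProj :
    IsCompletePair (dwProj (ModuleCat.{u} R)) (rightPerp (dwProj (ModuleCat.{u} R))) := by
  have embed (M : ChainComplex (ModuleCat.{u} R) ℤ) :
      ∃ Q W : ChainComplex (ModuleCat.{u} R) ℤ, Q ∈ dwProj (ModuleCat.{u} R) ∧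
        W ∈ rightPerp (dwProj (ModuleCat.{u} R)) ∧ SES M W Q := by
    obtain ⟨W, Q, f, g, h, hQ, hW⟩ := exists_isSES_of_small (FreeComplexData.complex (R := R))
      FreeComplexData.complex_mem_dwProj M
    exact ⟨Q, W, hQ, mem_rightPerp_dwProj_of_freeComplexData hW, f, g, h⟩
  refine ⟨fun M ↦ ?_, embed⟩
  obtain ⟨F, q, _, hF⟩ := exists_epi_diskSum M
  obtain ⟨Q, W, hQ, hW, u, v, huv⟩ := embed (kernel q)
  have sq := IsPushout.of_hasPushout (kernel.ι q) u
  obtain ⟨g, -, hg⟩ := (isSES_kernel q).exists_of_isPushout sq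
  obtain ⟨g', -, hg'⟩ := huv.exists_of_isPushout sq.flip
  exact ⟨_, W, hg'.mem_dwProj_mid (fun n ↦ inferInstance) hQ, hW, _, g, hg⟩

lemma isCotorsionPair_dwProj :
    IsCotorsionPair (dwProj (ModuleCat.{u} R)) (rightPerp (dwProj (ModuleCat.{u} R))) := by
  refine ⟨Set.Subset.antisymm (fun P hP W hW ↦ hW P hP) fun X hX ↦ ?_, rfl⟩
  obtain ⟨Q, W, hQ, hW, f, g, h⟩ := (isCompletePair_dwProj R).1 X
  obtain ⟨s, hs⟩ := (hX W hW).exists_section h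
  exact mem_dwProj_of_retract ⟨s, g, hs⟩ hQ

end Complete

end AbModel

/-- Proposition (the Proj / contraderived model structure, Bravo–Gillespie–Hovey,
Becker): for any ring `R`, let `dwP` be the class of chain complexes of projective
`R`-modules and `Wctr = (dwP)ᗮ` the class of contraacyclic complexes.  Then
`(dwP, Wctr)` is a complete hereditary cotorsion pair in `Ch(R)`, `Wctr` is thick, and
`dwP ∩ Wctr` is exactly the class of projective objects of `Ch(R)`. -/
theorem contraacyclic_cotorsion_pair (R : Type u) [Ring R] :
    IsCompleteCotorsionPair
      {P : ChainComplex (ModuleCat.{u} R) ℤ | ∀ n, Projective (P.X n)}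
      (rightPerp {P : ChainComplex (ModuleCat.{u} R) ℤ | ∀ n, Projective (P.X n)}) ∧
    IsHereditaryPair
      {P : ChainComplex (ModuleCat.{u} R) ℤ | ∀ n, Projective (P.X n)}
      (rightPerp {P : ChainComplex (ModuleCat.{u} R) ℤ | ∀ n, Projective (P.X n)}) ∧
    IsThick
      (rightPerp {P : ChainComplex (ModuleCat.{u} R) ℤ | ∀ n, Projective (P.X n)}) ∧
    ({P : ChainComplex (ModuleCat.{u} R) ℤ | ∀ n, Projective (P.X n)} ∩
        rightPerp {P : ChainComplex (ModuleCat.{u} R) ℤ | ∀ n, Projective (P.X n)} =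
      {P : ChainComplex (ModuleCat.{u} R) ℤ | Projective P}) :=
  ⟨⟨isCotorsionPair_dwProj R, isCompletePair_dwProj R⟩, isHereditaryPair_dwProj,
    isThick_rightPerp_dwProj, dwProj_inter_rightPerp⟩
end

section
/- Let R be any ring, let ex𝒫 be the class of exact chain complexes of left R-modules all of whose components are projective, and let 𝒱_prj = (ex𝒫)^⊥ = {V : Ext¹(P, V) = 0 for all P ∈ ex𝒫}. Then: (1) (ex𝒫, 𝒱_prj) is a complete hereditary cotorsion pair in Ch(R); (2) 𝒱_prj is a thick class; (3) ex𝒫 ∩ 𝒱_prj is exactly the class of projective objects of Ch(R), i.e., the split exact complexes with projective components. -/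
open CategoryTheory Limits ZeroObject

open AbModel

namespace ExactProj

universe u v w

/-- A family of at most `κ` sets of cardinality at most `κ` has a union of cardinality
at most `κ`. -/
lemma mk_iUnion_le_of_forall_le {ι : Type v} {α : Type u} {κ : Cardinal.{u}}
    (hκ : Cardinal.aleph0 ≤ κ) (f : ι → Set α)
    (hι : Cardinal.lift.{u} (Cardinal.mk ι) ≤ Cardinal.lift.{v} κ)
    (hf : ∀ i, Cardinal.mk (f i) ≤ κ) : Cardinal.mk (⋃ i, f i) ≤ κ := by
  have h := Cardinal.mk_iUnion_le_lift f
  rw [← Cardinal.lift_le.{v}]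
  refine h.trans (Cardinal.mul_le_of_le ?_ hι (ciSup_le' fun i => ?_))
  · simpa using hκ
  · simpa using hf i

section FreeComplex

variable {R : Type u} [Ring R] {B : Type u}

/-- The finitely supported functions on a set of cardinality at most `κ` number at most `κ`. -/
lemma mk_supported_le {κ : Cardinal.{u}} (hκ : Cardinal.aleph0 ≤ κ) (hR : Cardinal.mk R ≤ κ)
    {U : Set B} (hU : Cardinal.mk U ≤ κ) :
    Cardinal.mk (Finsupp.supported R R U) ≤ κ := by
  rw [Cardinal.mk_congr (Finsupp.supportedEquivFinsupp (M := R) (R := R) U).toEquiv]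
  calc Cardinal.mk (U →₀ R) ≤ Cardinal.mk (Finset (U × R)) :=
        Cardinal.mk_le_of_injective (Finsupp.graph_injective U R)
    _ ≤ Cardinal.mk (Finset (κ.out)) := by
        have h : Cardinal.mk (U × R) ≤ Cardinal.mk κ.out := by
          rw [Cardinal.mk_out, Cardinal.mk_prod, Cardinal.lift_id, Cardinal.lift_id]
          exact Cardinal.mul_le_of_le hκ hU hR
        obtain ⟨e⟩ := Cardinal.le_def _ _ |>.1 h
        exact Cardinal.mk_le_of_injective (Finset.map_injective e)
    _ = κ := by
        have : Infinite κ.out := by rwa [Cardinal.infinite_iff, Cardinal.mk_out]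
        rw [Cardinal.mk_finset_of_infinite, Cardinal.mk_out]

/-- Every set of cardinality at most `κ` is contained in a set of cardinality at most `κ` which
is closed under countably many finitary support operations. -/
lemma exists_closed_set {κ : Cardinal.{u}} (hκ : Cardinal.aleph0 ≤ κ) (hR : Cardinal.mk R ≤ κ)
    {ι : Type v} [Countable ι] (z : ι → (B →₀ R) → (B →₀ R)) (b : B) :
    ∃ U : Set B, b ∈ U ∧ Cardinal.mk U ≤ κ ∧
      ∀ n, ∀ x ∈ Finsupp.supported R R U, z n x ∈ Finsupp.supported R R U := by
  let F : Set B → Set B := fun U =>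
    U ∪ ⋃ n : ι, ⋃ x : Finsupp.supported R R U, ((z n x).support : Set B)
  let U : ℕ → Set B := fun k => F^[k] {b}
  have hsucc (k : ℕ) : U (k + 1) = F (U k) := Function.iterate_succ_apply' F k {b}
  have hmono : Monotone U := monotone_nat_of_le_succ fun k => by
    rw [hsucc]; exact Set.subset_union_left
  have hcard (k : ℕ) : Cardinal.mk (U k) ≤ κ := by
    induction k with
    | zero =>
      rw [show U 0 = {b} from rfl, Cardinal.mk_singleton]
      exact Cardinal.one_le_aleph0.trans hκ
    | succ k ih =>
      rw [hsucc]
      refine (Cardinal.mk_union_le _ _).trans (Cardinal.add_le_of_le hκ ih ?_)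
      refine mk_iUnion_le_of_forall_le hκ _ (by
        rw [← Cardinal.aleph0_le_lift.{u, v}] at hκ
        exact (Cardinal.lift_le_aleph0.2 Cardinal.mk_le_aleph0).trans hκ) fun n => ?_
      refine mk_iUnion_le_of_forall_le hκ _ (by simpa using mk_supported_le hκ hR ih) fun x => ?_
      exact (Cardinal.lt_aleph0_of_finite _).le.trans hκ
  refine ⟨⋃ k, U k, Set.mem_iUnion.2 ⟨0, rfl⟩,
    mk_iUnion_le_of_forall_le hκ _ (by simpa using hκ) hcard, fun n x hx => ?_⟩
  rw [Finsupp.mem_supported] at hx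
  obtain ⟨k, hk⟩ := hmono.directed_le.exists_mem_subset_of_finset_subset_biUnion hx
  rw [Finsupp.mem_supported]
  refine subset_trans ?_ (Set.subset_iUnion U (k + 1))
  rw [hsucc]
  refine subset_trans ?_ Set.subset_union_right
  exact subset_trans (Set.subset_iUnion (fun x : Finsupp.supported R R (U k) =>
    ((z n x).support : Set B)) ⟨x, hk⟩) (Set.subset_iUnion (fun n : ι =>
      ⋃ x : Finsupp.supported R R (U k), ((z n x).support : Set B)) n)

/-- The endomorphisms `δ n` of `A`, with `δ n` leaving degree `n`, form an exact complex. -/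
structure IsExactFamily {A : Type u} [AddCommGroup A] [Module R A]
    (δ : ℤ → A →ₗ[R] A) : Prop where
  comp_eq_zero : ∀ n x, δ n (δ (n + 1) x) = 0
  exact : ∀ n x, δ n x = 0 → ∃ y, δ (n + 1) y = x

variable {W : ℤ → Type u} [∀ n, AddCommGroup (W n)] [∀ n, Module R (W n)]

/-- Every chain map from the complex `(A, δ)` to `(W, d)` is null-homotopic. -/
def AllNullHomotopic (d : ∀ n, W (n + 1) →ₗ[R] W n) {A : Type u} [AddCommGroup A] [Module R A]
    (δ : ℤ → A →ₗ[R] A) : Prop :=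
  ∀ f : ∀ n, A →ₗ[R] W n, (∀ n x, f n (δ (n + 1) x) = d n (f (n + 1) x)) →
    ∃ h : ∀ n, A →ₗ[R] W n, ∀ n x, f n x = h n (δ n x) + d n (h (n + 1) x)

lemma IsExactFamily.conj {A A' : Type u} [AddCommGroup A] [Module R A] [AddCommGroup A']
    [Module R A'] {δ : ℤ → A →ₗ[R] A} (hδ : IsExactFamily δ) (e : A ≃ₗ[R] A') :
    IsExactFamily (fun n => e.toLinearMap ∘ₗ δ n ∘ₗ e.symm.toLinearMap) where
  comp_eq_zero n x := by simp [hδ.comp_eq_zero]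
  exact n x hx := by
    obtain ⟨y, hy⟩ := hδ.exact n (e.symm x) (by simpa using hx)
    exact ⟨e y, by simp [hy]⟩

lemma AllNullHomotopic.of_conj (d : ∀ n, W (n + 1) →ₗ[R] W n) {A A' : Type u} [AddCommGroup A]
    [Module R A] [AddCommGroup A'] [Module R A'] {δ : ℤ → A →ₗ[R] A} (e : A ≃ₗ[R] A')
    (H : AllNullHomotopic d (fun n => e.toLinearMap ∘ₗ δ n ∘ₗ e.symm.toLinearMap)) :
    AllNullHomotopic d δ := by
  intro f hf
  obtain ⟨h, hh⟩ := H (fun n => f n ∘ₗ e.symm.toLinearMap) (fun n x => by simp [hf])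
  exact ⟨fun n => h n ∘ₗ e.toLinearMap, fun n x => by simpa using hh n (e x)⟩

/-- Restriction of finitely supported functions to a subset. -/
noncomputable def restrictTo (U : Set B) : (B →₀ R) →ₗ[R] (U →₀ R) :=
  Finsupp.lcomapDomain Subtype.val Subtype.val_injective

/-- Extension of finitely supported functions by zero. -/
noncomputable def extendByZero (U : Set B) : (U →₀ R) →ₗ[R] (B →₀ R) :=
  Finsupp.lmapDomain R R Subtype.val

@[simp]
lemma restrictTo_apply (U : Set B) (x : B →₀ R) (u : U) : restrictTo U x u = x u := rfl

@[simp]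
lemma restrictTo_extendByZero (U : Set B) (x : U →₀ R) : restrictTo U (extendByZero U x) = x := by
  ext u
  exact Finsupp.mapDomain_apply Subtype.val_injective _ _

lemma extendByZero_mem (U : Set B) (x : U →₀ R) : extendByZero U x ∈ Finsupp.supported R R U := by
  classical
  rw [Finsupp.mem_supported]
  intro b hb
  obtain ⟨u, -, rfl⟩ := Finset.mem_image.1 (Finsupp.mapDomain_support hb)
  exact u.2

lemma extendByZero_apply_of_notMem {U : Set B} (x : U →₀ R) {b : B} (hb : b ∉ U) :
    extendByZero U x b = 0 :=
  (Finsupp.mem_supported' R _).1 (extendByZero_mem U x) b hb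

lemma sub_extendByZero_mem {T T' : Set B} {x : B →₀ R}
    (hx : x ∈ Finsupp.supported R R T') :
    x - extendByZero (T' \ T) (restrictTo (T' \ T) x) ∈ Finsupp.supported R R T := by
  rw [Finsupp.mem_supported'] at hx ⊢
  intro b hb
  by_cases hb' : b ∈ T'
  · have := DFunLike.congr_fun (restrictTo_extendByZero (R := R) (T' \ T) (restrictTo (T' \ T) x))
      ⟨b, hb', hb⟩
    simp only [restrictTo_apply] at this
    simp [this]
  · rw [Finsupp.sub_apply, hx b hb', extendByZero_apply_of_notMem _ fun h => hb' h.1, sub_zero]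

lemma restrictTo_eq_zero {T T' : Set B} {x : B →₀ R} (hx : x ∈ Finsupp.supported R R T) :
    restrictTo (T' \ T) x = 0 := by
  ext u
  exact (Finsupp.mem_supported' R _).1 hx u u.2.2

lemma mem_of_restrictTo_eq_zero {T T' : Set B} {x : B →₀ R}
    (hx : x ∈ Finsupp.supported R R T') (h : restrictTo (T' \ T) x = 0) :
    x ∈ Finsupp.supported R R T := by
  simpa [h] using sub_extendByZero_mem hx (T := T)

/-- `T` spans an exact subcomplex of `(B →₀ R, δ)`. -/
structure IsExactSubset (δ : ℤ → (B →₀ R) →ₗ[R] (B →₀ R)) (T : Set B) : Prop where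
  map_mem : ∀ n, ∀ x ∈ Finsupp.supported R R T, δ n x ∈ Finsupp.supported R R T
  exact : ∀ n, ∀ x ∈ Finsupp.supported R R T, δ n x = 0 →
    ∃ y ∈ Finsupp.supported R R T, δ (n + 1) y = x

/-- An exact subset which is not everything has a strictly larger exact subset with small
exact quotient. -/
lemma IsExactSubset.exists_larger {δ : ℤ → (B →₀ R) →ₗ[R] (B →₀ R)} (hδ : IsExactFamily δ)
    {T : Set B} (hT : IsExactSubset δ T) {κ : Cardinal.{u}} (hκ : Cardinal.aleph0 ≤ κ)
    (hR : Cardinal.mk R ≤ κ) (b : B) :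
    ∃ T' : Set B, T ⊆ T' ∧ b ∈ T' ∧ IsExactSubset δ T' ∧ Cardinal.mk (T' \ T : Set B) ≤ κ ∧
      IsExactFamily (fun n => restrictTo (T' \ T) ∘ₗ δ n ∘ₗ extendByZero (T' \ T)) := by
  classical
  have hz (n : ℤ) (x : B →₀ R) : ∃ z, δ n x ∈ Finsupp.supported R R T →
      x - δ (n + 1) z ∈ Finsupp.supported R R T := by
    by_cases hx : δ n x ∈ Finsupp.supported R R T
    · obtain ⟨y, hy, hyx⟩ := hT.exact (n - 1) (δ n x) hx (by
        have := hδ.comp_eq_zero (n - 1) x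
        rwa [sub_add_cancel] at this)
      rw [sub_add_cancel] at hyx
      obtain ⟨z, hz⟩ := hδ.exact n (x - y) (by rw [map_sub, hyx, sub_self])
      exact ⟨z, fun _ => by rw [hz]; simpa using hy⟩
    · exact ⟨0, fun h => absurd h hx⟩
  choose z hz using hz
  obtain ⟨U, hbU, hU, hUδ⟩ := exists_closed_set hκ hR
    (Sum.elim (fun n x => δ n x) z : ℤ ⊕ ℤ → _) b
  have hδU (n : ℤ) {x} (hx : x ∈ Finsupp.supported R R U) := hUδ (Sum.inl n) x hx
  have hzU (n : ℤ) {x} (hx : x ∈ Finsupp.supported R R U) := hUδ (Sum.inr n) x hx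
  simp only [Sum.elim_inl, Sum.elim_inr] at hδU hzU
  have hTle := Finsupp.supported_mono (M := R) (R := R) (Set.subset_union_left (s := T) (t := U))
  have hUle := Finsupp.supported_mono (M := R) (R := R) (Set.subset_union_right (s := T) (t := U))
  have hsub : (T ∪ U) \ T ⊆ U := fun x hx => hx.1.resolve_left hx.2
  have hext (w) : extendByZero ((T ∪ U) \ T) w ∈ Finsupp.supported R R U :=
    Finsupp.supported_mono hsub (extendByZero_mem _ _)
  have hmap (n) (x) (hx : x ∈ Finsupp.supported R R (T ∪ U)) :
      δ n x ∈ Finsupp.supported R R (T ∪ U) := by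
    have h1 := hTle (hT.map_mem n _ (sub_extendByZero_mem hx (T := T)))
    have h2 := hUle (hδU n (hext (restrictTo _ x)))
    simpa using add_mem h1 h2
  refine ⟨T ∪ U, Set.subset_union_left, Or.inr hbU, ⟨hmap, fun n x hx hx0 => ?_⟩,
    (Cardinal.mk_le_mk_of_subset hsub).trans hU, ⟨fun n w => ?_, fun n w hw => ?_⟩⟩
  · have h1 := sub_extendByZero_mem hx (T := T)
    set e := extendByZero ((T ∪ U) \ T) (restrictTo _ x)
    have h2 : e ∈ Finsupp.supported R R U := hext _
    have h3 : δ n e ∈ Finsupp.supported R R T := by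
      have := hT.map_mem n _ h1
      rw [map_sub, hx0, zero_sub] at this
      simpa using neg_mem this
    have h4 := add_mem h1 (hz n e h3)
    rw [sub_add_sub_cancel] at h4
    obtain ⟨y, hy, hyx⟩ := hT.exact n _ h4 (by rw [map_sub, hx0, hδ.comp_eq_zero, sub_zero])
    exact ⟨y + z n e, add_mem (hTle hy) (hUle (hzU n h2)), by rw [map_add, hyx]; abel⟩
  · have h1 := sub_extendByZero_mem (hmap (n + 1) _ (hUle (hext w))) (T := T)
    have h2 := restrictTo_eq_zero (T' := T ∪ U) (hT.map_mem n _ h1)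
    rw [map_sub, hδ.comp_eq_zero, zero_sub, map_neg, neg_eq_zero] at h2
    exact h2
  · have h1 := hz n _ (mem_of_restrictTo_eq_zero (hmap n _ (hUle (hext w))) hw)
    set x := extendByZero ((T ∪ U) \ T) w
    refine ⟨restrictTo _ (z n x), ?_⟩
    have h2 := restrictTo_eq_zero (T' := T ∪ U)
      (hT.map_mem (n + 1) _ (sub_extendByZero_mem (hUle (hzU n (hext w))) (T := T)))
    have h3 := restrictTo_eq_zero (T' := T ∪ U) h1
    rw [map_sub, sub_eq_zero, restrictTo_extendByZero] at h3
    rw [map_sub, map_sub, sub_eq_zero] at h2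
    simp only [LinearMap.comp_apply]
    rw [← h2, ← h3]

/-- Null-homotopies of maps out of an exact complex of free modules can be constructed as soon
as they exist for the small exact complexes of free modules. -/
theorem allNullHomotopic_of_small (d : ∀ n, W (n + 1) →ₗ[R] W n)
    (hd : ∀ n x, d n (d (n + 1) x) = 0)
    {κ : Cardinal.{u}} (hκ : Cardinal.aleph0 ≤ κ) (hR : Cardinal.mk R ≤ κ)
    (H : ∀ (U : Type u), Cardinal.mk U ≤ κ → ∀ δ : ℤ → (U →₀ R) →ₗ[R] (U →₀ R),
      IsExactFamily δ → AllNullHomotopic d δ)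
    {δ : ℤ → (B →₀ R) →ₗ[R] (B →₀ R)} (hδ : IsExactFamily δ) : AllNullHomotopic d δ := by
  classical
  intro f hf
  let Q := {p : Set B × (∀ n, (B →₀ R) →ₗ[R] W n) // IsExactSubset δ p.1 ∧
    ∀ n, ∀ x ∈ Finsupp.supported R R p.1, f n x = p.2 n (δ n x) + d n (p.2 (n + 1) x)}
  let r : Q → Q → Prop := fun p q => p.1.1 ⊆ q.1.1 ∧
    ∀ n, ∀ x ∈ Finsupp.supported R R p.1.1, p.1.2 n x = q.1.2 n x
  have hchain (c : Set Q) (hc : IsChain r c) : ∃ ub, ∀ a ∈ c, r a ub := by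
    rcases c.eq_empty_or_nonempty with rfl | ⟨p₀, hp₀⟩
    · refine ⟨⟨⟨∅, 0⟩, ⟨⟨?_, ?_⟩, ?_⟩⟩, by simp⟩
      · simp +contextual
      · intro n x hx _
        rw [Finsupp.supported_empty, Submodule.mem_bot] at hx
        exact ⟨0, by simp, by simp [hx]⟩
      · simp +contextual
    · let T : Set B := ⋃ p : c, p.1.1.1
      let g : ∀ n, B → W n := fun n b =>
        if hb : ∃ p : c, b ∈ p.1.1.1 then hb.choose.1.1.2 n (Finsupp.single b 1) else 0
      let h : ∀ n, (B →₀ R) →ₗ[R] W n := fun n => Finsupp.linearCombination R (g n)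
      have hdir : Directed (· ⊆ ·) (fun p : c => p.1.1.1) := fun p q => by
        rcases eq_or_ne p.1 q.1 with hpq | hpq
        · exact ⟨p, subset_rfl, (congrArg (fun p : Q => p.1.1) hpq).ge⟩
        · rcases hc p.2 q.2 hpq with h' | h'
          exacts [⟨q, h'.1, subset_rfl⟩, ⟨p, subset_rfl, h'.1⟩]
      have hagree (p : c) (n : ℤ) (x) (hx : x ∈ Finsupp.supported R R p.1.1.1) :
          p.1.1.2 n x = h n x := by
        rw [Finsupp.supported_eq_span_single] at hx
        refine LinearMap.eqOn_span (f := p.1.1.2 n) (g := h n) ?_ hx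
        rintro _ ⟨b, hb, rfl⟩
        have hb' : ∃ q : c, b ∈ q.1.1.1 := ⟨p, hb⟩
        have hq := hb'.choose_spec
        simp only [h, g, Finsupp.linearCombination_single, one_smul, dif_pos hb']
        generalize hb'.choose = q at hq
        rcases eq_or_ne p.1 q.1 with hpq | hpq
        · rw [hpq]
        · rcases hc p.2 q.2 hpq with h' | h'
          · exact h'.2 n _ (Finsupp.single_mem_supported R 1 hb)
          · exact (h'.2 n _ (Finsupp.single_mem_supported R 1 hq)).symm
      have hle (p : c) : Finsupp.supported R R p.1.1.1 ≤ Finsupp.supported R R T :=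
        Finsupp.supported_mono (Set.subset_iUnion (fun p : c => p.1.1.1) p)
      have hmem (x) (hx : x ∈ Finsupp.supported R R T) :
          ∃ p : c, x ∈ Finsupp.supported R R p.1.1.1 := by
        have : Nonempty c := ⟨⟨p₀, hp₀⟩⟩
        exact hdir.exists_mem_subset_of_finset_subset_biUnion hx
      refine ⟨⟨⟨T, h⟩, ⟨⟨fun n x hx => ?_, fun n x hx hx0 => ?_⟩, fun n x hx => ?_⟩⟩,
        fun p hp => ⟨Set.subset_iUnion (fun p : c => p.1.1.1) ⟨p, hp⟩, hagree ⟨p, hp⟩⟩⟩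
      · obtain ⟨p, hp⟩ := hmem x hx
        exact hle p (p.1.2.1.map_mem n x hp)
      · obtain ⟨p, hp⟩ := hmem x hx
        obtain ⟨y, hy, hyx⟩ := p.1.2.1.exact n x hp hx0
        exact ⟨y, hle p hy, hyx⟩
      · obtain ⟨p, hp⟩ := hmem x hx
        simp only
        rw [← hagree p _ _ hp, ← hagree p _ _ (p.1.2.1.map_mem n x hp)]
        exact p.1.2.2 n x hp
  obtain ⟨⟨⟨T, h⟩, hT, hh⟩, hmax⟩ := exists_maximal_of_chains_bounded (r := r)
    hchain (fun {p q s} hpq hqs => ⟨hpq.1.trans hqs.1, fun n x hx =>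
      (hpq.2 n x hx).trans (hqs.2 n x (Finsupp.supported_mono hpq.1 hx))⟩)
  suffices hT' : T = Set.univ from
    ⟨h, fun n x => hh n x (by simp [hT'])⟩
  refine Set.eq_univ_of_forall fun b => ?_
  obtain ⟨T', hTT', hb, hT', hcard, hex⟩ := hT.exists_larger hδ hκ hR b
  let e : ∀ n, (B →₀ R) →ₗ[R] W n := fun n =>
    f n - h n ∘ₗ δ n - d n ∘ₗ h (n + 1)
  have he (n x) : e n x = f n x - h n (δ n x) - d n (h (n + 1) x) := rfl
  have heT (n) (x) (hx : x ∈ Finsupp.supported R R T) : e n x = 0 := by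
    rw [he, hh n x hx]; abel
  have heδ (n x) : e n (δ (n + 1) x) = d n (e (n + 1) x) := by
    simp [he, hf, hδ.comp_eq_zero, hd]
  have her (n) (x) (hx : x ∈ Finsupp.supported R R T') :
      e n (extendByZero (T' \ T) (restrictTo (T' \ T) x)) = e n x := by
    have := heT n _ (sub_extendByZero_mem hx (T := T))
    rw [map_sub, sub_eq_zero] at this
    exact this.symm
  obtain ⟨k, hk⟩ := H _ hcard _ hex (fun n => e n ∘ₗ extendByZero (T' \ T)) (fun n x => by
    simp only [LinearMap.comp_apply]
    rw [her n _ (hT'.map_mem _ _ (Finsupp.supported_mono Set.sdiff_subset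
      (extendByZero_mem _ _))), heδ])
  have hk' (n) (x) (hx : x ∈ Finsupp.supported R R T') :
      e n x = k n (restrictTo (T' \ T) (δ n x)) +
        d n (k (n + 1) (restrictTo (T' \ T) x)) := by
    have h1 := hk n (restrictTo (T' \ T) x)
    simp only [LinearMap.comp_apply] at h1
    rw [her n x hx] at h1
    have h2 := restrictTo_eq_zero (T' := T')
      (hT.map_mem n _ (sub_extendByZero_mem hx (T := T)))
    rw [map_sub, map_sub, sub_eq_zero] at h2
    rw [h1, h2]
  have hmem := hmax ⟨⟨T', fun n => h n + k n ∘ₗ restrictTo (T' \ T)⟩, hT', fun n x hx => by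
    have h1 := hk' n x hx
    rw [he, sub_sub, sub_eq_iff_eq_add] at h1
    simp only [LinearMap.add_apply, LinearMap.comp_apply, map_add]
    rw [h1]
    abel⟩ ⟨hTT', fun n x hx => by
      simp [restrictTo_eq_zero (T' := T') hx]⟩
  exact hmem.1 hb

end FreeComplex

section Complexes

variable {R : Type u} [Ring R]

/-- The class of exact complexes of projective modules. -/
abbrev exProj (R : Type u) [Ring R] : Set (ChainComplex (ModuleCat.{u} R) ℤ) :=
  {P | (∀ n, P.ExactAt n) ∧ ∀ n, Projective (P.X n)}

variable {K L M : ChainComplex (ModuleCat.{u} R) ℤ}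

lemma exactAt_succ_iff (K : ChainComplex (ModuleCat.{u} R) ℤ) (n : ℤ) :
    K.ExactAt (n + 1) ↔ ∀ x : K.X (n + 1), K.d (n + 1) n x = 0 →
      ∃ y : K.X (n + 1 + 1), K.d (n + 1 + 1) (n + 1) y = x := by
  rw [K.exactAt_iff' (n + 1 + 1) (n + 1) n (by simp) (by simp), ShortComplex.moduleCat_exact_iff]
  rfl

lemma exact_iff (K : ChainComplex (ModuleCat.{u} R) ℤ) :
    (∀ n, K.ExactAt n) ↔ ∀ n (x : K.X (n + 1)), K.d (n + 1) n x = 0 →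
      ∃ y : K.X (n + 1 + 1), K.d (n + 1 + 1) (n + 1) y = x :=
  ⟨fun h n => (exactAt_succ_iff K n).1 (h _), fun h n => by
    obtain ⟨m, rfl⟩ : ∃ m, n = m + 1 := ⟨n - 1, by simp⟩
    exact (exactAt_succ_iff K m).2 (h m)⟩

lemma d_d_apply (K : ChainComplex (ModuleCat.{u} R) ℤ) (i j k : ℤ) (x : K.X i) :
    K.d j k (K.d i j x) = 0 := by
  rw [← ConcreteCategory.comp_apply, K.d_comp_d]
  rfl

lemma hom_comm_apply (f : K ⟶ L) (i j : ℤ) (x : K.X i) :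
    f.f j (K.d i j x) = L.d i j (f.f i x) := by
  rw [← ConcreteCategory.comp_apply, ← f.comm, ConcreteCategory.comp_apply]

lemma hom_ext_succ {f g : K ⟶ L} (h : ∀ n (x : K.X (n + 1)), f.f (n + 1) x = g.f (n + 1) x) :
    f = g := by
  ext n x
  obtain ⟨m, rfl⟩ : ∃ m, n = m + 1 := ⟨n - 1, by simp⟩
  exact h m x

lemma isSES_iff {f : K ⟶ L} {g : L ⟶ M} : IsSES f g ↔
    ∀ n, Function.Injective (f.f n) ∧ Function.Exact (f.f n) (g.f n) ∧
      Function.Surjective (g.f n) := by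
  constructor
  · rintro ⟨w, h⟩ n
    have h' := (HomologicalComplex.shortExact_iff_degreewise_shortExact _).1 h n
    exact ⟨h'.moduleCat_injective_f, (ShortComplex.ShortExact.moduleCat_exact_iff_function_exact _).1
      h'.exact, h'.moduleCat_surjective_g⟩
  · intro h
    have w : f ≫ g = 0 := by
      ext n x
      exact (h n).2.1.apply_apply_eq_zero x
    refine ⟨w, (HomologicalComplex.shortExact_iff_degreewise_shortExact _).2 fun n => ?_⟩
    exact ModuleCat.shortComplex_shortExact _ (h n).2.1 (h n).1 (h n).2.2

end Complexes

section Ext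

open Abelian

variable {C : Type u} [Category.{v} C] [Abelian C]

/-- Extending along the kernel of `D ⟶ X` is possible for maps to `Y` when every extension of
`X` by `Y` splits. -/
lemma exists_extension {K D X Y : C} {i : K ⟶ D} {p : D ⟶ X} (hS : IsSES i p)
    (h : Ext1IsZero X Y) (f : K ⟶ Y) : ∃ g : D ⟶ Y, i ≫ g = f := by
  obtain ⟨w, hS⟩ := hS
  have := hS.mono_f
  have := hS.epi_g
  have hw : i ≫ p = f ≫ 0 := by rw [w, comp_zero]
  let q : pushout i f ⟶ X := pushout.desc p 0 hw
  have hq : pushout.inr i f ≫ q = 0 := pushout.inr_desc _ _ _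
  have hpq : pushout.inl i f ≫ q = p := pushout.inl_desc _ _ _
  have hepi : Epi q := epi_of_epi_fac hpq
  have hex : (ShortComplex.mk _ _ hq).ShortExact :=
    { exact := by
        refine ShortComplex.exact_of_g_is_cokernel _ ?_
        refine CokernelCofork.IsColimit.ofπ _ _
          (fun k hk => hS.exact.desc (pushout.inl i f ≫ k) (by
            change i ≫ pushout.inl i f ≫ k = 0
            rw [pushout.condition_assoc, hk, comp_zero]))
          (fun k hk => ?_) (fun k hk m hm => ?_)
        · refine pushout.hom_ext ?_ ?_
          · rw [reassoc_of% hpq]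
            exact hS.exact.g_desc _ _
          · rw [reassoc_of% hq, zero_comp, hk]
        · rw [← cancel_epi p]
          refine Eq.trans ?_ (hS.exact.g_desc _ _).symm
          rw [← hm, reassoc_of% hpq]
      mono_f := inferInstanceAs (Mono (pushout.inr i f))
      epi_g := hepi }
  obtain ⟨s⟩ := h _ _ hq hex
  refine ⟨pushout.inl i f ≫ s.r, ?_⟩
  rw [pushout.condition_assoc]
  have := s.f_r
  dsimp only at this
  rw [this, Category.comp_id]

variable [HasExt.{w} C]

lemma ext1IsZero_of_subsingleton {X Y : C} [Subsingleton (Ext X Y 1)] : Ext1IsZero X Y := by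
  intro Z f g w hS
  obtain ⟨s, hs⟩ := Ext.covariant_sequence_exact₃ X hS (Ext.mk₀ (𝟙 X)) (zero_add 1)
    (Subsingleton.elim _ _)
  obtain ⟨s, rfl⟩ := Ext.addEquiv₀.symm.surjective s
  have hs' : s ≫ g = 𝟙 X := by
    apply Ext.addEquiv₀.symm.injective
    simpa using hs
  have := hS.mono_f
  exact ⟨ShortComplex.Splitting.ofExactOfSection _ hS.exact s hs' this⟩

/-- If `D` is projective and maps to `Y` extend along the kernel of `D ⟶ X`, then every extension
of `X` by `Y` splits. -/
lemma subsingleton_ext_of_extends {K D X Y : C} [Projective D] {i : K ⟶ D} {p : D ⟶ X}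
    (hS : IsSES i p) (h : ∀ f : K ⟶ Y, ∃ g : D ⟶ Y, i ≫ g = f) :
    Subsingleton (Ext X Y 1) := by
  obtain ⟨w, hS⟩ := hS
  refine subsingleton_of_forall_eq 0 fun x => ?_
  obtain ⟨f, rfl⟩ := Ext.contravariant_sequence_exact₃ hS Y x (Ext.eq_zero_of_projective _)
    (add_zero 1)
  obtain ⟨f, rfl⟩ := Ext.addEquiv₀.symm.surjective f
  obtain ⟨g, rfl⟩ := h f
  have := hS.extClass_comp_assoc (Ext.mk₀ g) (h := add_zero 1)
  rwa [Ext.mk₀_comp_mk₀] at this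

lemma ext1IsZero_iff [EnoughProjectives C] {X Y : C} :
    Ext1IsZero X Y ↔ Subsingleton (Ext X Y 1) := by
  refine ⟨fun h => ?_, fun _ => ext1IsZero_of_subsingleton⟩
  have hS : IsSES (kernel.ι (Projective.π X)) (Projective.π X) :=
    ⟨kernel.condition _, { exact := ShortComplex.exact_kernel _ }⟩
  exact subsingleton_ext_of_extends hS (exists_extension hS h)

/-- The right orthogonal of a class closed under syzygies and cosyzygies is thick. -/
lemma isThick_rightPerp [EnoughProjectives C] {S : Set C}
    (hsyz : ∀ P ∈ S, ∃ K ∈ S, ∃ D : C, Projective D ∧ SES K D P)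
    (hcosyz : ∀ P ∈ S, ∃ Q ∈ S, ∃ D : C, Projective D ∧ SES P D Q) :
    IsThick (rightPerp S) := by
  simp only [IsThick, rightPerp, Set.mem_ofPred_eq, ext1IsZero_iff]
  refine ⟨fun X Y hY ⟨i, r, hir⟩ P hP => ?_, fun X Y Z ⟨f, g, w, hS⟩ =>
    ⟨fun hX hY P hP => ?_, fun hX hZ P hP => ?_, fun hY hZ P hP => ?_⟩⟩
  · have := hY P hP
    refine subsingleton_of_forall_eq 0 fun x => ?_
    have h : (x.comp (Ext.mk₀ i) (add_zero 1)).comp (Ext.mk₀ r) (add_zero 1) = x := by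
      simp [hir]
    rw [← h, Subsingleton.elim (x.comp (Ext.mk₀ i) (add_zero 1)) 0, Ext.zero_comp]
  · have := hY P hP
    refine subsingleton_of_forall_eq 0 fun x => ?_
    obtain ⟨K, hK, D, hD, j, q, w', hS'⟩ := hsyz P hP
    have := hX K hK
    have h0 : x.comp hS.extClass (show 1 + 1 = 2 from rfl) = 0 := by
      obtain ⟨y, hy⟩ := Ext.contravariant_sequence_exact₃ hS' X
        (x.comp hS.extClass (show 1 + 1 = 2 from rfl)) (Ext.eq_zero_of_projective _)
        (show 1 + 1 = 2 from rfl)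
      rw [← hy, Subsingleton.elim y 0, Ext.comp_zero]
    obtain ⟨y, hy⟩ := Ext.covariant_sequence_exact₃ P hS x rfl h0
    rw [← hy, Subsingleton.elim y 0, Ext.zero_comp]
  · have := hX P hP
    have := hZ P hP
    refine subsingleton_of_forall_eq 0 fun x => ?_
    obtain ⟨y, hy⟩ := Ext.covariant_sequence_exact₂ P hS x (Subsingleton.elim _ _)
    rw [← hy, Subsingleton.elim y 0, Ext.zero_comp]
  · have := hY P hP
    refine subsingleton_of_forall_eq 0 fun x => ?_
    obtain ⟨Q, hQ, D, hD, j, q, w', hS'⟩ := hcosyz P hP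
    have := hZ Q hQ
    obtain ⟨y, hy⟩ := Ext.covariant_sequence_exact₁ P hS x (Subsingleton.elim _ _) (zero_add 1)
    obtain ⟨z, hz⟩ := Ext.contravariant_sequence_exact₁ hS' Z y (add_zero 1)
      (Subsingleton.elim _ _)
    rw [← hy, ← hz, Ext.comp_assoc _ _ _ (zero_add 0) (zero_add 1) (by rfl),
      Ext.eq_zero_of_projective (z.comp hS.extClass _), Ext.comp_zero]

end Ext

section Complexes

variable {R : Type u} [Ring R] {A : Type u} [AddCommGroup A] [Module R A]
  {K L M : ChainComplex (ModuleCat.{u} R) ℤ}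

/-- The complex which is `A` in every degree, with differentials given by `δ`. -/
noncomputable def constComplex (δ : ℤ → A →ₗ[R] A) (hδ : ∀ n x, δ n (δ (n + 1) x) = 0) :
    ChainComplex (ModuleCat.{u} R) ℤ :=
  ChainComplex.of (fun _ => ModuleCat.of R A) (fun n => ModuleCat.ofHom (δ (n + 1)))
    (fun n => by ext x; exact hδ (n + 1) x)

section

variable {δ : ℤ → A →ₗ[R] A} {hδ : ∀ n x, δ n (δ (n + 1) x) = 0}

/-- The terms of `constComplex δ` are equal to `A`. -/
noncomputable def constEquiv (δ : ℤ → A →ₗ[R] A) (hδ : ∀ n x, δ n (δ (n + 1) x) = 0) (n : ℤ) :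
    (constComplex δ hδ).X n ≃ₗ[R] A :=
  LinearEquiv.refl R A

lemma constEquiv_d (n : ℤ) (x : (constComplex δ hδ).X (n + 1)) :
    constEquiv δ hδ n ((constComplex δ hδ).d (n + 1) n x) =
      δ (n + 1) (constEquiv δ hδ (n + 1) x) := by
  have := ChainComplex.of_d (fun _ : ℤ => ModuleCat.of R A)
    (fun n => ModuleCat.ofHom (δ (n + 1))) n
  exact congrArg (fun f => f.hom x) this

/-- A chain map to `constComplex δ`, given by its components. -/
noncomputable def toConst (g : ∀ n, K.X n →ₗ[R] A)
    (hg : ∀ n x, g n (K.d (n + 1) n x) = δ (n + 1) (g (n + 1) x)) : K ⟶ constComplex δ hδ where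
  f n := ModuleCat.ofHom ((constEquiv δ hδ n).symm.toLinearMap ∘ₗ g n)
  comm' i j hij := by
    obtain rfl : j + 1 = i := hij
    ext x
    exact (constEquiv δ hδ j).injective ((constEquiv_d j _).trans (hg j x).symm)

/-- A chain map from `constComplex δ`, given by its components. -/
noncomputable def fromConst (g : ∀ n, A →ₗ[R] K.X n)
    (hg : ∀ n x, g n (δ (n + 1) x) = K.d (n + 1) n (g (n + 1) x)) : constComplex δ hδ ⟶ K where
  f n := ModuleCat.ofHom (g n ∘ₗ (constEquiv δ hδ n).toLinearMap)
  comm' i j hij := by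
    obtain rfl : j + 1 = i := hij
    ext x
    have := (hg j (constEquiv δ hδ _ x)).symm
    rw [← constEquiv_d] at this
    exact this

lemma constComplex_exact_iff :
    (∀ n, (constComplex δ hδ).ExactAt n) ↔ IsExactFamily δ := by
  rw [exact_iff]
  constructor
  · intro h
    refine ⟨hδ, fun n x hx => ?_⟩
    obtain ⟨m, rfl⟩ : ∃ m, n = m + 1 := ⟨n - 1, by simp⟩
    obtain ⟨y, hy⟩ := h m ((constEquiv δ hδ _).symm x) (by
      apply (constEquiv δ hδ _).injective
      simp [constEquiv_d, hx])
    exact ⟨constEquiv δ hδ _ y, by rw [← constEquiv_d, hy, LinearEquiv.apply_symm_apply]⟩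
  · intro h n x hx
    obtain ⟨y, hy⟩ := h.exact (n + 1) (constEquiv δ hδ _ x) (by
      rw [← constEquiv_d, hx, map_zero])
    refine ⟨(constEquiv δ hδ _).symm y, (constEquiv δ hδ _).injective ?_⟩
    rw [constEquiv_d, LinearEquiv.apply_symm_apply, hy]

end

/-- The sum over all degrees of the complexes `A = A`. -/
noncomputable def disk (R : Type u) [Ring R] (A : Type u) [AddCommGroup A] [Module R A] :
    ChainComplex (ModuleCat.{u} R) ℤ :=
  constComplex (A := A × A) (fun _ => LinearMap.inr R A A ∘ₗ LinearMap.fst R A A) (by simp)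

/-- The terms of `disk R A` are equal to `A × A`. -/
noncomputable def diskEquiv (R : Type u) [Ring R] (A : Type u) [AddCommGroup A] [Module R A]
    (n : ℤ) : (disk R A).X n ≃ₗ[R] A × A :=
  constEquiv _ _ n

lemma diskEquiv_d (n : ℤ) (x : (disk R A).X (n + 1)) :
    diskEquiv R A n ((disk R A).d (n + 1) n x) = (0, (diskEquiv R A (n + 1) x).1) :=
  constEquiv_d n x

lemma disk_exact (n : ℤ) : (disk R A).ExactAt n := by
  revert n
  refine constComplex_exact_iff.2 ⟨by simp, fun n x hx => ⟨(x.2, 0), ?_⟩⟩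
  have : x.1 = 0 := (Prod.ext_iff.1 hx).2
  ext <;> simp [this]

/-- The chain map to `disk R A` determined by linear maps to `A`. -/
noncomputable def toDisk (g : ∀ n, K.X n →ₗ[R] A) : K ⟶ disk R A :=
  toConst (fun n => (g (n - 1) ∘ₗ (K.d n (n - 1)).hom).prod (g n)) (fun n x => by
    obtain ⟨m, hm⟩ : ∃ m, n + 1 - 1 = m := ⟨_, rfl⟩
    obtain rfl : m = n := by omega
    rw [hm]
    ext
    · exact (congrArg (g (m - 1)) (d_d_apply K _ _ _ x)).trans (map_zero _)
    · rfl)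

lemma diskEquiv_toDisk (g : ∀ n, K.X n →ₗ[R] A) (n : ℤ) (x : K.X (n + 1)) :
    diskEquiv R A (n + 1) ((toDisk g).f (n + 1) x) = (g n (K.d (n + 1) n x), g (n + 1) x) := by
  obtain ⟨m, hm⟩ : ∃ m, n + 1 - 1 = m := ⟨_, rfl⟩
  obtain rfl : m = n := by omega
  change (g (m + 1 - 1) (K.d (m + 1) (m + 1 - 1) x), g (m + 1) x) = _
  rw [hm]

/-- The linear maps to `A` determining a chain map to `disk R A`. -/
noncomputable def sndDisk (φ : K ⟶ disk R A) (n : ℤ) : K.X n →ₗ[R] A :=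
  LinearMap.snd R A A ∘ₗ (diskEquiv R A n).toLinearMap ∘ₗ (φ.f n).hom

lemma sndDisk_apply (φ : K ⟶ disk R A) (n : ℤ) (x : K.X n) :
    sndDisk φ n x = (diskEquiv R A n (φ.f n x)).2 := rfl

lemma sndDisk_comp_apply (ψ : K ⟶ L) (φ : L ⟶ disk R A) (n : ℤ) (x : K.X n) :
    sndDisk (ψ ≫ φ) n x = sndDisk φ n (ψ.f n x) := rfl

@[simp]
lemma sndDisk_toDisk (g : ∀ n, K.X n →ₗ[R] A) : sndDisk (toDisk g) = g := rfl

lemma diskEquiv_fst (φ : K ⟶ disk R A) (n : ℤ) (x : K.X (n + 1)) :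
    (diskEquiv R A (n + 1) (φ.f (n + 1) x)).1 = sndDisk φ n (K.d (n + 1) n x) := by
  rw [sndDisk_apply, hom_comm_apply, diskEquiv_d]

lemma hom_toDisk_ext {φ ψ : K ⟶ disk R A} (h : ∀ n x, sndDisk φ n x = sndDisk ψ n x) :
    φ = ψ :=
  hom_ext_succ fun n x => (diskEquiv R A (n + 1)).injective <| Prod.ext
    (by rw [diskEquiv_fst, diskEquiv_fst, h]) (h _ _)

/-- The chain map from `disk R A` determined by linear maps from `A`. -/
noncomputable def fromDisk (h : ∀ n, A →ₗ[R] M.X n) : disk R A ⟶ M :=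
  fromConst (fun n => (h n).coprod ((M.d (n + 1) n).hom ∘ₗ h (n + 1))) (fun n x => by
    simp [d_d_apply])

lemma fromDisk_f_apply (h : ∀ n, A →ₗ[R] M.X n) (n : ℤ) (x : (disk R A).X n) :
    (fromDisk h).f n x = h n (diskEquiv R A n x).1 +
      M.d (n + 1) n (h (n + 1) (diskEquiv R A n x).2) := rfl

lemma hom_fromDisk_ext {φ ψ : disk R A ⟶ M}
    (h : ∀ n a, φ.f n ((diskEquiv R A n).symm (a, 0)) = ψ.f n ((diskEquiv R A n).symm (a, 0))) :
    φ = ψ := by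
  ext n x
  have hx : x = (diskEquiv R A n).symm ((diskEquiv R A n x).1, 0) +
      (disk R A).d (n + 1) n ((diskEquiv R A (n + 1)).symm ((diskEquiv R A n x).2, 0)) := by
    apply (diskEquiv R A n).injective
    rw [map_add, diskEquiv_d]
    simp
  rw [hx]
  simp only [map_add]
  exact congrArg₂ _ (h _ _) (by rw [hom_comm_apply, hom_comm_apply, h])

lemma disk_mem_exProj [Module.Projective R A] : disk R A ∈ exProj R :=
  ⟨disk_exact, fun _ => (IsProjective.iff_projective (R := R) (A × A)).1 inferInstance⟩

lemma surjective_f (e : K ⟶ L) [Epi e] (n : ℤ) : Function.Surjective (e.f n) := by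
  have : Epi (e.f n) := inferInstance
  exact (ModuleCat.epi_iff_surjective _).1 this

lemma disk_projective [Module.Projective R A] : Projective (disk R A) where
  factors {E X} f e he := by
    choose h hh using fun n => Module.projective_lifting_property (e.f n).hom
      ((f.f n).hom ∘ₗ (diskEquiv R A n).symm.toLinearMap ∘ₗ LinearMap.inl R A A)
      (surjective_f e n)
    refine ⟨fromDisk h, hom_fromDisk_ext fun n a => ?_⟩
    rw [HomologicalComplex.comp_f, ConcreteCategory.comp_apply, fromDisk_f_apply]
    simpa using LinearMap.congr_fun (hh n) a

end Complexes

section Closure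

variable {R : Type u} [Ring R] {K L M : ChainComplex (ModuleCat.{u} R) ℤ}

lemma exact_of_isSES₁ {f : K ⟶ L} {g : L ⟶ M} (h : IsSES f g) (hL : ∀ n, L.ExactAt n)
    (hM : ∀ n, M.ExactAt n) : ∀ n, K.ExactAt n := by
  rw [isSES_iff] at h
  rw [exact_iff] at *
  intro n x hx
  obtain ⟨y, hy⟩ := hL n (f.f _ x) (by rw [← hom_comm_apply, hx, map_zero])
  obtain ⟨z, hz⟩ := hM (n + 1) (g.f _ y) (by
    rw [← hom_comm_apply, hy, (h _).2.1.apply_apply_eq_zero])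
  obtain ⟨w, rfl⟩ := (h _).2.2 z
  obtain ⟨v, hv⟩ := ((h _).2.1 (y - L.d _ _ w)).1 (by rw [map_sub, hom_comm_apply, hz, sub_self])
  refine ⟨v, (h _).1 ?_⟩
  rw [hom_comm_apply, hv, map_sub, d_d_apply, hy, sub_zero]

lemma exact_of_isSES₃ {f : K ⟶ L} {g : L ⟶ M} (h : IsSES f g) (hK : ∀ n, K.ExactAt n)
    (hL : ∀ n, L.ExactAt n) : ∀ n, M.ExactAt n := by
  rw [isSES_iff] at h
  rw [exact_iff] at *
  intro n x hx
  obtain ⟨m, rfl⟩ : ∃ m, n = m + 1 := ⟨n - 1, by simp⟩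
  obtain ⟨y, rfl⟩ := (h _).2.2 x
  obtain ⟨z, hz⟩ := ((h _).2.1 (L.d _ (m + 1) y)).1 (by rw [hom_comm_apply, hx])
  obtain ⟨w, hw⟩ := hK m z ((h _).1 (by rw [hom_comm_apply, hz, d_d_apply, map_zero]))
  obtain ⟨v, hv⟩ := hL _ (y - f.f _ w) (by rw [map_sub, ← hom_comm_apply, hw, hz, sub_self])
  exact ⟨g.f _ v, by rw [← hom_comm_apply, hv, map_sub, (h _).2.1.apply_apply_eq_zero, sub_zero]⟩

lemma isSES_degreewise {f : K ⟶ L} {g : L ⟶ M} (h : IsSES f g) (n : ℤ) :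
    (ShortComplex.mk (f.f n) (g.f n) (by
      rw [← HomologicalComplex.comp_f, h.1, HomologicalComplex.zero_f])).ShortExact :=
  (HomologicalComplex.shortExact_iff_degreewise_shortExact _).1 h.2 n

lemma isSES_cokernel (f : K ⟶ L) [Mono f] : IsSES f (cokernel.π f) :=
  ⟨cokernel.condition f, { exact := ShortComplex.exact_cokernel f }⟩

lemma isSES_kernel (g : L ⟶ M) [Epi g] : IsSES (kernel.ι g) g :=
  ⟨kernel.condition g, { exact := ShortComplex.exact_kernel g }⟩

lemma mem_exProj_of_retract (h : Retract K L) (hL : L ∈ exProj R) : K ∈ exProj R := by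
  refine ⟨(exact_iff K).2 fun n x hx => ?_, fun n => ?_⟩
  · obtain ⟨y, hy⟩ := (exact_iff L).1 hL.1 n (h.i.f _ x) (by rw [← hom_comm_apply, hx, map_zero])
    refine ⟨h.r.f _ y, ?_⟩
    rw [← hom_comm_apply, hy, ← ConcreteCategory.comp_apply, ← HomologicalComplex.comp_f, h.retract]
    rfl
  · have := hL.2 n
    refine Retract.projective (Y := L.X n) ⟨h.i.f n, h.r.f n, ?_⟩
    rw [← HomologicalComplex.comp_f, h.retract, HomologicalComplex.id_f]

lemma mem_exProj_of_isSES {f : K ⟶ L} {g : L ⟶ M} (h : IsSES f g) (hL : L ∈ exProj R)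
    (hM : M ∈ exProj R) : K ∈ exProj R := by
  refine ⟨exact_of_isSES₁ h hL.1 hM.1, fun n => ?_⟩
  have := hL.2 n
  have := hM.2 n
  let s := (isSES_degreewise h n).splittingOfProjective
  exact Retract.projective (Y := L.X n) ⟨f.f n, s.r, s.f_r⟩

/-- Every complex is a quotient of a projective complex. -/
lemma exists_epi_disk (M : ChainComplex (ModuleCat.{u} R) ℤ) :
    ∃ (A : Type u) (_ : AddCommGroup A) (_ : Module R A) (_ : Module.Projective R A)
      (p : disk R A ⟶ M), Epi p := by
  classical
  let c (n : ℤ) : ((Σ n, M.X n) →₀ R) →ₗ[R] M.X n :=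
    Finsupp.linearCombination R fun s => if h : s.1 = n then h ▸ s.2 else 0
  refine ⟨(Σ n, M.X n) →₀ R, inferInstance, inferInstance, inferInstance, fromDisk c, ?_⟩
  have (n : ℤ) : Epi ((fromDisk c).f n) := by
    refine (ModuleCat.epi_iff_surjective _).2 fun x =>
      ⟨(diskEquiv R _ n).symm (Finsupp.single ⟨n, x⟩ 1, 0), ?_⟩
    rw [fromDisk_f_apply, LinearEquiv.apply_symm_apply, map_zero, map_zero, add_zero]
    simp [c]
  exact HomologicalComplex.epi_of_epi_f _ this

instance : EnoughProjectives (ChainComplex (ModuleCat.{u} R) ℤ) where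
  presentation M := by
    obtain ⟨A, _, _, _, p, _⟩ := exists_epi_disk M
    have := disk_projective (R := R) (A := A)
    exact ⟨⟨_, p⟩⟩

lemma mem_exProj_of_projective (hP : Projective K) : K ∈ exProj R := by
  obtain ⟨A, _, _, _, p, _⟩ := exists_epi_disk K
  exact mem_exProj_of_retract ⟨Projective.factorThru (𝟙 K) p, p, by simp⟩ disk_mem_exProj

lemma exists_syzygy (hK : K ∈ exProj R) :
    ∃ L ∈ exProj R, ∃ (A : Type u) (_ : AddCommGroup A) (_ : Module R A)
      (_ : Module.Projective R A) (i : L ⟶ disk R A) (p : disk R A ⟶ K), IsSES i p := by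
  obtain ⟨A, _, _, _, p, _⟩ := exists_epi_disk K
  exact ⟨_, mem_exProj_of_isSES (isSES_kernel p) disk_mem_exProj hK, A, _, _, ‹_›, _, p,
    isSES_kernel p⟩

/-- A degreewise split subcomplex of an exact complex of projectives which is itself such a
complex has a quotient with the same property. -/
lemma exists_isSES_of_retraction (hK : K ∈ exProj R) (hL : L ∈ exProj R) (i : K ⟶ L)
    (r : ∀ n, L.X n →ₗ[R] K.X n) (hr : ∀ n x, r n (i.f n x) = x) :
    ∃ M ∈ exProj R, ∃ p : L ⟶ M, IsSES i p := by
  have (n : ℤ) : Mono (i.f n) :=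
    (ModuleCat.mono_iff_injective _).2 (Function.LeftInverse.injective (hr n))
  have : Mono i := HomologicalComplex.mono_of_mono_f _ this
  have h := isSES_cokernel i
  refine ⟨_, ⟨exact_of_isSES₃ h hK.1 hL.1, fun n => ?_⟩, _, h⟩
  have hn := isSES_degreewise h n
  let s := ShortComplex.Splitting.ofExactOfRetraction _ hn.exact (ModuleCat.ofHom (r n))
    (by ext x; exact hr n x) hn.epi_g
  have := hL.2 n
  exact Retract.projective (Y := L.X n) ⟨s.s, (cokernel.π i).f n, s.s_g⟩

/-- The canonical embedding of a complex in a disk. -/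
noncomputable def toDirectSumDisk (K : ChainComplex (ModuleCat.{u} R) ℤ) :
    K ⟶ disk R (DirectSum ℤ fun n => K.X n) :=
  toDisk fun n => DirectSum.lof R ℤ (fun n => K.X n) n

/-- The degreewise retraction of the canonical embedding of a complex in a disk. -/
noncomputable def fromDirectSumDisk (K : ChainComplex (ModuleCat.{u} R) ℤ) (n : ℤ) :
    (disk R (DirectSum ℤ fun n => K.X n)).X n →ₗ[R] K.X n :=
  DirectSum.component R ℤ (fun n => K.X n) n ∘ₗ LinearMap.snd R _ _ ∘ₗ
    (diskEquiv R _ n).toLinearMap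

lemma fromDirectSumDisk_toDirectSumDisk (n : ℤ) (x : K.X n) :
    fromDirectSumDisk K n ((toDirectSumDisk K).f n x) = x :=
  DirectSum.component.lof_self (R := R) (M := fun n => K.X n) n x

lemma exists_cosyzygy (hK : K ∈ exProj R) :
    ∃ L ∈ exProj R, ∃ (A : Type u) (_ : AddCommGroup A) (_ : Module R A)
      (_ : Module.Projective R A) (i : K ⟶ disk R A) (p : disk R A ⟶ L), IsSES i p := by
  have (n : ℤ) : Module.Projective R (K.X n) := (IsProjective.iff_projective _).2 (hK.2 n)
  obtain ⟨L, hL, p, h⟩ := exists_isSES_of_retraction hK disk_mem_exProj (toDirectSumDisk K)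
    (fromDirectSumDisk K) fromDirectSumDisk_toDirectSumDisk
  exact ⟨L, hL, _, _, _, inferInstance, _, p, h⟩

/-- A chain map to a disk extends along a degreewise split monomorphism. -/
lemma exists_extension_to_disk {A : Type u} [AddCommGroup A] [Module R A] (i : K ⟶ L)
    (r : ∀ n, L.X n →ₗ[R] K.X n) (hr : ∀ n x, r n (i.f n x) = x) (f : K ⟶ disk R A) :
    ∃ g : L ⟶ disk R A, i ≫ g = f :=
  ⟨toDisk fun n => sndDisk f n ∘ₗ r n, hom_toDisk_ext fun n x =>
    congrArg (sndDisk f n) (hr n x)⟩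

lemma exists_splitting {f : K ⟶ L} {g : L ⟶ M} (h : IsSES f g) (hM : M ∈ exProj R) :
    ∃ (r : ∀ n, L.X n →ₗ[R] K.X n) (s : ∀ n, M.X n →ₗ[R] L.X n),
      (∀ n x, r n (f.f n x) = x) ∧ ∀ n x, f.f n (r n x) + s n (g.f n x) = x := by
  have := hM.2
  let s (n : ℤ) := (isSES_degreewise h n).splittingOfProjective
  exact ⟨fun n => (s n).r.hom, fun n => (s n).s.hom,
    fun n x => congrArg (fun φ => φ.hom x) (s n).f_r,
    fun n x => congrArg (fun φ => φ.hom x) (s n).id⟩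

lemma exists_retraction {f : K ⟶ L} {g : L ⟶ M} (h : IsSES f g) (hM : M ∈ exProj R) :
    ∃ r : ∀ n, L.X n →ₗ[R] K.X n, ∀ n x, r n (f.f n x) = x := by
  obtain ⟨r, -, hr, -⟩ := exists_splitting h hM
  exact ⟨r, hr⟩

/-- An exact complex of projectives is projective when its extensions by exact complexes of
projectives split, and conversely. -/
lemma exProj_inter_rightPerp :
    exProj R ∩ rightPerp (exProj R) =
      {P : ChainComplex (ModuleCat.{u} R) ℤ | Projective P} := by
  ext P
  constructor
  · rintro ⟨hP, hP'⟩
    obtain ⟨L, hL, A, _, _, _, i, p, w, hS⟩ := exists_cosyzygy hP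
    obtain ⟨s⟩ := hP' L hL _ _ w hS
    have := disk_projective (R := R) (A := A)
    exact Retract.projective (Y := disk R A) ⟨i, s.r, s.f_r⟩
  · intro (hP : Projective P)
    refine ⟨mem_exProj_of_projective hP, fun Q hQ Z f g w hS => ?_⟩
    obtain ⟨A, _, _, _, p, _⟩ := exists_epi_disk P
    let j := Projective.factorThru (𝟙 P) p
    have hj : j ≫ p = 𝟙 P := by simp [j]
    obtain ⟨r, hr⟩ := exists_retraction ⟨w, hS⟩ hQ
    obtain ⟨k, hk⟩ := exists_extension_to_disk f r hr j
    exact ⟨ShortComplex.Splitting.ofExactOfRetraction _ hS.exact (k ≫ p)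
      (by rw [reassoc_of% hk, hj]) hS.epi_g⟩

/-- The right orthogonal of the class of exact complexes of projectives is thick. -/
lemma isThick_rightPerp_exProj : IsThick (rightPerp (exProj R)) := by
  have := hasExt_of_enoughProjectives.{u} (ChainComplex (ModuleCat.{u} R) ℤ)
  refine isThick_rightPerp (fun P hP => ?_) (fun P hP => ?_)
  · obtain ⟨L, hL, A, _, _, _, i, p, h⟩ := exists_syzygy hP
    exact ⟨L, hL, _, disk_projective (A := A), i, p, h⟩
  · obtain ⟨L, hL, A, _, _, _, i, p, h⟩ := exists_cosyzygy hP
    exact ⟨L, hL, _, disk_projective (A := A), i, p, h⟩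

end Closure

section Swindle

variable {R : Type u} [Ring R]

/-- The Eilenberg swindle: if `P` is a direct summand of `F`, then adding `P` to a countable sum of
copies of `F` does not change it. -/
noncomputable def swindleEquiv {P F : Type u} [AddCommGroup P] [Module R P] [AddCommGroup F]
    [Module R F] (i : P →ₗ[R] F) (r : F →ₗ[R] P) (h : ∀ p, r (i p) = p) :
    (P × (ℕ →₀ F)) ≃ₗ[R] (ℕ →₀ F) :=
  let E : (ℕ →₀ F) →ₗ[R] (ℕ →₀ F) := Finsupp.mapRange.linearMap (i ∘ₗ r)
  have hzero (x : ℕ →₀ F) : Finsupp.mapDomain Nat.succ x 0 = 0 :=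
    Finsupp.mapDomain_of_notMem_range _ _ (by simp)
  have hsucc (x : ℕ →₀ F) (k : ℕ) : Finsupp.mapDomain Nat.succ x (k + 1) = x k :=
    Finsupp.mapDomain_apply Nat.succ_injective _ _
  LinearEquiv.ofLinearMap
    ((Finsupp.lsingle 0 ∘ₗ i).coprod
      (Finsupp.lmapDomain F R Nat.succ ∘ₗ E + (LinearMap.id - E)))
    ((r ∘ₗ Finsupp.lapply 0).prod
      (Finsupp.lcomapDomain Nat.succ Nat.succ_injective ∘ₗ E + (LinearMap.id - E)))
    (by
      refine LinearMap.ext fun y => Finsupp.ext fun k => ?_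
      cases k <;> simp [E, h, hzero, hsucc, Finsupp.lcomapDomain])
    (by
      refine LinearMap.ext fun x => Prod.ext (by simp [E, h, hzero]) (Finsupp.ext fun k => ?_)
      cases k <;> simp [E, h, hzero, hsucc, Finsupp.lcomapDomain])

/-- A family of projective modules is absorbed by some free module. -/
lemma exists_absorbing_free (P : ℤ → Type u) [∀ n, AddCommGroup (P n)] [∀ n, Module R (P n)]
    [∀ n, Module.Projective R (P n)] :
    ∃ (F : Type u) (_ : AddCommGroup F) (_ : Module R F) (_ : Module.Free R F),
      ∀ n, Nonempty ((P n × F) ≃ₗ[R] F) := by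
  classical
  refine ⟨ℕ →₀ ((Σ n, P n) →₀ R), inferInstance, inferInstance, inferInstance, fun n => ?_⟩
  let r : ((Σ n, P n) →₀ R) →ₗ[R] P n :=
    Finsupp.linearCombination R fun s => if h : s.1 = n then h ▸ s.2 else 0
  obtain ⟨i, hi⟩ := Module.projective_lifting_property r LinearMap.id fun x =>
    ⟨Finsupp.single ⟨n, x⟩ 1, by simp [r]⟩
  exact ⟨swindleEquiv i r fun p => LinearMap.congr_fun hi p⟩

end Swindle

section RightPerp

variable {R : Type u} [Ring R] {P W : ChainComplex (ModuleCat.{u} R) ℤ}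

/-- The differentials of a complex as linear maps. -/
def dLin (W : ChainComplex (ModuleCat.{u} R) ℤ) (n : ℤ) : W.X (n + 1) →ₗ[R] W.X n :=
  (W.d (n + 1) n).hom

/-- Chain maps from exact complexes of projectives factor through disks as soon as chain maps from
exact complexes of free modules with constant terms are null-homotopic. -/
lemma exists_factorization_disk
    (hW : ∀ (B : Type u) (δ : ℤ → (B →₀ R) →ₗ[R] (B →₀ R)), IsExactFamily δ →
      AllNullHomotopic (W := fun n => W.X n) (dLin W) δ)
    (hP : P ∈ exProj R) (f : P ⟶ W) :
    ∃ (A : Type u) (_ : AddCommGroup A) (_ : Module R A) (a : P ⟶ disk R A)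
      (b : disk R A ⟶ W), a ≫ b = f := by
  have (n : ℤ) : Module.Projective R (P.X n) := (IsProjective.iff_projective _).2 (hP.2 n)
  obtain ⟨F, _, _, _, hF⟩ := exists_absorbing_free (R := R) (fun n => P.X n)
  let e (n : ℤ) : (P.X n × F × F) ≃ₗ[R] F × F :=
    (LinearEquiv.prodAssoc R _ F F).symm ≪≫ₗ ((hF n).some.prodCongr (LinearEquiv.refl R F))
  let δ (n : ℤ) : F × F →ₗ[R] F × F :=
    (e (n - 1)).toLinearMap ∘ₗ ((P.d n (n - 1)).hom.prodMap
      (LinearMap.inr R F F ∘ₗ LinearMap.fst R F F)) ∘ₗ (e n).symm.toLinearMap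
  have hδ' (n : ℤ) (x : P.X (n + 1) × F × F) :
      δ (n + 1) (e (n + 1) x) = e n (P.d (n + 1) n x.1, 0, x.2.1) := by
    obtain ⟨m, hm⟩ : ∃ m, n + 1 - 1 = m := ⟨_, rfl⟩
    obtain rfl : m = n := by omega
    have : δ (m + 1) (e (m + 1) x) = e (m + 1 - 1) (P.d (m + 1) (m + 1 - 1) x.1, 0, x.2.1) := by
      simp [δ]
    rw [this, hm]
  have hδ : IsExactFamily δ := by
    refine ⟨fun n x => ?_, fun n x hx => ?_⟩
    · obtain ⟨m, rfl⟩ : ∃ m, n = m + 1 := ⟨n - 1, by simp⟩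
      obtain ⟨x, rfl⟩ := (e (m + 1 + 1)).surjective x
      rw [hδ', hδ']
      simp [d_d_apply]
    · obtain ⟨m, rfl⟩ : ∃ m, n = m + 1 := ⟨n - 1, by simp⟩
      obtain ⟨x, rfl⟩ := (e (m + 1)).surjective x
      rw [hδ', LinearEquiv.map_eq_zero_iff] at hx
      simp only [Prod.mk_eq_zero, true_and] at hx
      obtain ⟨y, hy⟩ := (exact_iff P).1 hP.1 m x.1 hx.1
      refine ⟨e _ (y, x.2.2, 0), ?_⟩
      rw [hδ', hy]
      congr 1
      ext <;> simp [hx.2]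
  obtain ⟨h, hh⟩ := AllNullHomotopic.of_conj (W := fun n => W.X n) (dLin W)
    (Module.Free.chooseBasis R (F × F)).repr
    (hW _ _ (hδ.conj _)) (fun n => (f.f n).hom ∘ₗ LinearMap.fst R _ _ ∘ₗ (e n).symm.toLinearMap)
    (fun n x => by
      obtain ⟨x, rfl⟩ := (e (n + 1)).surjective x
      rw [hδ']
      simp only [LinearMap.comp_apply, LinearEquiv.coe_coe, LinearEquiv.symm_apply_apply,
        LinearMap.fst_apply]
      exact hom_comm_apply f (n + 1) n x.1)
  refine ⟨F × F, inferInstance, inferInstance,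
    toDisk fun n => (e n).toLinearMap ∘ₗ LinearMap.inl R _ _, fromDisk h, ?_⟩
  refine hom_ext_succ fun n x => ?_
  rw [HomologicalComplex.comp_f, ConcreteCategory.comp_apply, fromDisk_f_apply, diskEquiv_toDisk]
  have := hh (n + 1) (e _ (x, 0))
  rw [hδ'] at this
  simp only [LinearMap.comp_apply, LinearEquiv.coe_coe, LinearEquiv.symm_apply_apply,
    LinearMap.fst_apply, LinearMap.inl_apply] at this ⊢
  exact this.symm

lemma mem_rightPerp_of_allNullHomotopic
    (hW : ∀ (B : Type u) (δ : ℤ → (B →₀ R) →ₗ[R] (B →₀ R)), IsExactFamily δ →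
      AllNullHomotopic (W := fun n => W.X n) (dLin W) δ) : W ∈ rightPerp (exProj R) := by
  intro P hP
  have := hasExt_of_enoughProjectives.{u} (ChainComplex (ModuleCat.{u} R) ℤ)
  obtain ⟨L, hL, A, _, _, _, i, p, hS⟩ := exists_syzygy hP
  have := disk_projective (R := R) (A := A)
  rw [ext1IsZero_iff]
  refine subsingleton_ext_of_extends hS fun f => ?_
  obtain ⟨A', _, _, a, b, rfl⟩ := exists_factorization_disk hW hL f
  obtain ⟨r, hr⟩ := exists_retraction hS hP
  obtain ⟨g, rfl⟩ := exists_extension_to_disk i r hr a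
  exact ⟨g ≫ b, by simp⟩

end RightPerp

section SmallObject

open MorphismProperty

/-- A small family of monomorphisms in a Grothendieck abelian category permits the small object
argument. -/
lemma hasSmallObjectArgument_of_le_monomorphisms {C : Type u} [Category.{v} C] [Abelian C]
    [IsGrothendieckAbelian.{w} C] (I : MorphismProperty C) [MorphismProperty.IsSmall.{w} I]
    (hI : I ≤ monomorphisms C) : HasSmallObjectArgument.{w} I := by
  obtain ⟨κ, hκ', hκ⟩ := HasCardinalLT.exists_regular_cardinal_forall.{w}
    (fun i : I.toSet => Subobject i.1.left)
  have : Fact κ.IsRegular := ⟨hκ'⟩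
  have : Nonempty κ.ord.ToType := by simpa using hκ'.ne_zero
  have := WellFoundedLT.toOrderBot κ.ord.ToType
  exact ⟨κ, inferInstance, inferInstance,
    { preservesColimit {A B X Y} i hi f hf := by
        let hf' : (monomorphisms C).TransfiniteCompositionOfShape κ.ord.ToType f :=
          { toTransfiniteCompositionOfShape := hf.toTransfiniteCompositionOfShape
            map_mem j hj := by
              have := (hf.attachCells j hj).pushouts_coproducts
              simp only [ofHoms_homFamily] at this
              refine (?_ : _ ≤ monomorphisms C) _ this
              simp only [pushouts_le_iff, coproducts_le_iff]
              exact hI }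
        have (j j' : κ.ord.ToType) (φ : j ⟶ j') : Mono (hf'.F.map φ) := hf'.mem_map φ
        apply IsGrothendieckAbelian.preservesColimit_coyoneda_obj_of_mono (Y := hf'.F) (κ := κ)
        exact hκ ⟨Arrow.mk i, hi⟩ }⟩

end SmallObject

section Lifting

variable {R : Type u} [Ring R] {A B : Type u} [AddCommGroup A] [Module R A] [AddCommGroup B]
  [Module R B] {K L M : ChainComplex (ModuleCat.{u} R) ℤ}

lemma exists_comp_eq_of_injective {M N E : Type u} [AddCommGroup M] [Module R M] [AddCommGroup N]
    [Module R N] [AddCommGroup E] [Module R E] [Module.Injective R E] (u : M →ₗ[R] E)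
    (v : M →ₗ[R] N) (huv : ∀ x, v x = 0 → u x = 0) : ∃ t : N →ₗ[R] E, ∀ x, t (v x) = u x := by
  obtain ⟨t, ht⟩ := Module.Injective.out (LinearMap.range v).subtype Subtype.val_injective
    ((LinearMap.ker v).liftQ u huv ∘ₗ v.quotKerEquivRange.symm.toLinearMap)
  refine ⟨t, fun x => ?_⟩
  have := ht (v.quotKerEquivRange (Submodule.Quotient.mk x))
  rw [LinearMap.comp_apply, LinearEquiv.coe_coe, LinearEquiv.symm_apply_apply] at this
  exact this

/-- The chain map between disks induced by a linear map. -/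
noncomputable def diskMap (q : A →ₗ[R] B) : disk R A ⟶ disk R B :=
  toDisk fun n => q ∘ₗ sndDisk (𝟙 _) n

lemma sndDisk_comp_diskMap (q : A →ₗ[R] B) (f : K ⟶ disk R A) (n : ℤ) (x : K.X n) :
    sndDisk (f ≫ diskMap q) n x = q (sndDisk f n x) := rfl

/-- The projection of a disk to the complex with the same module in each degree and zero
differentials. -/
noncomputable def diskFst (R : Type u) [Ring R] (A : Type u) [AddCommGroup A] [Module R A] :
    disk R A ⟶ constComplex (R := R) (A := A) (fun _ => 0) (by simp) :=
  toConst (fun n => LinearMap.fst R A A ∘ₗ (diskEquiv R A n).toLinearMap) (fun n x => by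
    simp [diskEquiv_d])

lemma constEquiv_comp_diskFst (f : K ⟶ disk R A) (n : ℤ) (x : K.X (n + 1)) :
    constEquiv _ _ (n + 1) ((f ≫ diskFst R A).f (n + 1) x) = sndDisk f n (K.d (n + 1) n x) :=
  diskEquiv_fst f n x

lemma hasLiftingProperty_diskMap {i : K ⟶ L} {p : L ⟶ M} (h : IsSES i p) (hM : M ∈ exProj R)
    {q : A →ₗ[R] B} (hq : Function.Surjective q) : HasLiftingProperty i (diskMap q) := by
  obtain ⟨r, s, hr, hs⟩ := exists_splitting h hM
  have (n : ℤ) : Module.Projective R (M.X n) := (IsProjective.iff_projective _).2 (hM.2 n)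
  refine ⟨fun {f g} sq => ?_⟩
  choose t ht using fun n => Module.projective_lifting_property q (sndDisk g n ∘ₗ s n) hq
  have hsq (n : ℤ) (x : K.X n) : q (sndDisk f n x) = sndDisk g n (i.f n x) := by
    rw [← sndDisk_comp_diskMap, sq.w, sndDisk_comp_apply]
  refine ⟨⟨⟨toDisk fun n => sndDisk f n ∘ₗ r n + t n ∘ₗ (p.f n).hom,
    hom_toDisk_ext fun n x => ?_, hom_toDisk_ext fun n x => ?_⟩⟩⟩
  · rw [sndDisk_comp_apply, sndDisk_toDisk]
    have : p.f n (i.f n x) = 0 := ((isSES_iff.1 h) n).2.1.apply_apply_eq_zero x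
    simp only [LinearMap.add_apply, LinearMap.comp_apply, hr]
    exact (congrArg (sndDisk f n x + t n ·) this).trans (by simp)
  · rw [sndDisk_comp_diskMap, sndDisk_toDisk]
    simp only [LinearMap.add_apply, LinearMap.comp_apply, map_add, hsq]
    refine (congrArg (_ + ·) (LinearMap.congr_fun (ht n) _)).trans ?_
    rw [LinearMap.comp_apply, ← map_add]
    exact congrArg _ (hs n x)

lemma hasLiftingProperty_diskFst {i : K ⟶ L} {p : L ⟶ M} (h : IsSES i p) (hM : M ∈ exProj R)
    [Module.Injective R A] : HasLiftingProperty i (diskFst R A) := by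
  obtain ⟨r, hr⟩ := exists_retraction h hM
  have hp := isSES_iff.1 h
  refine ⟨fun {f g} sq => ?_⟩
  let g' (n : ℤ) : L.X n →ₗ[R] A := (constEquiv _ _ n).toLinearMap ∘ₗ (g.f n).hom
  have hg' (n : ℤ) (x : L.X (n + 1)) : g' n (L.d (n + 1) n x) = 0 := by
    change constEquiv _ _ n (g.f n _) = 0
    rw [hom_comm_apply, constEquiv_d]
    rfl
  have hfg (n : ℤ) (x : K.X (n + 1)) : g' (n + 1) (i.f (n + 1) x) =
      sndDisk f n (K.d (n + 1) n x) := by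
    rw [← constEquiv_comp_diskFst, sq.w]
    rfl
  have key (n : ℤ) : ∃ t : M.X n →ₗ[R] A, ∀ x, t (p.f n (L.d (n + 1) n x)) =
      g' (n + 1) x - sndDisk f n (r n (L.d (n + 1) n x)) := by
    refine exists_comp_eq_of_injective (g' (n + 1) - sndDisk f n ∘ₗ r n ∘ₗ (L.d (n + 1) n).hom)
      ((p.f n).hom ∘ₗ (L.d (n + 1) n).hom) fun x (hx : p.f n (L.d (n + 1) n x) = 0) => ?_
    rw [hom_comm_apply] at hx
    obtain ⟨z, hz⟩ := (exact_iff M).1 hM.1 n _ hx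
    obtain ⟨w, rfl⟩ := (hp _).2.2 z
    obtain ⟨y, hy⟩ := ((hp _).2.1 (x - L.d _ _ w)).1 (by
      rw [map_sub, hom_comm_apply, hz, sub_self])
    obtain rfl : x = i.f _ y + L.d _ _ w := by rw [hy, sub_add_cancel]
    change g' (n + 1) (_ + _) - sndDisk f n (r n (L.d (n + 1) n (_ + _))) = 0
    rw [map_add, map_add, d_d_apply, hg', ← hom_comm_apply, add_zero, add_zero, hr, hfg, sub_self]
  choose t ht using key
  refine ⟨⟨⟨toDisk fun n => sndDisk f n ∘ₗ r n + t n ∘ₗ (p.f n).hom,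
    hom_toDisk_ext fun n x => ?_, hom_ext_succ fun n x => ?_⟩⟩⟩
  · rw [sndDisk_comp_apply, sndDisk_toDisk]
    have : p.f n (i.f n x) = 0 := (hp n).2.1.apply_apply_eq_zero x
    simp only [LinearMap.add_apply, LinearMap.comp_apply, hr]
    exact (congrArg (sndDisk f n x + t n ·) this).trans (by simp)
  · apply (constEquiv _ _ (n + 1)).injective
    rw [constEquiv_comp_diskFst, sndDisk_toDisk]
    exact (congrArg (_ + ·) (ht n x)).trans (add_sub_cancel _ _)

lemma hasLiftingProperty_disk_zero {i : K ⟶ L} {p : L ⟶ M} (h : IsSES i p) (hM : M ∈ exProj R) :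
    HasLiftingProperty i (0 : disk R A ⟶ 0) := by
  obtain ⟨r, hr⟩ := exists_retraction h hM
  refine ⟨fun {f g} sq => ?_⟩
  obtain ⟨l, hl⟩ := exists_extension_to_disk i r hr f
  exact ⟨⟨⟨l, hl, (isZero_zero _).eq_of_tgt _ _⟩⟩⟩

end Lifting

section SmallObjectCotorsion

open MorphismProperty

variable {R : Type u} [Ring R] {K L M : ChainComplex (ModuleCat.{u} R) ℤ}
  {I : MorphismProperty (ChainComplex (ModuleCat.{u} R) ℤ)}

lemma isPushout_of_isSES {f : K ⟶ L} {g : L ⟶ M} (h : IsSES f g) :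
    IsPushout (0 : K ⟶ 0) f (0 : 0 ⟶ M) g := by
  obtain ⟨w, h⟩ := h
  have := h.epi_g
  refine ⟨⟨by simp [w]⟩, ⟨PushoutCocone.IsColimit.mk _ (fun s => h.gIsCokernel.desc
    (CokernelCofork.ofπ s.inr (by rw [← s.condition]; simp))) (fun s => by
      exact (isZero_zero _).eq_of_src _ _)
    (fun s => h.gIsCokernel.fac _ WalkingParallelPair.one) (fun s m _ hm => ?_)⟩⟩
  refine (cancel_epi g).1 (hm.trans ?_)
  exact (h.gIsCokernel.fac (CokernelCofork.ofπ s.inr _) WalkingParallelPair.one).symm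

lemma isPullback_of_isSES {f : K ⟶ L} {g : L ⟶ M} (h : IsSES f g) :
    IsPullback f (0 : K ⟶ 0) g (0 : 0 ⟶ M) := by
  obtain ⟨w, h⟩ := h
  have := h.mono_f
  refine ⟨⟨by simp [w]⟩, ⟨PullbackCone.IsLimit.mk _ (fun s => h.fIsKernel.lift
    (KernelFork.ofι s.fst (by rw [s.condition]; simp)))
    (fun s => h.fIsKernel.fac _ WalkingParallelPair.zero) (fun s => by
      exact (isZero_zero _).eq_of_tgt _ _) (fun s m hm _ => ?_)⟩⟩
  refine (cancel_mono f).1 (hm.trans ?_)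
  exact (h.fIsKernel.fac (KernelFork.ofι s.fst _) WalkingParallelPair.zero).symm

section

variable (hI : ∀ ⦃K L : ChainComplex (ModuleCat.{u} R) ℤ⦄ (i : K ⟶ L), I i →
  ∃ M ∈ exProj R, ∃ p : L ⟶ M, IsSES i p)

include hI

lemma mono_of_rlp_llp {j : K ⟶ L} (hj : I.rlp.llp j) : Mono j := by
  have (n : ℤ) : Mono ((toDirectSumDisk K).f n) := (ModuleCat.mono_iff_injective _).2
    (Function.LeftInverse.injective (fromDirectSumDisk_toDirectSumDisk n))
  have : Mono (toDirectSumDisk K) := HomologicalComplex.mono_of_mono_f _ this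
  have := hj (0 : disk R (DirectSum ℤ fun n => K.X n) ⟶ 0) fun _ _ i hi => by
    obtain ⟨M, hM, p, h⟩ := hI i hi
    exact hasLiftingProperty_disk_zero h hM
  have sq : CommSq (toDirectSumDisk K) j (0 : disk R (DirectSum ℤ fun n => K.X n) ⟶ 0) 0 := ⟨by simp⟩
  exact mono_of_mono_fac sq.fac_left

lemma projective_of_rlp_llp (hK : I.rlp.llp (0 : 0 ⟶ K)) (n : ℤ) : Projective (K.X n) := by
  let B := DirectSum ℤ fun n => K.X n
  let q : (B →₀ R) →ₗ[R] B := Finsupp.linearCombination R id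
  have := hK (diskMap q) fun _ _ i hi => by
    obtain ⟨M, hM, p, h⟩ := hI i hi
    exact hasLiftingProperty_diskMap h hM (Finsupp.linearCombination_id_surjective R B)
  have sq : CommSq 0 (0 : 0 ⟶ K) (diskMap q)
    (toDisk fun n => DirectSum.lof R ℤ (fun n => K.X n) n) := ⟨by simp⟩
  have hl (x : K.X n) : q (sndDisk sq.lift n x) = DirectSum.lof R ℤ (fun n => K.X n) n x := by
    rw [← sndDisk_comp_diskMap, sq.fac_right, sndDisk_toDisk]
  have : Projective (ModuleCat.of R (B →₀ R)) := (IsProjective.iff_projective _).1 inferInstance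
  refine Retract.projective (Y := ModuleCat.of R (B →₀ R)) ⟨ModuleCat.ofHom (sndDisk sq.lift n),
    ModuleCat.ofHom (DirectSum.component R ℤ (fun n => K.X n) n ∘ₗ q), ?_⟩
  ext x
  exact (congrArg (DirectSum.component R ℤ (fun n => K.X n) n) (hl x)).trans
    (DirectSum.component.lof_self R (M := fun n => K.X n) n x)

lemma exact_of_rlp_llp (hK : I.rlp.llp (0 : 0 ⟶ K)) : ∀ n, K.ExactAt n := by
  let Q (n : ℤ) := K.X n ⧸ LinearMap.range (K.d (n + 1) n).hom
  let ι := Injective.ι (ModuleCat.of R (DirectSum ℤ Q))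
  have hι : Function.Injective ι := (ModuleCat.mono_iff_injective _).1 inferInstance
  let E : ModuleCat.{u} R := Injective.under (ModuleCat.of R (DirectSum ℤ Q))
  have : Injective (ModuleCat.of R E) := inferInstanceAs (Injective E)
  have : Module.Injective R E := Module.injective_module_of_injective_object R E
  have := hK (diskFst R E) fun _ _ i hi => by
    obtain ⟨M, hM, p, h⟩ := hI i hi
    exact hasLiftingProperty_diskFst h hM
  let g (n : ℤ) : K.X n →ₗ[R] E :=
    ι.hom ∘ₗ DirectSum.lof R ℤ Q n ∘ₗ (LinearMap.range (K.d (n + 1) n).hom).mkQ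
  have hg (n : ℤ) (x : K.X n) : g n x = 0 ↔ ∃ y, K.d (n + 1) n y = x := by
    have : g n x = 0 ↔ (LinearMap.range (K.d (n + 1) n).hom).mkQ x = 0 := by
      refine ⟨fun h => DirectSum.of_injective n (hι ?_), fun h => ?_⟩
      · exact h.trans (by simp)
      · simp only [g, LinearMap.comp_apply, h, map_zero]
    rw [this, Submodule.mkQ_apply, Submodule.Quotient.mk_eq_zero]
    rfl
  have sq : CommSq 0 (0 : 0 ⟶ K) (diskFst R E)
    (toConst g fun n x => (hg n _).2 ⟨x, rfl⟩) := ⟨by simp⟩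
  refine (exact_iff K).2 fun n x hx => (hg _ x).1 ?_
  have := constEquiv_comp_diskFst sq.lift n x
  rw [sq.fac_right, hx, map_zero] at this
  exact this

lemma mem_exProj_of_rlp_llp (hK : I.rlp.llp (0 : 0 ⟶ K)) : K ∈ exProj R :=
  ⟨exact_of_rlp_llp hI hK, projective_of_rlp_llp hI hK⟩

variable [HasSmallObjectArgument.{u} I]

lemma exists_isSES_to (M : ChainComplex (ModuleCat.{u} R) ℤ) :
    ∃ W Q : ChainComplex (ModuleCat.{u} R) ℤ, I.rlp (0 : W ⟶ 0) ∧ Q ∈ exProj R ∧ SES M W Q := by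
  let fac := factorizationData I.rlp.llp I.rlp (0 : M ⟶ 0)
  have := mono_of_rlp_llp hI fac.hi
  have h := isSES_cokernel fac.i
  refine ⟨fac.Z, _, ?_, mem_exProj_of_rlp_llp hI (of_isPushout (isPushout_of_isSES h) fac.hi),
    _, _, h⟩
  rw [← (isZero_zero _).eq_of_tgt fac.p 0]
  exact fac.hp

lemma exists_isSES_from (hI' : I (0 : 0 ⟶ disk R R)) (M : ChainComplex (ModuleCat.{u} R) ℤ) :
    ∃ W Q : ChainComplex (ModuleCat.{u} R) ℤ, I.rlp (0 : W ⟶ 0) ∧ Q ∈ exProj R ∧ SES W Q M := by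
  classical
  let fac := factorizationData I.rlp.llp I.rlp (0 : 0 ⟶ M)
  have hQ : fac.Z ∈ exProj R := mem_exProj_of_rlp_llp hI (by
    rw [← (isZero_zero _).eq_of_src fac.i 0]
    exact fac.hi)
  have (n : ℤ) : Epi (fac.p.f n) := by
    refine (ModuleCat.epi_iff_surjective _).2 fun x => ?_
    have sq : CommSq 0 (0 : 0 ⟶ disk R R) fac.p
      (fromDisk fun k =>
        LinearMap.toSpanSingleton R (M.X k) (Pi.single (M := fun k => M.X k) n x k)) := ⟨by simp⟩
    have := fac.hp _ hI'
    refine ⟨sq.lift.f n ((diskEquiv R R n).symm (1, 0)), ?_⟩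
    rw [← ConcreteCategory.comp_apply, ← HomologicalComplex.comp_f, sq.fac_right,
      fromDisk_f_apply]
    simp
  have : Epi fac.p := HomologicalComplex.epi_of_epi_f _ this
  have h := isSES_kernel fac.p
  exact ⟨_, _, of_isPullback (isPullback_of_isSES h) fac.hp, hQ, _, _, h⟩

end

end SmallObjectCotorsion

section Generators

open MorphismProperty

variable {R : Type u} [Ring R] {W : ChainComplex (ModuleCat.{u} R) ℤ}

/-- The embedding into a disk of an exact complex with constant terms. -/
noncomputable def constToDisk {A : Type u} [AddCommGroup A] [Module R A] {δ : ℤ → A →ₗ[R] A}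
    (hδ : IsExactFamily δ) : constComplex δ hδ.comp_eq_zero ⟶ disk R A :=
  toDisk fun n => (constEquiv δ hδ.comp_eq_zero n).toLinearMap

/-- The embeddings into disks of the exact complexes of free modules on subsets of `B`, together
with the inclusion of the zero complex in the free disk of rank one. -/
def generators (R : Type u) [Ring R] (B : Type u) :
    MorphismProperty (ChainComplex (ModuleCat.{u} R) ℤ) :=
  ofHoms (fun s : Σ J : Set B, {δ : ℤ → (J →₀ R) →ₗ[R] (J →₀ R) // IsExactFamily δ} =>
    constToDisk s.2.2) ⊔ ofHoms (fun _ : Unit => (0 : 0 ⟶ disk R R))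

variable {B : Type u}

lemma constToDisk_mem_generators {J : Set B} {δ : ℤ → (J →₀ R) →ₗ[R] (J →₀ R)}
    (hδ : IsExactFamily δ) : generators R B (constToDisk hδ) :=
  Or.inl (ofHoms.mk (⟨J, δ, hδ⟩ : Σ J : Set B, {δ : ℤ → (J →₀ R) →ₗ[R] (J →₀ R) //
    IsExactFamily δ}))

lemma zero_mem_generators : generators R B (0 : 0 ⟶ disk R R) :=
  Or.inr (ofHoms.mk ())

lemma exists_isSES_of_generators ⦃K L : ChainComplex (ModuleCat.{u} R) ℤ⦄ (i : K ⟶ L)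
    (hi : generators R B i) : ∃ M ∈ exProj R, ∃ p : L ⟶ M, IsSES i p := by
  rcases hi with ⟨⟨s⟩⟩ | ⟨⟨_⟩⟩
  · exact exists_isSES_of_retraction ⟨constComplex_exact_iff.2 s.2.2, fun _ =>
      (IsProjective.iff_projective (R := R) (s.1 →₀ R)).1 inferInstance⟩ disk_mem_exProj _
      (fun n => (constEquiv s.2.1 s.2.2.comp_eq_zero n).symm.toLinearMap ∘ₗ LinearMap.snd R _ _ ∘ₗ
        (diskEquiv R _ n).toLinearMap) fun n x => rfl
  · refine exists_isSES_of_retraction (mem_exProj_of_projective inferInstance) disk_mem_exProj _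
      (fun n => 0) fun n x => ?_
    have := (HomologicalComplex.eval (ModuleCat.{u} R) (ComplexShape.down ℤ) n).map_isZero
      (isZero_zero _)
    exact @Subsingleton.elim _ (ModuleCat.subsingleton_of_isZero this) _ _

instance : HasSmallObjectArgument.{u} (generators R B) := by
  have : MorphismProperty.IsSmall.{u} (generators R B) :=
    ⟨inferInstanceAs (Small.{u} ↑(MorphismProperty.toSet _ ∪ MorphismProperty.toSet _))⟩
  refine hasSmallObjectArgument_of_le_monomorphisms _ fun K L i hi => ?_
  obtain ⟨M, -, p, w, h⟩ := exists_isSES_of_generators i hi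
  exact h.mono_f

lemma allNullHomotopic_of_hasLiftingProperty {A : Type u} [AddCommGroup A] [Module R A]
    {δ : ℤ → A →ₗ[R] A} (hδ : IsExactFamily δ)
    [HasLiftingProperty (constToDisk hδ) (0 : W ⟶ 0)] :
    AllNullHomotopic (W := fun n => W.X n) (dLin W) δ := by
  intro f hf
  have sq : CommSq (fromConst f hf) (constToDisk hδ) (0 : W ⟶ 0) 0 := ⟨by simp⟩
  refine ⟨fun n => (sq.lift.f n).hom ∘ₗ (diskEquiv R A n).symm.toLinearMap ∘ₗ
    LinearMap.inl R A A, fun n x => ?_⟩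
  obtain ⟨m, rfl⟩ : ∃ m, n = m + 1 := ⟨n - 1, by simp⟩
  obtain ⟨y, rfl⟩ := (constEquiv δ hδ.comp_eq_zero (m + 1)).surjective x
  have hl : sq.lift.f (m + 1) ((constToDisk hδ).f (m + 1) y) = f (m + 1) (constEquiv _ _ _ y) := by
    rw [← ConcreteCategory.comp_apply, ← HomologicalComplex.comp_f, sq.fac_left]
    rfl
  have hy : (constToDisk hδ).f (m + 1) y =
      (diskEquiv R A (m + 1)).symm (δ (m + 1) (constEquiv _ _ _ y), 0) +
      (disk R A).d (m + 1 + 1) (m + 1)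
        ((diskEquiv R A (m + 1 + 1)).symm (constEquiv _ _ _ y, 0)) := by
    apply (diskEquiv R A (m + 1)).injective
    rw [map_add, diskEquiv_d, constToDisk, diskEquiv_toDisk]
    simp [constEquiv_d]
  rw [← hl, hy, map_add, hom_comm_apply]
  rfl

lemma mem_rightPerp_of_rlp_generators [Infinite B] (hB : Cardinal.mk R ≤ Cardinal.mk B)
    (hW : (generators R B).rlp (0 : W ⟶ 0)) : W ∈ rightPerp (exProj R) := by
  refine mem_rightPerp_of_allNullHomotopic fun A δ hδ =>
    allNullHomotopic_of_small (W := fun n => W.X n) (dLin W) (fun n x => d_d_apply W _ _ _ x)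
      (Cardinal.aleph0_le_mk B) hB (fun U hU δ hδ => ?_) hδ
  obtain ⟨j⟩ := hU
  let e := Finsupp.domLCongr (R := R) (M := R) (Equiv.ofInjective j j.injective)
  have := hW _ (constToDisk_mem_generators (hδ.conj e))
  exact AllNullHomotopic.of_conj (W := fun n => W.X n) (dLin W) e
    (allNullHomotopic_of_hasLiftingProperty (hδ.conj e))

lemma isCompletePair_exProj : IsCompletePair (exProj R) (rightPerp (exProj R)) := by
  have hB : Cardinal.mk R ≤ Cardinal.mk (ℕ ⊕ R) := Cardinal.mk_le_of_injective Sum.inr_injective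
  constructor
  · intro M
    obtain ⟨W, Q, hW, hQ, h⟩ := exists_isSES_from (exists_isSES_of_generators (B := ℕ ⊕ R))
      zero_mem_generators M
    exact ⟨Q, W, hQ, mem_rightPerp_of_rlp_generators hB hW, h⟩
  · intro M
    obtain ⟨W, Q, hW, hQ, h⟩ := exists_isSES_to (exists_isSES_of_generators (B := ℕ ⊕ R)) M
    exact ⟨Q, W, hQ, mem_rightPerp_of_rlp_generators hB hW, h⟩

lemma isCotorsionPair_exProj : IsCotorsionPair (exProj R) (rightPerp (exProj R)) := by
  refine ⟨Set.Subset.antisymm (fun P hP W hW => hW P hP) fun P hP => ?_, rfl⟩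
  obtain ⟨Q, W, hQ, hW, f, g, w, h⟩ := isCompletePair_exProj.1 P
  obtain ⟨s⟩ := hP W hW f g w h
  exact mem_exProj_of_retract ⟨s.s, g, s.s_g⟩ hQ

lemma isHereditaryPair_exProj : IsHereditaryPair (exProj R) (rightPerp (exProj R)) :=
  ⟨fun _ _ _ hB hB' ⟨_, _, h⟩ => mem_exProj_of_isSES h hB hB',
    fun _ _ _ hB hB' h => (isThick_rightPerp_exProj.2 h).1 hB hB'⟩

end Generators

end ExactProj

/-- Proposition (the exact Proj cotorsion pair): for any ring `R`, let `exP` be the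
class of exact complexes of projective `R`-modules and `Vprj = (exP)ᗮ`.  Then
`(exP, Vprj)` is a complete hereditary cotorsion pair in `Ch(R)`, `Vprj` is thick,
and `exP ∩ Vprj` is exactly the class of projective objects of `Ch(R)`. -/
theorem exact_proj_cotorsion_pair (R : Type u) [Ring R] :
    IsCompleteCotorsionPair
      {P : ChainComplex (ModuleCat.{u} R) ℤ |
        (∀ n, P.ExactAt n) ∧ ∀ n, Projective (P.X n)}
      (rightPerp {P : ChainComplex (ModuleCat.{u} R) ℤ |
        (∀ n, P.ExactAt n) ∧ ∀ n, Projective (P.X n)}) ∧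
    IsHereditaryPair
      {P : ChainComplex (ModuleCat.{u} R) ℤ |
        (∀ n, P.ExactAt n) ∧ ∀ n, Projective (P.X n)}
      (rightPerp {P : ChainComplex (ModuleCat.{u} R) ℤ |
        (∀ n, P.ExactAt n) ∧ ∀ n, Projective (P.X n)}) ∧
    IsThick
      (rightPerp {P : ChainComplex (ModuleCat.{u} R) ℤ |
        (∀ n, P.ExactAt n) ∧ ∀ n, Projective (P.X n)}) ∧
    ({P : ChainComplex (ModuleCat.{u} R) ℤ |
        (∀ n, P.ExactAt n) ∧ ∀ n, Projective (P.X n)} ∩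
      rightPerp {P : ChainComplex (ModuleCat.{u} R) ℤ |
        (∀ n, P.ExactAt n) ∧ ∀ n, Projective (P.X n)} =
      {P : ChainComplex (ModuleCat.{u} R) ℤ | Projective P}) := by
  exact ⟨⟨ExactProj.isCotorsionPair_exProj, ExactProj.isCompletePair_exProj⟩,
    ExactProj.isHereditaryPair_exProj, ExactProj.isThick_rightPerp_exProj,
    ExactProj.exProj_inter_rightPerp⟩
end
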